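/- For every Boolean function f ∈ B_8, the second-order nonlinearity satisfies nl_2(f) ≤ 96; that is, the covering radius of RM(2,8) is at most 96. -/

import Mathlib

open scoped BigOperators

/-- Boolean functions in `n` variables. -/
abbrev BF (n : ℕ) := (Fin n → ZMod 2) → ZMod 2

/-- Hamming distance between two Boolean functions. -/
def hd {n : ℕ} (f g : BF n) : ℕ :=
  (Finset.univ.filter (fun x : Fin n → ZMod 2 => f x ≠ g x)).card

/-- The Reed--Muller code `RM(r,n)`: Boolean functions given by evaluation of a
multivariate polynomial over `F_2` of total degree at most `r`. -/
def RM (r n : ℕ) : Set (BF n) :=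
  {f | ∃ p : MvPolynomial (Fin n) (ZMod 2),
    p.totalDegree ≤ r ∧ ∀ x, f x = MvPolynomial.eval x p}

/-- The `r`-th order nonlinearity of a Boolean function. -/
noncomputable def nl (r : ℕ) {n : ℕ} (f : BF n) : ℕ :=
  sInf {d | ∃ g ∈ RM r n, d = hd f g}

/-- Concatenation `f1 || f2` of two Boolean functions. -/
def concat {n : ℕ} (f1 f2 : BF n) : BF (n + 1) :=
  fun x => (1 + x (Fin.last n)) * f1 (x ∘ Fin.castSucc)
    + x (Fin.last n) * f2 (x ∘ Fin.castSucc)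

/-- A Boolean function is homogeneous quadratic if it is of the form
`∑_{i<j} a_{ij} x_i x_j`. -/
def HomQuad {n : ℕ} (g : BF n) : Prop :=
  ∃ a : Fin n → Fin n → ZMod 2,
    ∀ x, g x = ∑ i : Fin n, ∑ j : Fin n, (if i < j then a i j * x i * x j else 0)

/-- `Fh f r` is the set of homogeneous quadratic functions `g` with `nl(f+g) = r`. -/
def Fh {n : ℕ} (f : BF n) (r : ℕ) : Set (BF n) :=
  {g | HomQuad g ∧ nl 1 (f + g) = r}

/-- `NFh f r = |Fh f r|`. -/
noncomputable def NFh {n : ℕ} (f : BF n) (r : ℕ) : ℕ := (Fh f r).ncard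

/-- The set of 6-variable Boolean functions with nonlinearity 16. -/
def S16 : Set (BF 6) := {f | nl 1 f = 16}

/-- `f1` and `f2` are affine equivalent modulo `RM(r,n)`. -/
def AffEquivMod (r n : ℕ) (f1 f2 : BF n) : Prop :=
  ∃ A : Matrix (Fin n) (Fin n) (ZMod 2), IsUnit A ∧ ∃ b : Fin n → ZMod 2,
    (fun x => f1 x + f2 (A.mulVec x + b)) ∈ RM r n

def fun1 : BF 6 := fun x => x 0*x 1*x 5 + x 0*x 2*x 4 + x 1*x 2*x 3

def fun2 : BF 6 := fun x => x 0*x 1*x 2*x 3 + x 0*x 1*x 5 + x 0*x 3*x 4 + x 1*x 2*x 4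

def fun3 : BF 6 := fun x => x 0*x 1*x 2*x 3 + x 0*x 2*x 4 + x 0*x 3*x 5 + x 1*x 2*x 4
  + x 1*x 2*x 5 + x 1*x 3*x 4

def fun4 : BF 6 := fun x => x 0*x 1*x 2*x 5 + x 0*x 1*x 3*x 4 + x 0*x 2*x 4
  + x 0*x 3*x 4 + x 0*x 3*x 5 + x 1*x 2*x 3

def fun5 : BF 6 := fun x => x 0*x 1*x 2*x 3*x 4 + x 0*x 2*x 4 + x 0*x 3*x 5
  + x 1*x 2*x 4 + x 1*x 2*x 5 + x 1*x 3*x 4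

def fun6 : BF 6 := fun x => x 0*x 1*x 2*x 3*x 4*x 5 + x 0*x 1*x 5 + x 0*x 2*x 4
  + x 1*x 2*x 3

def fun7 : BF 6 := fun x => x 0*x 1*x 2*x 3*x 4*x 5 + x 0*x 1*x 2*x 3 + x 0*x 1*x 5
  + x 0*x 3*x 4 + x 1*x 2*x 4 + x 3*x 4

def fun8 : BF 6 := fun x => x 0*x 1*x 2*x 3*x 4*x 5 + x 0*x 1*x 2*x 3 + x 0*x 2*x 4
  + x 0*x 3*x 5 + x 1*x 2*x 4 + x 1*x 2*x 5 + x 1*x 3*x 4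

def fun9 : BF 6 := fun x => x 0*x 1*x 2*x 3*x 4*x 5 + x 0*x 1*x 2*x 5 + x 0*x 1*x 3*x 4
  + x 0*x 2*x 4 + x 0*x 3*x 4 + x 0*x 3*x 5 + x 1*x 2*x 3 + x 3*x 5

def fun10 : BF 6 := fun x => x 0*x 1*x 2*x 3*x 4*x 5 + x 0*x 1*x 2*x 3 + x 0*x 2*x 3
  + x 0*x 4*x 5 + x 1*x 2*x 3 + x 1*x 2*x 5 + x 1*x 3*x 4 + x 2*x 3 + x 2*x 5 + x 3*x 4

def fun11 : BF 6 := fun x => x 0*x 1*x 2*x 3*x 4*x 5 + x 0*x 1*x 2*x 5 + x 0*x 1*x 3*x 4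
  + x 0*x 2*x 4 + x 0*x 3*x 4 + x 0*x 3*x 5 + x 1*x 2*x 3 + x 1*x 2*x 5 + x 1*x 3*x 4
  + x 2*x 4 + x 3*x 4 + x 3*x 5

def fun12 : BF 6 := fun x => x 0*x 1*x 2*x 3*x 4*x 5 + x 1*x 2*x 3*x 4 + x 0*x 1*x 4*x 5
  + x 0*x 2*x 3*x 5 + x 0*x 1*x 3 + x 0*x 1*x 4 + x 1*x 2*x 4 + x 2*x 3*x 4
  + x 0*x 1*x 5 + x 2*x 3*x 5

def g0 : BF 6 := fun x => x 0*x 1*x 2 + x 0*x 3*x 4 + x 1*x 3*x 5 + x 2*x 4*x 5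
  + x 3*x 4*x 5

namespace SecondOrder

/-- The vector space `F_2^8`. -/
abbrev V := Fin 8 → ZMod 2

/-- The sign character of `ZMod 2`. -/
def sg (a : ZMod 2) : ℤ := if a = 0 then 1 else -1

@[simp] lemma sg_zero : sg 0 = 1 := rfl
@[simp] lemma sg_one : sg 1 = -1 := rfl

lemma sg_add (a b : ZMod 2) : sg (a + b) = sg a * sg b := by
  revert a b; decide

lemma sg_mul_self (a : ZMod 2) : sg a * sg a = 1 := by
  revert a; decide

lemma sg_eq (a : ZMod 2) : sg a = 1 ∨ sg a = -1 := by
  revert a; decide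

lemma zmod2_cases (a : ZMod 2) : a = 0 ∨ a = 1 := by
  revert a; decide

lemma sg_sum {ι : Type*} (s : Finset ι) (f : ι → ZMod 2) :
    sg (∑ i ∈ s, f i) = ∏ i ∈ s, sg (f i) := by
  classical
  induction s using Finset.induction_on with
  | empty => simp
  | insert a s ha ih => rw [Finset.sum_insert ha, Finset.prod_insert ha, sg_add, ih]

lemma add_self_eq {G : Type*} [AddCommGroup G] [Module (ZMod 2) G] (a : G) : a + a = 0 :=
  ZModModule.add_self a

lemma add_add_cancel {G : Type*} [AddCommGroup G] [Module (ZMod 2) G] (a b : G) :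
    a + b + b = a := by rw [add_assoc, add_self_eq, add_zero]

lemma add_eq_zero_iff {G : Type*} [AddCommGroup G] [Module (ZMod 2) G] {a b : G} :
    a + b = 0 ↔ a = b := by
  constructor
  · intro h
    rw [← add_add_cancel a b, h, zero_add]
  · rintro rfl
    exact add_self_eq a

lemma sum_add_right {G M : Type*} [AddCommGroup G] [Module (ZMod 2) G] [AddCommMonoid M]
    (s : Finset G) (g : G → M) {a : G} (ha : ∀ x ∈ s, x + a ∈ s) :
    ∑ x ∈ s, g (x + a) = ∑ x ∈ s, g x := by
  refine Finset.sum_nbij' (· + a) (· + a) ha ha ?_ ?_ ?_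
  · intro x _; exact add_add_cancel x a
  · intro x _; exact add_add_cancel x a
  · intro x _; rfl

lemma sum_char_eq_zero {G : Type*} [AddCommGroup G] [Module (ZMod 2) G]
    (s : Finset G) (χ : G → ℤ) {a : G} (ha : ∀ x ∈ s, x + a ∈ s)
    (hχ : ∀ x ∈ s, χ (x + a) = - χ x) : ∑ x ∈ s, χ x = 0 := by
  have h := sum_add_right s χ ha
  rw [Finset.sum_congr rfl hχ, Finset.sum_neg_distrib] at h
  omega

lemma dot_single (u : V) (i : Fin 8) : u ⬝ᵥ (Pi.single i 1) = u i := by simp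

lemma exists_dot_eq_one {u : V} (hu : u ≠ 0) : ∃ i, u ⬝ᵥ (Pi.single i 1) = 1 := by
  by_contra! h
  apply hu
  funext i
  have := h i
  rw [dot_single] at this
  rcases zmod2_cases (u i) with h0 | h0
  · simpa using h0
  · exact absurd h0 this

lemma card_V : (Finset.univ : Finset V).card = 256 := by
  simp [Finset.card_univ]

lemma sum_sg_dot (u : V) : ∑ x : V, sg (u ⬝ᵥ x) = if u = 0 then 256 else 0 := by
  split_ifs with h
  · subst h
    simp
  · obtain ⟨i, hi⟩ := exists_dot_eq_one h
    refine sum_char_eq_zero _ _ (a := Pi.single i 1) (fun _ _ => Finset.mem_univ _) ?_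
    intro x _
    rw [dotProduct_add, sg_add, hi]
    simp

/-- The Walsh transform. -/
def walsh (g : V → ℤ) (l : V) : ℤ := ∑ x : V, g x * sg (l ⬝ᵥ x)

lemma walsh_inversion (g : V → ℤ) (y : V) :
    ∑ l : V, walsh g l * sg (l ⬝ᵥ y) = 256 * g y := by
  have h1 : ∀ l : V, walsh g l * sg (l ⬝ᵥ y) = ∑ x : V, g x * sg ((x + y) ⬝ᵥ l) := by
    intro l
    rw [walsh, Finset.sum_mul]
    refine Finset.sum_congr rfl fun x _ => ?_
    rw [mul_assoc, ← sg_add, ← dotProduct_add, dotProduct_comm]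
  rw [Finset.sum_congr rfl fun l _ => h1 l, Finset.sum_comm]
  have h2 : ∀ x : V, ∑ l : V, g x * sg ((x + y) ⬝ᵥ l) = if x = y then 256 * g y else 0 := by
    intro x
    rw [← Finset.mul_sum, sum_sg_dot]
    by_cases h : x = y
    · subst h
      simp [add_self_eq, mul_comm]
    · rw [if_neg (fun h' => h (add_eq_zero_iff.1 h')), if_neg h, mul_zero]
  rw [Finset.sum_congr rfl fun x _ => h2 x]
  simp

lemma walsh_sq_inversion (g : V → ℤ) (y : V) :
    ∑ l : V, walsh g l ^ 2 * sg (l ⬝ᵥ y) = 256 * ∑ b : V, g b * g (b + y) := by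
  have h1 : ∀ l : V, walsh g l ^ 2 * sg (l ⬝ᵥ y)
      = ∑ b : V, g b * (walsh g l * sg (l ⬝ᵥ (b + y))) := by
    intro l
    rw [sq]
    nth_rewrite 1 [walsh]
    rw [Finset.sum_mul, Finset.sum_mul]
    refine Finset.sum_congr rfl fun x _ => ?_
    rw [dotProduct_add, sg_add]
    ring
  rw [Finset.sum_congr rfl fun l _ => h1 l, Finset.sum_comm, Finset.mul_sum]
  refine Finset.sum_congr rfl fun b _ => ?_
  rw [← Finset.mul_sum, walsh_inversion]
  ring

/-- The `w`-th elementary symmetric function of `s` on `t`. -/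
def esum {ι : Type*} (t : Finset ι) (s : ι → ℤ) (w : ℕ) : ℤ :=
  ∑ C ∈ t.powersetCard w, ∏ x ∈ C, s x

lemma esum_zero {ι : Type*} (t : Finset ι) (s : ι → ℤ) : esum t s 0 = 1 := by
  simp [esum]

lemma esum_one {ι : Type*} (t : Finset ι) (s : ι → ℤ) : esum t s 1 = ∑ x ∈ t, s x := by
  simp [esum, Finset.powersetCard_one]

lemma esum_insert {ι : Type*} [DecidableEq ι] {t : Finset ι} {a : ι} (ha : a ∉ t) (s : ι → ℤ)
    (w : ℕ) : esum (insert a t) s (w + 1) = esum t s (w + 1) + s a * esum t s w := by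
  rw [esum, Finset.powersetCard_succ_insert ha, Finset.sum_union]
  · rw [Finset.sum_image]
    · rw [esum, esum, Finset.mul_sum]
      congr 1
      refine Finset.sum_congr rfl fun C hC => ?_
      rw [Finset.prod_insert]
      exact fun h => ha ((Finset.mem_powersetCard.1 hC).1 h)
    · intro C hC C' hC' h
      have hC1 : a ∉ C := fun h => ha ((Finset.mem_powersetCard.1 hC).1 h)
      have hC1' : a ∉ C' := fun h => ha ((Finset.mem_powersetCard.1 hC').1 h)
      rw [← Finset.erase_insert hC1, ← Finset.erase_insert hC1', h]
  · rw [Finset.disjoint_left]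
    intro C hC hC'
    obtain ⟨B, _, rfl⟩ := Finset.mem_image.1 hC'
    exact ha ((Finset.mem_powersetCard.1 hC).1 (Finset.mem_insert_self _ _))

lemma esum_rec {ι : Type*} (t : Finset ι) (s : ι → ℤ) (hs : ∀ x ∈ t, s x * s x = 1) (w : ℕ) :
    ((w : ℤ) + 2) * esum t s (w + 2)
      = (∑ x ∈ t, s x) * esum t s (w + 1) - ((t.card : ℤ) - w) * esum t s w := by
  classical
  induction t using Finset.induction_on generalizing w with
  | empty =>
    have h0 : ∀ k, esum (∅ : Finset ι) s (k + 1) = 0 := by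
      intro k
      rw [esum, Finset.powersetCard_eq_empty.2 (by simp)]
      simp
    cases w with
    | zero => simp [h0]
    | succ w => simp [h0]
  | insert a t ha ih =>
    have hs' : ∀ x ∈ t, s x * s x = 1 := fun x hx => hs x (Finset.mem_insert_of_mem hx)
    have ha' := hs a (Finset.mem_insert_self _ _)
    rw [Finset.sum_insert ha, Finset.card_insert_of_notMem ha, esum_insert ha, esum_insert ha]
    have e1 := ih hs' w
    cases w with
    | zero =>
      rw [esum_zero, esum_zero] at *
      have h1 := esum_one t s
      push_cast at *
      rw [h1] at *
      linear_combination e1 - ha'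
    | succ w =>
      rw [esum_insert ha]
      have e2 := ih hs' w
      push_cast at *
      linear_combination e1 + s a * e2 - ha' * esum t s (w + 1)

/-- Krawtchouk numbers: the elementary symmetric functions of `N` signs with sum `S`. -/
def kraw (N : ℕ) (S : ℤ) : ℕ → ℤ
  | 0 => 1
  | 1 => S
  | w + 2 => (S * kraw N S (w + 1) - ((N : ℤ) - w) * kraw N S w) / ((w : ℤ) + 2)

lemma esum_eq_kraw {ι : Type*} (t : Finset ι) (s : ι → ℤ) (hs : ∀ x ∈ t, s x * s x = 1) :
    ∀ w, esum t s w = kraw t.card (∑ x ∈ t, s x) w := by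
  intro w
  induction w using Nat.strong_induction_on with
  | _ w ih =>
    match w with
    | 0 => simp [kraw, esum_zero]
    | 1 => simp [kraw, esum_one]
    | w + 2 =>
      rw [kraw, ← ih w (by omega), ← ih (w + 1) (by omega), ← esum_rec t s hs w]
      rw [Int.mul_ediv_cancel_left]
      omega

/-- A set of points is a word if every product of two affine functions sums to zero on it. -/
def IsWord (C : Finset V) : Prop :=
  ∀ (u v : V) (a b : ZMod 2), ∑ x ∈ C, (u ⬝ᵥ x + a) * (v ⬝ᵥ x + b) = 0

/-- The Walsh transform of the indicator function of `C`. -/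
def wt (C : Finset V) (l : V) : ℤ := ∑ x ∈ C, sg (l ⬝ᵥ x)

lemma wt_eq_walsh (C : Finset V) (l : V) : wt C l = walsh (fun x => if x ∈ C then 1 else 0) l := by
  simp [wt, walsh]

lemma wt_inversion (C : Finset V) (y : V) :
    ∑ l : V, wt C l * sg (l ⬝ᵥ y) = if y ∈ C then 256 else 0 := by
  simp only [wt_eq_walsh, walsh_inversion]
  split_ifs <;> simp

lemma wt_sq_inversion (C : Finset V) (y : V) :
    ∑ l : V, wt C l ^ 2 * sg (l ⬝ᵥ y) = 256 * (C.filter fun b => b + y ∈ C).card := by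
  simp only [wt_eq_walsh, walsh_sq_inversion]
  rw [← Finset.sum_boole, ← Finset.sum_subset (Finset.subset_univ C)]
  · refine congrArg _ (Finset.sum_congr rfl fun b hb => ?_)
    simp [hb]
  · intro b _ hb
    simp [hb]

lemma wt_parseval (C : Finset V) : ∑ l : V, wt C l ^ 2 = 256 * C.card := by
  have h := wt_sq_inversion C 0
  simpa using h

lemma exists_dot_of_additive (t : V → ZMod 2) (h : ∀ l m, t (l + m) = t l + t m) :
    ∃ y : V, ∀ l, t l = l ⬝ᵥ y := by
  refine ⟨fun i => t (Pi.single i 1), fun l => ?_⟩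
  let T : V →+ ZMod 2 := AddMonoidHom.mk' t h
  have h1 : t l = T (∑ i, Pi.single i (l i)) := by
    rw [Finset.univ_sum_single]
    rfl
  rw [h1, map_sum, dotProduct]
  refine Finset.sum_congr rfl fun i _ => ?_
  rcases zmod2_cases (l i) with h0 | h0
  · rw [h0]
    simp
  · rw [h0, one_mul]
    rfl

/-- The number of points of `C` on which `l` takes the value one. -/
def ones (C : Finset V) (l : V) : ℤ := (C.filter fun x => l ⬝ᵥ x = 1).card

lemma wt_eq_ones (C : Finset V) (l : V) : wt C l = C.card - 2 * ones C l := by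
  rw [wt, ones, Finset.card_filter, Finset.card_eq_sum_ones]
  push_cast
  rw [Finset.mul_sum, ← Finset.sum_sub_distrib]
  refine Finset.sum_congr rfl fun x _ => ?_
  rcases zmod2_cases (l ⬝ᵥ x) with h0 | h0 <;> rw [h0] <;> simp

lemma cast_ones (C : Finset V) (l : V) : ((ones C l : ℤ) : ZMod 2) = ∑ x ∈ C, l ⬝ᵥ x := by
  rw [ones, Finset.card_filter]
  push_cast
  refine Finset.sum_congr rfl fun x _ => ?_
  rcases zmod2_cases (l ⬝ᵥ x) with h0 | h0 <;> rw [h0] <;> simp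

lemma ones_add (C : Finset V) (l m : V) : ones C (l + m) = ones C l + ones C m
    - 2 * (C.filter fun x => l ⬝ᵥ x = 1 ∧ m ⬝ᵥ x = 1).card := by
  simp only [ones, Finset.card_filter]
  push_cast
  rw [Finset.mul_sum, ← Finset.sum_add_distrib, ← Finset.sum_sub_distrib]
  refine Finset.sum_congr rfl fun x _ => ?_
  rw [add_dotProduct]
  generalize l ⬝ᵥ x = a
  generalize m ⬝ᵥ x = b
  revert a b
  decide

lemma cast_inter (C : Finset V) (l m : V) :
    (((C.filter fun x => l ⬝ᵥ x = 1 ∧ m ⬝ᵥ x = 1).card : ℕ) : ZMod 2)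
      = ∑ x ∈ C, (l ⬝ᵥ x) * (m ⬝ᵥ x) := by
  rw [Finset.card_filter]
  push_cast
  refine Finset.sum_congr rfl fun x _ => ?_
  generalize l ⬝ᵥ x = a
  generalize m ⬝ᵥ x = b
  revert a b
  decide

namespace IsWord

variable {C : Finset V}

lemma even_card (hC : IsWord C) : C.card % 2 = 0 := by
  have h := hC 0 0 1 1
  simp at h
  have := (ZMod.natCast_eq_zero_iff _ _).1 h
  omega

lemma sum_dot (hC : IsWord C) (l : V) : ∑ x ∈ C, l ⬝ᵥ x = 0 := by
  have h := hC l 0 0 1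
  simpa using h

lemma sum_mul (hC : IsWord C) (l m : V) : ∑ x ∈ C, (l ⬝ᵥ x) * (m ⬝ᵥ x) = 0 := by
  have h := hC l m 0 0
  simpa using h

lemma even_ones (hC : IsWord C) (l : V) : ones C l % 2 = 0 := by
  have h := cast_ones C l
  rw [hC.sum_dot] at h
  have := (ZMod.intCast_zmod_eq_zero_iff_dvd _ 2).1 h
  omega

lemma card_filter_ne_two (hC : IsWord C) (l : V) (a : ZMod 2) :
    (C.filter fun x => l ⬝ᵥ x = a).card ≠ 2 := by
  intro h
  obtain ⟨x, y, hxy, hf⟩ := Finset.card_eq_two.1 h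
  obtain ⟨i, hi⟩ := exists_dot_eq_one (u := x + y) (fun h => hxy (add_eq_zero_iff.1 h))
  have h1 := hC l (Pi.single i 1) (a + 1) 0
  have key : ∀ a b c : ZMod 2, (b + (a + 1)) * (c + 0) = if b = a then c else 0 := by decide
  have h2 : ∀ z ∈ C, (l ⬝ᵥ z + (a + 1)) * ((Pi.single i 1) ⬝ᵥ z + 0)
      = if l ⬝ᵥ z = a then z ⬝ᵥ (Pi.single i 1) else 0 := by
    intro z _
    rw [dotProduct_comm (Pi.single i 1) z]
    exact key a _ _
  rw [Finset.sum_congr rfl h2, ← Finset.sum_filter, hf, Finset.sum_pair hxy, ← add_dotProduct,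
    hi] at h1
  exact one_ne_zero h1

lemma exists_center (hC : IsWord C) : ∃ y : V, ∀ l : V,
    wt C l = C.card - 2 * ones C l ∧ 0 ≤ ones C l ∧ ones C l ≤ C.card ∧ ones C l ≠ 2 ∧
      ones C l ≠ C.card - 2 ∧
      ((l ⬝ᵥ y = 0 ∧ ones C l % 4 = 0) ∨ (l ⬝ᵥ y = 1 ∧ ones C l % 4 = 2)) := by
  obtain ⟨y, hy⟩ := exists_dot_of_additive (fun l => ((ones C l / 2 : ℤ) : ZMod 2)) (by
    intro l m
    have h1 := ones_add C l m
    have h2 := cast_inter C l m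
    rw [hC.sum_mul] at h2
    have h3 := (ZMod.natCast_eq_zero_iff _ _).1 h2
    have h4 := hC.even_ones l
    have h5 := hC.even_ones m
    have h6 : (ones C (l + m) / 2 - (ones C l / 2 + ones C m / 2) : ℤ) % 2 = 0 := by omega
    have h7 := (ZMod.intCast_zmod_eq_zero_iff_dvd _ 2).2 (Int.dvd_of_emod_eq_zero h6)
    push_cast at h7
    exact sub_eq_zero.1 h7)
  refine ⟨y, fun l => ⟨wt_eq_ones C l, ?_, ?_, ?_, ?_, ?_⟩⟩
  · exact Int.natCast_nonneg _
  · exact Int.ofNat_le.2 (Finset.card_filter_le _ _)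
  · have := hC.card_filter_ne_two l 1
    rw [ones]
    omega
  · have h1 : (C.filter fun x => l ⬝ᵥ x = 0).card ≠ 2 := hC.card_filter_ne_two l 0
    have h2 := Finset.card_filter_add_card_filter_not (s := C) (fun x => l ⬝ᵥ x = 1)
    have h3 : (C.filter fun x => ¬ l ⬝ᵥ x = 1) = C.filter fun x => l ⬝ᵥ x = 0 := by
      refine Finset.filter_congr fun x _ => ?_
      generalize l ⬝ᵥ x = b
      revert b
      decide
    rw [h3] at h2
    clear h3 hy
    intro h4
    rw [ones, ← h2] at h4
    push_cast at h4
    apply h1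
    exact_mod_cast (by linarith : ((C.filter fun x => l ⬝ᵥ x = 0).card : ℤ) = 2)
  · have h1 := hy l
    have h2 := hC.even_ones l
    rcases zmod2_cases (l ⬝ᵥ y) with h0 | h0
    · left
      refine ⟨h0, ?_⟩
      rw [h0] at h1
      have := (ZMod.intCast_zmod_eq_zero_iff_dvd _ 2).1 h1
      omega
    · right
      refine ⟨h0, ?_⟩
      rw [h0] at h1
      have h3 : (((ones C l / 2 - 1 : ℤ)) : ZMod 2) = 0 := by
        push_cast
        rw [sub_eq_zero]
        exact h1
      have := (ZMod.intCast_zmod_eq_zero_iff_dvd _ 2).1 h3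
      omega

lemma card_ne_of_mod_eight (hC : IsWord C) (h : C.card = 2 ∨ C.card = 6 ∨ C.card = 10) : False := by
  obtain ⟨y, hy⟩ := hC.exists_center
  have h1 := wt_inversion C y
  have h2 : ∀ l : V, (2 : ℤ) ≤ wt C l * sg (l ⬝ᵥ y) := by
    intro l
    obtain ⟨e, a1, a2, a3, a4, a5⟩ := hy l
    rcases a5 with ⟨b1, b2⟩ | ⟨b1, b2⟩ <;> rw [b1, e] <;> simp <;> omega
  have h3 := Finset.sum_le_sum (s := Finset.univ) fun l _ => h2 l
  rw [h1, Finset.sum_const, card_V] at h3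
  split_ifs at h3 <;> simp at h3

lemma card_ne_four (hC : IsWord C) : C.card ≠ 4 := by
  intro h
  obtain ⟨y, hy⟩ := hC.exists_center
  have h1 := wt_parseval C
  have h2 : ∀ l : V, (16 : ℤ) ≤ wt C l ^ 2 := by
    intro l
    obtain ⟨e, a1, a2, a3, a4, a5⟩ := hy l
    have : wt C l = 4 ∨ wt C l = -4 := by omega
    rcases this with h | h <;> rw [h] <;> norm_num
  have h3 := Finset.sum_le_sum (s := Finset.univ) fun l _ => h2 l
  rw [h1, Finset.sum_const, card_V, h] at h3
  norm_num at h3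

lemma card_cases (hC : IsWord C) : C.card = 0 ∨ C.card = 8 ∨ C.card = 12 ∨ C.card = 14 ∨
    (16 ≤ C.card ∧ C.card % 2 = 0) := by
  have h1 := hC.even_card
  have h2 := hC.card_ne_four
  have h3 : ¬ (C.card = 2 ∨ C.card = 6 ∨ C.card = 10) := hC.card_ne_of_mod_eight
  omega

end IsWord

open scoped Classical in
/-- The words with `w` points. -/
noncomputable def words (w : ℕ) : Finset (Finset V) :=
  (Finset.univ.powersetCard w).filter IsWord

lemma mem_words {w : ℕ} {C : Finset V} : C ∈ words w ↔ C.card = w ∧ IsWord C := by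
  simp [words]

/-- Closure under sums of three points, that is, being an affine subspace or empty. -/
def AffClosed (A : Finset V) : Prop := ∀ a ∈ A, ∀ b ∈ A, ∀ c ∈ A, a + b + c ∈ A

lemma IsWord.affClosed {C : Finset V} (hC : IsWord C) (h8 : C.card = 8) : AffClosed C := by
  obtain ⟨y, hy⟩ := hC.exists_center
  have hv : ∀ l, wt C l = 0 ∨ wt C l = 8 ∨ wt C l = -8 := by
    intro l
    obtain ⟨e, a1, a2, a3, a4, a5⟩ := hy l
    omega
  have key : ∀ x ∈ C, ∀ l, wt C l ^ 2 = 8 * (wt C l * sg (l ⬝ᵥ x)) := by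
    intro x hx
    have h1 := wt_inversion C x
    rw [if_pos hx] at h1
    have h2 := wt_parseval C
    have h3 : ∀ l ∈ (Finset.univ : Finset V), 0 ≤ wt C l ^ 2 - 8 * (wt C l * sg (l ⬝ᵥ x)) := by
      intro l _
      rcases hv l with h | h | h <;> rw [h] <;> rcases sg_eq (l ⬝ᵥ x) with h' | h' <;> rw [h'] <;>
        norm_num
    have h4 : ∑ l : V, (wt C l ^ 2 - 8 * (wt C l * sg (l ⬝ᵥ x))) = 0 := by
      rw [Finset.sum_sub_distrib, ← Finset.mul_sum, h1, h2, h8]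
      norm_num
    intro l
    have h5 := (Finset.sum_eq_zero_iff_of_nonneg h3).1 h4 l (Finset.mem_univ l)
    linarith
  intro a ha b hb c hc
  have h1 : ∀ l, wt C l * sg (l ⬝ᵥ (a + b + c)) = wt C l * sg (l ⬝ᵥ a) := by
    intro l
    rw [dotProduct_add, dotProduct_add, sg_add, sg_add]
    have e1 := key b hb l
    have e2 := key c hc l
    rcases hv l with h | h | h <;> rw [h] at e1 e2 ⊢
    · simp
    · have f1 : sg (l ⬝ᵥ b) = 1 := by linarith
      have f2 : sg (l ⬝ᵥ c) = 1 := by linarith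
      rw [f1, f2]
      ring
    · have f1 : sg (l ⬝ᵥ b) = -1 := by linarith
      have f2 : sg (l ⬝ᵥ c) = -1 := by linarith
      rw [f1, f2]
      ring
  have h2 := wt_inversion C (a + b + c)
  rw [Finset.sum_congr rfl fun l _ => h1 l, wt_inversion, if_pos ha] at h2
  by_contra h
  rw [if_neg h] at h2
  norm_num at h2

lemma AffClosed.isWord {A : Finset V} (hA : AffClosed A) (h8 : A.card = 8) : IsWord A := by
  intro u v a b
  obtain ⟨x, hx, y, hy, hxy, he⟩ := Finset.exists_ne_map_eq_of_card_lt_of_maps_to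
    (s := A) (t := (Finset.univ : Finset (ZMod 2 × ZMod 2))) (f := fun x => (u ⬝ᵥ x, v ⬝ᵥ x))
    (by rw [h8]; simp) (fun _ _ => Finset.mem_coe.2 (Finset.mem_univ _))
  simp only [Prod.mk.injEq] at he
  have hd : ∀ w : V, w ⬝ᵥ x = w ⬝ᵥ y → ∀ z, w ⬝ᵥ (z + (x + y)) = w ⬝ᵥ z := by
    intro w hw z
    rw [dotProduct_add, dotProduct_add, hw, add_self_eq, add_zero]
  refine Finset.sum_involution (fun z _ => z + (x + y)) ?_ ?_ ?_ ?_
  · intro z _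
    rw [hd u he.1, hd v he.2, add_self_eq]
  · intro z _ _ h
    exact hxy (add_eq_zero_iff.1 (add_eq_left.1 h))
  · intro z hz
    have := hA z hz x hx y hy
    rwa [← add_assoc]
  · intro z _
    exact add_add_cancel _ _

lemma mem_words_eight {A : Finset V} : A ∈ words 8 ↔ A.card = 8 ∧ AffClosed A := by
  rw [mem_words]
  exact ⟨fun h => ⟨h.1, h.2.affClosed h.1⟩, fun h => ⟨h.1, h.2.isWord h.1⟩⟩

/-- Four points in general position lie on exactly one flat of size eight. -/
lemma exists_flat {a b c d : V} (hab : a ≠ b) (hac : a ≠ c) (hbc : b ≠ c) (had : a ≠ d)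
    (hbd : b ≠ d) (hcd : c ≠ d) (hd : d ≠ a + b + c) :
    ∃ A ∈ words 8, (a ∈ A ∧ b ∈ A ∧ c ∈ A ∧ d ∈ A) ∧
      ∀ B ∈ words 8, a ∈ B → b ∈ B → c ∈ B → d ∈ B → B = A := by
  let f : ZMod 2 × ZMod 2 × ZMod 2 → V := fun t =>
    a + (t.1 • (a + b) + t.2.1 • (a + c) + t.2.2 • (a + d))
  have hf : Function.Injective f := by
    have h0 : ∀ t1 t2 t3 : ZMod 2, t1 • (a + b) + t2 • (a + c) + t3 • (a + d) = 0 →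
        t1 = 0 ∧ t2 = 0 ∧ t3 = 0 := by
      intro t1 t2 t3 h
      rcases zmod2_cases t1 with rfl | rfl <;> rcases zmod2_cases t2 with rfl | rfl <;>
        rcases zmod2_cases t3 with rfl | rfl <;>
        simp only [zero_smul, one_smul, zero_add, add_zero, and_self] at h ⊢ <;> exfalso
      · exact had (add_eq_zero_iff.1 h)
      · exact hac (add_eq_zero_iff.1 h)
      · apply hcd
        have := add_eq_zero_iff.1 h
        exact add_left_cancel this
      · exact hab (add_eq_zero_iff.1 h)
      · apply hbd
        have := add_eq_zero_iff.1 h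
        exact add_left_cancel this
      · apply hbc
        have := add_eq_zero_iff.1 h
        exact add_left_cancel this
      · apply hd
        have h1 : a + b + c + d = 0 := by
          rw [← h]
          have h2 : a + b + (a + c) + (a + d) = (a + a) + (a + b + c + d) := by abel
          rw [h2, add_self_eq, zero_add]
        exact (add_eq_zero_iff.1 h1).symm
    rintro ⟨s1, s2, s3⟩ ⟨t1, t2, t3⟩ h
    have h1 := add_left_cancel h
    have h2 := h0 (s1 + t1) (s2 + t2) (s3 + t3) (by
      rw [add_smul, add_smul, add_smul, ← add_eq_zero_iff.2 h1]
      abel)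
    rw [add_eq_zero_iff, add_eq_zero_iff, add_eq_zero_iff] at h2
    obtain ⟨rfl, rfl, rfl⟩ := h2
    rfl
  have hcl : AffClosed (Finset.univ.image f) := by
    intro x hx y hy z hz
    obtain ⟨s, _, rfl⟩ := Finset.mem_image.1 hx
    obtain ⟨t, _, rfl⟩ := Finset.mem_image.1 hy
    obtain ⟨r, _, rfl⟩ := Finset.mem_image.1 hz
    refine Finset.mem_image.2 ⟨s + t + r, Finset.mem_univ _, ?_⟩
    simp only [f, Prod.fst_add, Prod.snd_add, add_smul]
    have : a = a + (a + a) := by rw [add_self_eq, add_zero]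
    nth_rewrite 1 [this]
    abel
  have hcard : (Finset.univ.image f).card = 8 := by
    rw [Finset.card_image_of_injective _ hf]
    simp [Finset.card_univ]
  have hc2 : ∀ x : V, a + (a + x) = x := fun x => by rw [← add_assoc, add_self_eq, zero_add]
  refine ⟨Finset.univ.image f, mem_words_eight.2 ⟨hcard, hcl⟩, ⟨?_, ?_, ?_, ?_⟩, ?_⟩
  · exact Finset.mem_image.2 ⟨(0, 0, 0), Finset.mem_univ _, by simp [f]⟩
  · exact Finset.mem_image.2 ⟨(1, 0, 0), Finset.mem_univ _, by simp [f, hc2]⟩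
  · exact Finset.mem_image.2 ⟨(0, 1, 0), Finset.mem_univ _, by simp [f, hc2]⟩
  · exact Finset.mem_image.2 ⟨(0, 0, 1), Finset.mem_univ _, by simp [f, hc2]⟩
  · intro B hB ha' hb' hc' hd'
    obtain ⟨h8, hB'⟩ := mem_words_eight.1 hB
    refine (Finset.eq_of_subset_of_card_le ?_ (by rw [h8, hcard])).symm
    have step : ∀ x ∈ B, ∀ y ∈ B, ∀ t : ZMod 2, x + t • (a + y) ∈ B := by
      intro x hx y hy t
      rcases zmod2_cases t with rfl | rfl
      · simpa using hx
      · rw [one_smul, ← add_assoc]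
        exact hB' x hx a ha' y hy
    intro x hx
    obtain ⟨t, _, rfl⟩ := Finset.mem_image.1 hx
    simp only [f]
    rw [← add_assoc, ← add_assoc]
    exact step _ (step _ (step _ ha' b hb' _) c hc' _) d hd' _

lemma double_count (𝒜 : Finset (Finset V)) (S : Finset V) {k m : ℕ}
    (hk : ∀ A ∈ 𝒜, (S ∩ A).card = k) (hm : ∀ y ∈ S, (𝒜.filter (y ∈ ·)).card = m) :
    𝒜.card * k = S.card * m := by
  refine Finset.card_mul_eq_card_mul (fun (A : Finset V) y => y ∈ A) ?_ ?_
  · intro A hA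
    rw [← hk A hA, Finset.bipartiteAbove, Finset.filter_mem_eq_inter]
  · intro y hy
    rw [← hm y hy, Finset.bipartiteBelow]

lemma eq_of_dot_eq {x y : V} (h : ∀ l : V, l ⬝ᵥ x = l ⬝ᵥ y) : x = y := by
  by_contra hne
  obtain ⟨i, hi⟩ := exists_dot_eq_one (u := x + y) (fun h => hne (add_eq_zero_iff.1 h))
  rw [add_dotProduct, dotProduct_comm x, dotProduct_comm y, h, add_self_eq] at hi
  exact zero_ne_one hi

lemma IsWord.symmDiff {A C : Finset V} (hA : IsWord A) (hC : IsWord C) :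
    IsWord (symmDiff A C) := by
  intro u v a b
  have h := hA u v a b
  have h' := hC u v a b
  rw [← Finset.sum_inter_add_sum_sdiff A C] at h
  rw [← Finset.sum_inter_add_sum_sdiff C A, Finset.inter_comm] at h'
  have hd : Disjoint (A \ C) (C \ A) := disjoint_sdiff_sdiff
  rw [_root_.symmDiff, Finset.sup_eq_union, Finset.sum_union hd]
  rw [add_eq_zero_iff] at h h'
  rw [← h, ← h', add_self_eq]

lemma card_symmDiff_add (A C : Finset V) :
    (symmDiff A C).card + 2 * (A ∩ C).card = A.card + C.card := by
  have hd : Disjoint (A \ C) (C \ A) := disjoint_sdiff_sdiff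
  rw [symmDiff, Finset.sup_eq_union, Finset.card_union_of_disjoint hd]
  have h1 := Finset.card_inter_add_card_sdiff A C
  have h2 := Finset.card_inter_add_card_sdiff C A
  rw [Finset.inter_comm] at h2
  omega

lemma wt_symmDiff (A C : Finset V) (l : V) :
    wt (symmDiff A C) l + 2 * wt (A ∩ C) l = wt A l + wt C l := by
  have hd : Disjoint (A \ C) (C \ A) := disjoint_sdiff_sdiff
  rw [symmDiff, Finset.sup_eq_union, wt, Finset.sum_union hd]
  have h1 := Finset.sum_inter_add_sum_sdiff A C (fun x => sg (l ⬝ᵥ x))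
  have h2 := Finset.sum_inter_add_sum_sdiff C A (fun x => sg (l ⬝ᵥ x))
  rw [Finset.inter_comm] at h2
  simp only [wt]
  linarith

lemma IsWord.wt_eight {A : Finset V} (hA : IsWord A) (h8 : A.card = 8) (l : V) :
    wt A l % 8 = 0 := by
  obtain ⟨y, hy⟩ := hA.exists_center
  obtain ⟨e, a1, a2, a3, a4, a5⟩ := hy l
  omega

lemma IsWord.exists_period {C : Finset V} (hC : IsWord C) (h12 : C.card = 12) :
    ∃ r : V, r ≠ 0 ∧ (∀ x ∈ C, x + r ∈ C) ∧ (∀ s, s ≠ 0 → (∀ x ∈ C, x + s ∈ C) → s = r) ∧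
      ∀ l, (l ⬝ᵥ r = 0 ∧ wt C l % 8 = 4) ∨ (l ⬝ᵥ r = 1 ∧ wt C l = 0) := by
  obtain ⟨r, hr⟩ := hC.exists_center
  have hv : ∀ l, (l ⬝ᵥ r = 0 ∧ wt C l % 8 = 4) ∨ (l ⬝ᵥ r = 1 ∧ wt C l = 0) := by
    intro l
    obtain ⟨e, a1, a2, a3, a4, a5⟩ := hr l
    rcases a5 with ⟨b1, b2⟩ | ⟨b1, b2⟩
    · left
      exact ⟨b1, by omega⟩
    · right
      exact ⟨b1, by omega⟩
  refine ⟨r, ?_, ?_, ?_, hv⟩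
  · rintro rfl
    have h1 := wt_parseval C
    have h2 : ∀ l : V, (16 : ℤ) ≤ wt C l ^ 2 := by
      intro l
      rcases hv l with ⟨-, h⟩ | ⟨h, -⟩
      · have : 4 ≤ wt C l ∨ wt C l ≤ -4 := by omega
        rcases this with h | h <;> nlinarith
      · simp at h
    have h3 := Finset.sum_le_sum (s := Finset.univ) fun l _ => h2 l
    rw [h1, Finset.sum_const, card_V, h12] at h3
    norm_num at h3
  · intro x hx
    have h2 := wt_inversion C (x + r)
    have h1 : ∀ l, wt C l * sg (l ⬝ᵥ (x + r)) = wt C l * sg (l ⬝ᵥ x) := by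
      intro l
      rw [dotProduct_add, sg_add]
      rcases hv l with ⟨h, -⟩ | ⟨-, h⟩ <;> rw [h] <;> simp
    rw [Finset.sum_congr rfl fun l _ => h1 l, wt_inversion, if_pos hx] at h2
    by_contra h
    rw [if_neg h] at h2
    norm_num at h2
  · intro s _ hs
    have h0 : ∀ l, l ⬝ᵥ s = 1 → wt C l = 0 := by
      intro l hl
      refine sum_char_eq_zero _ _ hs ?_
      intro x _
      rw [dotProduct_add, sg_add, hl]
      simp
    by_contra hne
    -- a functional separating `s` from `r`
    have h1 : ∀ l, l ⬝ᵥ s = 1 → l ⬝ᵥ r = 1 := by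
      intro l hl
      rcases hv l with ⟨-, h⟩ | ⟨h, -⟩
      · rw [h0 l hl] at h
        norm_num at h
      · exact h
    obtain ⟨i, hi⟩ := exists_dot_eq_one (u := s) (by assumption)
    rw [dotProduct_comm] at hi
    apply hne
    apply eq_of_dot_eq
    intro l
    rcases zmod2_cases (l ⬝ᵥ s) with hl | hl
    · have h2 := h1 (l + Pi.single i 1) (by rw [add_dotProduct, hl, hi, zero_add])
      rw [add_dotProduct, h1 _ hi] at h2
      rw [hl]
      exact (add_eq_right.1 h2).symm
    · rw [hl, h1 l hl]

lemma IsWord.card_inter_twelve_le {A C : Finset V} (hA : IsWord A) (hC : IsWord C)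
    (h8 : A.card = 8) (h12 : C.card = 12) : (A ∩ C).card ≤ 6 := by
  have h1 := card_symmDiff_add A C
  have h2 := (hA.symmDiff hC).card_cases
  have h3 := Finset.card_le_card (Finset.inter_subset_left (s₁ := A) (s₂ := C))
  rw [h8, h12] at h1
  omega

lemma exists_unique_flat_filter {a b c d : V} (P : Finset V → Prop) [DecidablePred P] (hab : a ≠ b)
    (hac : a ≠ c) (hbc : b ≠ c) (had : a ≠ d) (hbd : b ≠ d) (hcd : c ≠ d) (hd : d ≠ a + b + c)
    (hP : ∀ A ∈ words 8, P A ↔ (a ∈ A ∧ b ∈ A ∧ c ∈ A ∧ d ∈ A)) :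
    ((words 8).filter P).card = 1 := by
  obtain ⟨A, hA, h, hu⟩ := exists_flat hab hac hbc had hbd hcd hd
  refine Finset.card_eq_one.2 ⟨A, ?_⟩
  ext B
  simp only [Finset.mem_filter, Finset.mem_singleton]
  constructor
  · rintro ⟨hB, h⟩
    obtain ⟨h1, h2, h3, h4⟩ := (hP B hB).1 h
    exact hu B hB h1 h2 h3 h4
  · rintro rfl
    exact ⟨hA, (hP B hA).2 h⟩

lemma card_inter_sdiff {S T A : Finset V} (h : T ⊆ S ∩ A) :
    ((S \ T) ∩ A).card = (S ∩ A).card - T.card := by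
  rw [← Finset.card_sdiff_of_subset h]
  congr 1
  ext x
  simp only [Finset.mem_inter, Finset.mem_sdiff]
  tauto

lemma AffClosed.add_mem_iff {A : Finset V} (hA : AffClosed A) {r a : V} (ha : a ∈ A)
    (har : a + r ∈ A) {x : V} (hx : x ∈ A) : x + r ∈ A := by
  have := hA x hx a ha _ har
  rwa [add_assoc, ← add_assoc a, add_self_eq, zero_add] at this

lemma IsWord.flat_period {C A : Finset V} {r : V} (hC : IsWord C) (h12 : C.card = 12)
    (hw : ∀ l, (l ⬝ᵥ r = 0 ∧ wt C l % 8 = 4) ∨ (l ⬝ᵥ r = 1 ∧ wt C l = 0))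
    (hA : A ∈ words 8) (h6 : (A ∩ C).card = 6) {x : V} (hx : x ∈ A) : x + r ∈ A := by
  obtain ⟨h8, hA'⟩ := mem_words.1 hA
  have h1 := card_symmDiff_add A C
  rw [h8, h12, h6] at h1
  have h2 := Finset.card_inter_add_card_sdiff A C
  obtain ⟨z, z', hzz, hd⟩ := Finset.card_eq_two.1 (by omega : (A \ C).card = 2)
  have hr : z + z' = r := by
    apply eq_of_dot_eq
    intro l
    have e1 := wt_symmDiff A C l
    have e2 := Finset.sum_inter_add_sum_sdiff A C (fun x => sg (l ⬝ᵥ x))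
    rw [hd, Finset.sum_pair hzz] at e2
    have e3 := hA'.wt_eight h8 l
    have e4 := (hA'.symmDiff hC).wt_eight (by omega) l
    change wt (A ∩ C) l + _ = wt A l at e2
    rw [dotProduct_add]
    rcases zmod2_cases (l ⬝ᵥ z) with u | u <;> rcases zmod2_cases (l ⬝ᵥ z') with v | v <;>
      rw [u, v] at e2 ⊢ <;> simp only [sg_zero, sg_one] at e2 <;>
      rcases hw l with ⟨w, w'⟩ | ⟨w, w'⟩ <;> rw [w] <;> first | rfl | (exfalso; omega)
  have hz : z ∈ A := (Finset.mem_sdiff.1 (hd ▸ Finset.mem_insert_self z _)).1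
  have hz' : z' ∈ A := (Finset.mem_sdiff.1
    (hd ▸ Finset.mem_insert_of_mem (Finset.mem_singleton_self z'))).1
  have hA2 := (mem_words_eight.1 hA).2
  refine hA2.add_mem_iff hz ?_ hx
  rw [← hr, ← add_assoc, add_self_eq, zero_add]
  exact hz'

lemma IsWord.card_flats_twelve {C : Finset V} (hC : IsWord C) (h12 : C.card = 12) :
    ((words 8).filter fun A => (A ∩ C).card = 6).card = 20 := by
  obtain ⟨r, hr0, hr, -, hw⟩ := hC.exists_period h12
  have hrr : ∀ x : V, x + r + r = x := fun x => add_add_cancel x r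
  have hxr : ∀ x : V, x ≠ x + r := fun x h => hr0 (add_eq_left.1 h.symm)
  have hsw : ∀ x y : V, x ≠ y + r → x + r ≠ y := fun x y h h' => h (by rw [← h', hrr])
  have hper : ∀ A ∈ words 8, (A ∩ C).card = 6 → ∀ x ∈ A, x + r ∈ A :=
    fun A hA h6 x hx => hC.flat_period h12 hw hA h6 hx
  set 𝒜 := (words 8).filter fun A => (A ∩ C).card = 6 with h𝒜
  have key3 : ∀ a ∈ C, ∀ b ∈ C, ∀ c ∈ C, a ≠ b → a ≠ b + r → a ≠ c → a ≠ c + r → b ≠ c →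
      b ≠ c + r → (((𝒜.filter (a ∈ ·)).filter (b ∈ ·)).filter (c ∈ ·)).card = 1 := by
    intro a ha b hb c hc h1 h2 h3 h4 h5 h6
    rw [h𝒜, Finset.filter_filter, Finset.filter_filter, Finset.filter_filter]
    refine exists_unique_flat_filter (a := a) (b := a + r) (c := b) (d := c) _ (hxr a) h1
      (hsw _ _ h2) h3 (hsw _ _ h4) h5 ?_ ?_
    · rw [← add_assoc, add_self_eq, zero_add, add_comm r]
      exact fun h => h6 (by rw [h, hrr])
    · intro A hA
      constructor
      · rintro ⟨q1, q2, q3, q4⟩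
        exact ⟨q2, hper A hA q1 a q2, q3, q4⟩
      · rintro ⟨q1, q2, q3, q4⟩
        refine ⟨?_, q1, q3, q4⟩
        obtain ⟨e8, hA'⟩ := mem_words_eight.1 hA
        have hp : ∀ x ∈ A, x + r ∈ A := fun x hx => hA'.add_mem_iff q1 q2 hx
        refine le_antisymm ((mem_words.1 hA).2.card_inter_twelve_le hC e8 h12) ?_
        have hsub : ({a, a + r, b, b + r, c, c + r} : Finset V) ⊆ A ∩ C := by
          intro x hx
          simp only [Finset.mem_insert, Finset.mem_singleton] at hx
          rw [Finset.mem_inter]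
          rcases hx with rfl | rfl | rfl | rfl | rfl | rfl
          · exact ⟨q1, ha⟩
          · exact ⟨q2, hr _ ha⟩
          · exact ⟨q3, hb⟩
          · exact ⟨hp _ q3, hr _ hb⟩
          · exact ⟨q4, hc⟩
          · exact ⟨hp _ q4, hr _ hc⟩
        refine le_trans (le_of_eq ?_) (Finset.card_le_card hsub)
        have g1 : ∀ x y : V, x ≠ y → x + r ≠ y + r := fun x y h h' => h (add_right_cancel h')
        rw [Finset.card_insert_of_notMem, Finset.card_insert_of_notMem,
          Finset.card_insert_of_notMem, Finset.card_insert_of_notMem,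
          Finset.card_insert_of_notMem, Finset.card_singleton]
        all_goals simp only [Finset.mem_insert, Finset.mem_singleton, not_or]
        · exact hxr c
        · exact ⟨hsw _ _ h6, g1 _ _ h5⟩
        · exact ⟨hxr b, h5, h6⟩
        · exact ⟨hsw _ _ h2, g1 _ _ h1, hsw _ _ h4, g1 _ _ h3⟩
        · exact ⟨hxr a, h1, h2, h3, h4⟩
  have h6 : ∀ A ∈ 𝒜, (C ∩ A).card = 6 := by
    intro A hA
    rw [Finset.inter_comm]
    exact (Finset.mem_filter.1 hA).2
  have hw8 : ∀ A ∈ 𝒜, ∀ x ∈ A, x + r ∈ A :=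
    fun A hA => hper A (Finset.mem_filter.1 hA).1 (Finset.mem_filter.1 hA).2
  have key2 : ∀ a ∈ C, ∀ b ∈ C, a ≠ b → a ≠ b + r →
      ((𝒜.filter (a ∈ ·)).filter (b ∈ ·)).card = 4 := by
    intro a ha b hb h1 h2
    have hT : ({a, a + r, b, b + r} : Finset V).card = 4 := by
      rw [Finset.card_insert_of_notMem, Finset.card_insert_of_notMem, Finset.card_pair (hxr b)]
      all_goals simp only [Finset.mem_insert, Finset.mem_singleton, not_or]
      · exact ⟨hsw _ _ h2, fun h => h1 (add_right_cancel h)⟩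
      · exact ⟨hxr a, h1, h2⟩
    have hTC : ({a, a + r, b, b + r} : Finset V) ⊆ C := by
      intro x hx
      simp only [Finset.mem_insert, Finset.mem_singleton] at hx
      rcases hx with rfl | rfl | rfl | rfl
      exacts [ha, hr _ ha, hb, hr _ hb]
    have := double_count ((𝒜.filter (a ∈ ·)).filter (b ∈ ·)) (C \ {a, a + r, b, b + r})
      (k := 2) (m := 1) ?_ ?_
    · rw [Finset.card_sdiff_of_subset hTC, hT, h12] at this
      omega
    · intro A hA
      simp only [Finset.mem_filter] at hA
      obtain ⟨⟨hA, q1⟩, q2⟩ := hA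
      rw [card_inter_sdiff, hT, h6 A (by simpa using hA)]
      intro x hx
      refine Finset.mem_inter.2 ⟨hTC hx, ?_⟩
      simp only [Finset.mem_insert, Finset.mem_singleton] at hx
      rcases hx with rfl | rfl | rfl | rfl
      exacts [q1, hw8 A hA _ q1, q2, hw8 A hA _ q2]
    · intro c hc
      simp only [Finset.mem_sdiff, Finset.mem_insert, Finset.mem_singleton, not_or] at hc
      obtain ⟨hc, c1, c2, c3, c4⟩ := hc
      exact key3 a ha b hb c hc h1 h2 (Ne.symm c1) (fun h => c2 (by rw [h, hrr])) (Ne.symm c3)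
        (fun h => c4 (by rw [h, hrr]))
  have key1 : ∀ a ∈ C, (𝒜.filter (a ∈ ·)).card = 10 := by
    intro a ha
    have hTC : ({a, a + r} : Finset V) ⊆ C := by
      intro x hx
      simp only [Finset.mem_insert, Finset.mem_singleton] at hx
      rcases hx with rfl | rfl
      exacts [ha, hr _ ha]
    have := double_count (𝒜.filter (a ∈ ·)) (C \ {a, a + r}) (k := 4) (m := 4) ?_ ?_
    · rw [Finset.card_sdiff_of_subset hTC, Finset.card_pair (hxr a), h12] at this
      omega
    · intro A hA
      simp only [Finset.mem_filter] at hA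
      obtain ⟨hA, q1⟩ := hA
      rw [card_inter_sdiff, Finset.card_pair (hxr a), h6 A (by simpa using hA)]
      intro x hx
      refine Finset.mem_inter.2 ⟨hTC hx, ?_⟩
      simp only [Finset.mem_insert, Finset.mem_singleton] at hx
      rcases hx with rfl | rfl
      exacts [q1, hw8 A hA _ q1]
    · intro b hb
      simp only [Finset.mem_sdiff, Finset.mem_insert, Finset.mem_singleton, not_or] at hb
      obtain ⟨hb, b1, b2⟩ := hb
      exact key2 a ha b hb (Ne.symm b1) (fun h => b2 (by rw [h, hrr]))
  have := double_count 𝒜 C h6 key1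
  omega

lemma add_add_left (a b : V) : a + (a + b) = b := by rw [← add_assoc, add_self_eq, zero_add]

lemma sum_three_ne {a b c : V} (hab : a ≠ b) (hac : a ≠ c) (hbc : b ≠ c) :
    a ≠ a + b + c ∧ b ≠ a + b + c ∧ c ≠ a + b + c := by
  refine ⟨fun h => hbc ?_, fun h => hac ?_, fun h => hab ?_⟩
  · rw [add_assoc] at h
    exact add_eq_zero_iff.1 (add_eq_left.1 h.symm)
  · rw [add_comm a b, add_assoc] at h
    exact add_eq_zero_iff.1 (add_eq_left.1 h.symm)
  · exact add_eq_zero_iff.1 (add_eq_right.1 h.symm)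

lemma card_plane {a b c : V} (hab : a ≠ b) (hac : a ≠ c) (hbc : b ≠ c) :
    ({a, b, c, a + b + c} : Finset V).card = 4 := by
  obtain ⟨h1, h2, h3⟩ := sum_three_ne hab hac hbc
  rw [Finset.card_insert_of_notMem, Finset.card_insert_of_notMem, Finset.card_pair h3]
  all_goals simp only [Finset.mem_insert, Finset.mem_singleton, not_or]
  · exact ⟨hbc, h2⟩
  · exact ⟨hab, hac, h1⟩

lemma plane_subset {A : Finset V} (hA : AffClosed A) {a b c : V} (ha : a ∈ A) (hb : b ∈ A)
    (hc : c ∈ A) : ({a, b, c, a + b + c} : Finset V) ⊆ A := by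
  intro x hx
  simp only [Finset.mem_insert, Finset.mem_singleton] at hx
  rcases hx with rfl | rfl | rfl | rfl
  exacts [ha, hb, hc, hA _ ha _ hb _ hc]

/-- The number of flats of size eight through three points. -/
lemma card_flats_three {a b c : V} (hab : a ≠ b) (hac : a ≠ c) (hbc : b ≠ c) :
    ((words 8).filter fun A => a ∈ A ∧ b ∈ A ∧ c ∈ A).card = 63 := by
  have hT := card_plane hab hac hbc
  have := double_count ((words 8).filter fun A => a ∈ A ∧ b ∈ A ∧ c ∈ A)
    (Finset.univ \ {a, b, c, a + b + c}) (k := 4) (m := 1) ?_ ?_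
  · rw [Finset.card_sdiff_of_subset (Finset.subset_univ _), hT, card_V] at this
    omega
  · intro A hA
    simp only [Finset.mem_filter] at hA
    obtain ⟨hA, q1, q2, q3⟩ := hA
    obtain ⟨h8, hA'⟩ := mem_words_eight.1 hA
    rw [card_inter_sdiff, hT, Finset.univ_inter, h8]
    rw [Finset.univ_inter]
    exact plane_subset hA' q1 q2 q3
  · intro d hd
    simp only [Finset.mem_sdiff, Finset.mem_insert, Finset.mem_singleton, not_or] at hd
    obtain ⟨-, c1, c2, c3, c4⟩ := hd
    rw [Finset.filter_filter]
    exact exists_unique_flat_filter _ hab hac hbc (Ne.symm c1) (Ne.symm c2) (Ne.symm c3) c4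
      (fun A _ => by simp only [and_assoc])

lemma card_flats_two {a b : V} (hab : a ≠ b) :
    ((words 8).filter fun A => a ∈ A ∧ b ∈ A).card = 2667 := by
  have := double_count ((words 8).filter fun A => a ∈ A ∧ b ∈ A)
    (Finset.univ \ {a, b}) (k := 6) (m := 63) ?_ ?_
  · rw [Finset.card_sdiff_of_subset (Finset.subset_univ _), Finset.card_pair hab, card_V] at this
    omega
  · intro A hA
    simp only [Finset.mem_filter] at hA
    obtain ⟨hA, q1, q2⟩ := hA
    rw [card_inter_sdiff, Finset.card_pair hab, Finset.univ_inter, (mem_words_eight.1 hA).1]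
    rw [Finset.univ_inter]
    simp [Finset.insert_subset_iff, q1, q2]
  · intro d hd
    simp only [Finset.mem_sdiff, Finset.mem_insert, Finset.mem_singleton, not_or] at hd
    obtain ⟨-, c1, c2⟩ := hd
    rw [Finset.filter_filter, ← card_flats_three hab (Ne.symm c1) (Ne.symm c2)]
    simp only [and_assoc]

lemma card_flats_one (a : V) : ((words 8).filter fun A => a ∈ A).card = 97155 := by
  have := double_count ((words 8).filter fun A => a ∈ A)
    (Finset.univ \ {a}) (k := 7) (m := 2667) ?_ ?_
  · rw [Finset.card_sdiff_of_subset (Finset.subset_univ _), Finset.card_singleton, card_V] at this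
    omega
  · intro A hA
    simp only [Finset.mem_filter] at hA
    obtain ⟨hA, q1⟩ := hA
    rw [card_inter_sdiff, Finset.card_singleton, Finset.univ_inter, (mem_words_eight.1 hA).1]
    rw [Finset.univ_inter]
    simp [q1]
  · intro d hd
    simp only [Finset.mem_sdiff, Finset.mem_singleton] at hd
    rw [Finset.filter_filter]
    exact card_flats_two (Ne.symm hd.2)

lemma card_words_eight : (words 8).card = 3108960 := by
  have := double_count (words 8) Finset.univ (k := 8) (m := 97155) ?_ ?_
  · rw [card_V] at this
    omega
  · intro A hA
    rw [Finset.univ_inter, (mem_words_eight.1 hA).1]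
  · intro d _
    exact card_flats_one d

lemma eq_of_plane_ssubset {A C : Finset V} (hA : A ∈ words 8) (hC : C ∈ words 8) {a b c d : V}
    (hab : a ≠ b) (hac : a ≠ c) (hbc : b ≠ c) (h : ({a, b, c, a + b + c} : Finset V) ⊆ A ∩ C)
    (hd : d ∈ A ∩ C) (hd' : d ∉ ({a, b, c, a + b + c} : Finset V)) : A = C := by
  simp only [Finset.mem_insert, Finset.mem_singleton, not_or] at hd'
  obtain ⟨c1, c2, c3, c4⟩ := hd'
  obtain ⟨B, -, -, hu⟩ := exists_flat hab hac hbc (Ne.symm c1) (Ne.symm c2) (Ne.symm c3) c4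
  simp only [Finset.insert_subset_iff, Finset.singleton_subset_iff, Finset.mem_inter] at h hd
  rw [hu A hA h.1.1 h.2.1.1 h.2.2.1.1 hd.1, hu C hC h.1.2 h.2.1.2 h.2.2.1.2 hd.2]

lemma card_flats_eight {C : Finset V} (hC : C ∈ words 8) :
    ((words 8).filter fun A => (A ∩ C).card = 4).card = 868 := by
  obtain ⟨h8, hC'⟩ := mem_words_eight.1 hC
  set 𝒜 := (words 8).filter fun A => (A ∩ C).card = 4 with h𝒜
  have h4 : ∀ A ∈ 𝒜, (C ∩ A).card = 4 := by
    intro A hA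
    rw [Finset.inter_comm]
    exact (Finset.mem_filter.1 hA).2
  have h4' : ∀ A ∈ 𝒜, (Finset.univ \ C ∩ A).card = 4 := by
    intro A hA
    have := h4 A hA
    have h1 := Finset.card_inter_add_card_sdiff A C
    have h2 : Finset.univ \ C ∩ A = A \ C := by
      ext x
      simp [and_comm]
    rw [h2]
    rw [Finset.inter_comm, this, (mem_words_eight.1 (Finset.mem_filter.1 hA).1).1] at h1
    omega
  have key3 : ∀ a ∈ C, ∀ b ∈ C, ∀ c ∈ C, a ≠ b → a ≠ c → b ≠ c →
      (((𝒜.filter (a ∈ ·)).filter (b ∈ ·)).filter (c ∈ ·)).card = 62 := by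
    intro a ha b hb c hc hab hac hbc
    have hp := plane_subset hC' ha hb hc
    have := double_count (((𝒜.filter (a ∈ ·)).filter (b ∈ ·)).filter (c ∈ ·)) (Finset.univ \ C)
      (k := 4) (m := 1) ?_ ?_
    · rw [Finset.card_sdiff_of_subset (Finset.subset_univ _), h8, card_V] at this
      omega
    · intro A hA
      simp only [Finset.mem_filter] at hA
      exact h4' A (by simpa using hA.1.1.1)
    · intro d hd
      rw [Finset.mem_sdiff] at hd
      rw [h𝒜, Finset.filter_filter, Finset.filter_filter, Finset.filter_filter,
        Finset.filter_filter]
      refine exists_unique_flat_filter (a := a) (b := b) (c := c) (d := d) _ hab hac hbc ?_ ?_ ?_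
        ?_ ?_
      · rintro rfl
        exact hd.2 ha
      · rintro rfl
        exact hd.2 hb
      · rintro rfl
        exact hd.2 hc
      · rintro rfl
        exact hd.2 (hC' _ ha _ hb _ hc)
      · intro A hA
        constructor
        · rintro ⟨q1, q2, q3, q4, q5⟩
          exact ⟨q2, q3, q4, q5⟩
        · rintro ⟨q2, q3, q4, q5⟩
          refine ⟨?_, q2, q3, q4, q5⟩
          have hpA := Finset.subset_inter (plane_subset (mem_words_eight.1 hA).2 q2 q3 q4) hp
          rw [← card_plane hab hac hbc]
          congr 1
          refine (Finset.Subset.antisymm hpA fun x hx => ?_).symm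
          by_contra hx'
          have := eq_of_plane_ssubset hA hC hab hac hbc hpA hx hx'
          exact hd.2 (this ▸ q5)
  have key2 : ∀ a ∈ C, ∀ b ∈ C, a ≠ b → ((𝒜.filter (a ∈ ·)).filter (b ∈ ·)).card = 186 := by
    intro a ha b hb hab
    have hT : ({a, b} : Finset V) ⊆ C := by simp [Finset.insert_subset_iff, ha, hb]
    have := double_count ((𝒜.filter (a ∈ ·)).filter (b ∈ ·)) (C \ {a, b}) (k := 2) (m := 62) ?_ ?_
    · rw [Finset.card_sdiff_of_subset hT, Finset.card_pair hab, h8] at this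
      omega
    · intro A hA
      simp only [Finset.mem_filter] at hA
      obtain ⟨⟨hA, q1⟩, q2⟩ := hA
      rw [card_inter_sdiff, Finset.card_pair hab, h4 A (by simpa using hA)]
      simp [Finset.insert_subset_iff, ha, hb, q1, q2]
    · intro d hd
      simp only [Finset.mem_sdiff, Finset.mem_insert, Finset.mem_singleton, not_or] at hd
      exact key3 a ha b hb d hd.1 hab (Ne.symm hd.2.1) (Ne.symm hd.2.2)
  have key1 : ∀ a ∈ C, (𝒜.filter (a ∈ ·)).card = 434 := by
    intro a ha
    have := double_count (𝒜.filter (a ∈ ·)) (C \ {a}) (k := 3) (m := 186) ?_ ?_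
    · rw [Finset.card_sdiff_of_subset (by simpa using ha), Finset.card_singleton, h8] at this
      omega
    · intro A hA
      simp only [Finset.mem_filter] at hA
      obtain ⟨hA, q1⟩ := hA
      rw [card_inter_sdiff, Finset.card_singleton, h4 A (by simpa using hA)]
      simp [ha, q1]
    · intro d hd
      simp only [Finset.mem_sdiff, Finset.mem_singleton] at hd
      exact key2 a ha d hd.1 (Ne.symm hd.2)
  have := double_count 𝒜 C h4 key1
  omega

lemma wt_fourteen {C : Finset V} (hC : IsWord C) (h14 : C.card = 14) : ∃ z : V, ∀ l,
    wt C l * sg (l ⬝ᵥ z) = 14 ∨ wt C l * sg (l ⬝ᵥ z) = 6 ∨ wt C l * sg (l ⬝ᵥ z) = -2 := by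
  obtain ⟨z, hz⟩ := hC.exists_center
  refine ⟨z, fun l => ?_⟩
  obtain ⟨e, a1, a2, a3, a4, a5⟩ := hz l
  rcases a5 with ⟨b1, b2⟩ | ⟨b1, b2⟩ <;> rw [b1] <;> simp only [sg_zero, sg_one] <;> omega

lemma rep_fourteen {C : Finset V} (h14 : C.card = 14) {z : V} (hz : ∀ l,
    wt C l * sg (l ⬝ᵥ z) = 14 ∨ wt C l * sg (l ⬝ᵥ z) = 6 ∨ wt C l * sg (l ⬝ᵥ z) = -2) :
    z ∉ C ∧ ∀ x ∈ C, ∀ y ∈ insert z C, x ≠ y → (C.filter fun b => b + (x + y) ∈ C).card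
      = 2 + if x + y + z ∈ C then 4 else 0 := by
  have i1 : ∀ y, ∑ l : V, wt C l * sg (l ⬝ᵥ z) * sg (l ⬝ᵥ y) = if y + z ∈ C then 256 else 0 := by
    intro y
    rw [← wt_inversion, add_comm y]
    refine Finset.sum_congr rfl fun l _ => ?_
    rw [dotProduct_add, sg_add]
    ring
  have i2 : ∀ y, ∑ l : V, (wt C l * sg (l ⬝ᵥ z)) ^ 2 * sg (l ⬝ᵥ y)
      = 256 * (C.filter fun b => b + y ∈ C).card := by
    intro y
    rw [← wt_sq_inversion]
    refine Finset.sum_congr rfl fun l _ => ?_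
    rw [mul_pow, sq (sg _), sg_mul_self, mul_one]
  generalize hg : (fun l => wt C l * sg (l ⬝ᵥ z)) = g at *
  have hg' : ∀ l, wt C l * sg (l ⬝ᵥ z) = g l := fun l => congrFun hg l
  simp only [hg'] at hz i1 i2
  have e : ∀ l, g l ^ 2 = 4 * g l + 12 + 128 * (if g l = 14 then 1 else 0) := by
    intro l
    rcases hz l with h | h | h <;> rw [h] <;> norm_num
  -- the number of functionals with value fourteen
  have s0 : ∀ y, ∑ l : V, (if g l = 14 then 1 else 0) * sg (l ⬝ᵥ y)
      = 2 * (C.filter fun b => b + y ∈ C).card - (8 * if y + z ∈ C then 1 else 0)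
        - 24 * if y = 0 then 1 else 0 := by
    intro y
    have h1 := i2 y
    have h2 : ∀ l, g l ^ 2 * sg (l ⬝ᵥ y) = 4 * (g l * sg (l ⬝ᵥ y)) + 12 * sg (y ⬝ᵥ l)
        + 128 * ((if g l = 14 then 1 else 0) * sg (l ⬝ᵥ y)) := by
      intro l
      rw [e l, dotProduct_comm y]
      ring
    rw [Finset.sum_congr rfl fun l _ => h2 l, Finset.sum_add_distrib, Finset.sum_add_distrib,
      ← Finset.mul_sum, ← Finset.mul_sum, ← Finset.mul_sum, i1, sum_sg_dot] at h1
    split_ifs at h1 ⊢ <;> linarith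
  have c0 : (0 : ℤ) ≤ ∑ l : V, (if g l = 14 then 1 else 0) :=
    Finset.sum_nonneg fun l _ => by split_ifs <;> norm_num
  have s00 := s0 0
  simp only [dotProduct_zero, sg_zero, mul_one, add_zero, zero_add, Finset.filter_mem_eq_inter,
    Finset.inter_self, h14, if_true] at s00
  have hzC : z ∉ C := by
    intro h
    rw [if_pos h] at s00
    norm_num at s00 c0
    omega
  rw [if_neg hzC] at s00
  refine ⟨hzC, ?_⟩
  intro x hx y hy hxy
  have hc : ∀ l, g l = 14 → ∀ x ∈ C, sg (l ⬝ᵥ x) = sg (l ⬝ᵥ z) := by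
    intro l hl
    have hs : ∑ x ∈ C, (1 - sg (l ⬝ᵥ x) * sg (l ⬝ᵥ z)) = 0 := by
      rw [Finset.sum_sub_distrib, ← Finset.sum_mul]
      have := hg' l
      rw [wt] at this
      rw [this, hl]
      simp [h14]
    have h3 := (Finset.sum_eq_zero_iff_of_nonneg ?_).1 hs
    · intro x hx
      have := h3 x hx
      rcases sg_eq (l ⬝ᵥ x) with h | h <;> rcases sg_eq (l ⬝ᵥ z) with h' | h' <;>
        rw [h, h'] at this ⊢ <;> norm_num at this
    · intro x _
      rcases sg_eq (l ⬝ᵥ x) with h | h <;> rcases sg_eq (l ⬝ᵥ z) with h' | h' <;> rw [h, h'] <;>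
        norm_num
  have hcz : ∀ l, g l = 14 → sg (l ⬝ᵥ y) = sg (l ⬝ᵥ z) := by
    intro l hl
    rcases Finset.mem_insert.1 hy with rfl | hy
    · rfl
    · exact hc l hl y hy
  have s1 := s0 (x + y)
  have h5 : ∀ l, (if g l = 14 then 1 else 0) * sg (l ⬝ᵥ (x + y)) = if g l = 14 then 1 else 0 := by
    intro l
    split_ifs with h
    · rw [dotProduct_add, sg_add, hc l h x hx, hcz l h, sg_mul_self, one_mul]
    · simp
  rw [Finset.sum_congr rfl fun l _ => h5 l, s00,
    if_neg (fun h => hxy (add_eq_zero_iff.1 h))] at s1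
  generalize (C.filter fun b => b + (x + y) ∈ C).card = n at s1 ⊢
  split_ifs at s1 ⊢
  · have h6 : (2 * 14 - 8 * 0 - 24 : ℤ) = 2 * (n : ℤ) - 8 * 1 - 24 * 0 := s1
    omega
  · have h6 : (2 * 14 - 8 * 0 - 24 : ℤ) = 2 * (n : ℤ) - 8 * 0 - 24 * 0 := s1
    omega

lemma exists_flat_fourteen {C : Finset V} {z : V} (hzC : z ∉ C)
    (hz : ∀ x ∈ C, ∀ y ∈ insert z C, x ≠ y → (C.filter fun b => b + (x + y) ∈ C).card
      = 2 + if x + y + z ∈ C then 4 else 0) {x : V} (hx : x ∈ C) :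
    insert z (insert x (C.filter fun b => b + (x + z) ∈ C)) ∈ words 8 ∧
      (C ∩ insert z (insert x (C.filter fun b => b + (x + z) ∈ C))).card = 7 := by
  have hxz : x ≠ z := fun h => hzC (h ▸ hx)
  have hn := hz x hx z (Finset.mem_insert_self _ _) hxz
  rw [add_add_cancel, if_pos hx] at hn
  have hxK : x ∉ C.filter fun b => b + (x + z) ∈ C := by
    rw [Finset.mem_filter, add_add_left]
    exact fun h => hzC h.2
  have hzK : z ∉ insert x (C.filter fun b => b + (x + z) ∈ C) := by
    rw [Finset.mem_insert, Finset.mem_filter, not_or]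
    exact ⟨Ne.symm hxz, fun h => hzC h.1⟩
  have hcard : (insert x (C.filter fun b => b + (x + z) ∈ C)).card = 7 := by
    rw [Finset.card_insert_of_notMem hxK, hn]
  have claim : ∀ b ∈ C, ∀ c ∈ C, b + (x + z) ∈ C → c + (x + z) ∈ C → b ≠ c → b ≠ c + (x + z) →
      b + c + z ∈ C := by
    intro b hb c hc hb' hc' h1 h2
    by_contra h
    have h3 := hz b hb c (Finset.mem_insert_of_mem hc) h1
    rw [if_neg h] at h3
    have h4 : ({b, c, b + (x + z), c + (x + z)} : Finset V) ⊆
        C.filter fun t => t + (b + c) ∈ C := by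
      intro t ht
      rw [Finset.mem_filter]
      simp only [Finset.mem_insert, Finset.mem_singleton] at ht
      rcases ht with rfl | rfl | rfl | rfl
      · exact ⟨hb, by rwa [add_add_left]⟩
      · exact ⟨hc, by rwa [add_comm b, add_add_left]⟩
      · exact ⟨hb', by rwa [add_right_comm, add_add_left]⟩
      · exact ⟨hc', by rwa [add_right_comm, add_comm b, add_add_left]⟩
    have hne : ∀ t : V, t ≠ t + (x + z) := fun t h =>
      hxz (add_eq_zero_iff.1 (add_eq_left.1 h.symm))
    have h5 := Finset.card_le_card h4
    rw [h3, Finset.card_insert_of_notMem, Finset.card_insert_of_notMem, Finset.card_pair] at h5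
    · omega
    · exact fun h => h1 (add_right_cancel h)
    · simp only [Finset.mem_insert, Finset.mem_singleton, not_or]
      refine ⟨fun h => h2 ?_, hne c⟩
      rw [h, add_add_cancel]
    · simp only [Finset.mem_insert, Finset.mem_singleton, not_or]
      exact ⟨h1, hne b, h2⟩
  set K := insert z (insert x (C.filter fun b => b + (x + z) ∈ C)) with hK
  have mK : ∀ t, t ∈ K ↔ t = z ∨ t = x ∨ (t ∈ C ∧ t + (x + z) ∈ C) := by
    intro t
    simp only [hK, Finset.mem_insert, Finset.mem_filter]
  have mixed : ∀ b, b ∈ C → b + (x + z) ∈ C → x + b + z ∈ K := by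
    intro b hb hb'
    rw [mK]
    right; right
    have e : x + b + z = b + (x + z) := by rw [add_comm x b, add_assoc]
    rw [e, add_add_cancel]
    exact ⟨hb', hb⟩
  have hadd : ∀ p ∈ K, ∀ q ∈ K, p + q + z ∈ K := by
    intro p hp q hq
    have hp0 := hp
    have hq0 := hq
    rw [mK] at hp hq
    rcases hp with rfl | rfl | ⟨hp, hp'⟩
    · rwa [add_right_comm, add_self_eq, zero_add]
    · rcases hq with rfl | rfl | ⟨hq, hq'⟩
      · rwa [add_add_cancel]
      · rw [add_self_eq, zero_add]
        exact Finset.mem_insert_self _ _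
      · exact mixed q hq hq'
    · rcases hq with rfl | rfl | ⟨hq, hq'⟩
      · rwa [add_add_cancel]
      · rw [add_comm p]
        exact mixed p hp hp'
      · by_cases h1 : p = q
        · rw [h1, add_self_eq, zero_add]
          exact Finset.mem_insert_self _ _
        by_cases h2 : p = q + (x + z)
        · rw [mK]
          right; left
          rw [h2, add_right_comm q, add_self_eq, zero_add, add_add_cancel]
        rw [mK]
        right; right
        refine ⟨claim p hp q hq hp' hq' h1 h2, ?_⟩
        have := claim p hp _ hq' hp' (by rwa [add_add_cancel]) h2 (by rwa [add_add_cancel])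
        have e : p + q + z + (x + z) = p + (q + (x + z)) + z := by abel
        rwa [e]
  refine ⟨mem_words_eight.2 ⟨?_, ?_⟩, ?_⟩
  · rw [hK, Finset.card_insert_of_notMem hzK, hcard]
  · intro p hp q hq r hr
    have := hadd _ (hadd p hp q hq) r hr
    have e : p + q + z + r + z = p + q + r := by
      rw [add_right_comm (p + q), add_add_cancel]
    rwa [e] at this
  · rw [hK, Finset.inter_insert_of_notMem hzC, Finset.inter_eq_right.2, hcard]
    intro t ht
    rcases Finset.mem_insert.1 ht with rfl | ht
    exacts [hx, (Finset.mem_filter.1 ht).1]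

lemma IsWord.card_flats_fourteen {C : Finset V} (hC : IsWord C) (h14 : C.card = 14) :
    ((words 8).filter fun A => (A ∩ C).card = 7).card = 2 := by
  obtain ⟨z, hz⟩ := wt_fourteen hC h14
  obtain ⟨hzC, hrep⟩ := rep_fourteen h14 hz
  have := double_count ((words 8).filter fun A => (A ∩ C).card = 7) C (k := 7) (m := 1) ?_ ?_
  · omega
  · intro A hA
    rw [Finset.inter_comm]
    exact (Finset.mem_filter.1 hA).2
  · intro x hx
    obtain ⟨h1, h2⟩ := exists_flat_fourteen hzC hrep hx
    refine Finset.card_eq_one.2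
      ⟨insert z (insert x (C.filter fun b => b + (x + z) ∈ C)), ?_⟩
    ext A
    simp only [Finset.mem_filter, Finset.mem_singleton]
    constructor
    swap
    · rintro rfl
      refine ⟨⟨h1, by rwa [Finset.inter_comm]⟩, ?_⟩
      exact Finset.mem_insert_of_mem (Finset.mem_insert_self _ _)
    rintro ⟨⟨hA, h7⟩, hxA⟩
    obtain ⟨h8, hA'⟩ := mem_words.1 hA
    have hAc := (mem_words_eight.1 hA).2
    have g1 := card_symmDiff_add A C
    rw [h8, h14, h7] at g1
    have g2 := Finset.card_inter_add_card_sdiff A C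
    obtain ⟨y, hd⟩ := Finset.card_eq_one.1 (by omega : (A \ C).card = 1)
    have hyz : y = z := by
      apply eq_of_dot_eq
      intro l
      have e1 := wt_symmDiff A C l
      have e2 := Finset.sum_inter_add_sum_sdiff A C (fun x => sg (l ⬝ᵥ x))
      rw [hd, Finset.sum_singleton] at e2
      have e3 := hA'.wt_eight h8 l
      have e4 := (hA'.symmDiff hC).wt_eight (by omega) l
      change wt (A ∩ C) l + _ = wt A l at e2
      have e5 := hz l
      rcases zmod2_cases (l ⬝ᵥ z) with u | u <;> rcases zmod2_cases (l ⬝ᵥ y) with v | v <;>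
        rw [u] at e5 ⊢ <;> rw [v] at e2 ⊢ <;> simp only [sg_zero, sg_one] at e2 e5 <;> exfalso <;>
        omega
    subst hyz
    refine Finset.eq_of_subset_of_card_le ?_ (by rw [h8, (mem_words_eight.1 h1).1])
    have hyA : y ∈ A := (Finset.mem_sdiff.1 (hd ▸ Finset.mem_singleton_self y)).1
    have hout : ∀ b ∈ A, b ≠ y → b ∈ C := by
      intro b hb hne
      by_contra hbC
      have : b ∈ A \ C := Finset.mem_sdiff.2 ⟨hb, hbC⟩
      rw [hd, Finset.mem_singleton] at this
      exact hne this
    intro b hb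
    simp only [Finset.mem_insert, Finset.mem_filter]
    by_cases hby : b = y
    · exact Or.inl hby
    by_cases hbx : b = x
    · exact Or.inr (Or.inl hbx)
    refine Or.inr (Or.inr ⟨hout b hb hby, hout _ ?_ ?_⟩)
    · rw [← add_assoc]
      exact hAc b hb x hxA y hyA
    · intro h
      rw [← add_assoc] at h
      exact hbx (add_eq_zero_iff.1 (add_eq_right.1 h))

/-- The number of pairs of words of size eight with a given sum. -/
lemma card_flats_half {w N : ℕ} (h : (w = 8 ∧ N = 868) ∨ (w = 12 ∧ N = 20) ∨ (w = 14 ∧ N = 2))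
    {C : Finset V} (hC : C ∈ words w) :
    ((words 8).filter fun A => 2 * (A ∩ C).card = C.card).card = N := by
  obtain ⟨hw, hC'⟩ := mem_words.1 hC
  rcases h with ⟨rfl, rfl⟩ | ⟨rfl, rfl⟩ | ⟨rfl, rfl⟩
  · refine Eq.trans ?_ (card_flats_eight hC)
    refine congrArg Finset.card (Finset.filter_congr fun A _ => ?_)
    rw [hw]
    exact ⟨fun h => by omega, fun h => by omega⟩
  · refine Eq.trans ?_ (hC'.card_flats_twelve hw)
    refine congrArg Finset.card (Finset.filter_congr fun A _ => ?_)
    rw [hw]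
    exact ⟨fun h => by omega, fun h => by omega⟩
  · refine Eq.trans ?_ (hC'.card_flats_fourteen hw)
    refine congrArg Finset.card (Finset.filter_congr fun A _ => ?_)
    rw [hw]
    exact ⟨fun h => by omega, fun h => by omega⟩

lemma prod_symmDiff {F : V → ℤ} (hF : ∀ x, F x * F x = 1) (A C : Finset V) :
    ∏ x ∈ symmDiff A C, F x = (∏ x ∈ A, F x) * ∏ x ∈ C, F x := by
  have hd : Disjoint (A \ C) (C \ A) := disjoint_sdiff_sdiff
  rw [symmDiff, Finset.sup_eq_union, Finset.prod_union hd, ← Finset.prod_inter_mul_prod_sdiff A C,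
    ← Finset.prod_inter_mul_prod_sdiff C A, Finset.inter_comm C A]
  have h1 : (∏ x ∈ A ∩ C, F x) * ∏ x ∈ A ∩ C, F x = 1 := by
    rw [← Finset.prod_mul_distrib]
    exact Finset.prod_eq_one fun x _ => hF x
  linear_combination (-(∏ x ∈ A \ C, F x) * ∏ x ∈ C \ A, F x) * h1

/-- The signed number of words of size `w`. -/
noncomputable def tsum (F : V → ℤ) (w : ℕ) : ℤ := ∑ C ∈ words w, ∏ x ∈ C, F x

lemma words_disjoint {v w : ℕ} (h : v ≠ w) : Disjoint (words v) (words w) := by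
  rw [Finset.disjoint_left]
  intro C hC hC'
  exact h ((mem_words.1 hC).1.symm.trans (mem_words.1 hC').1)

lemma tsum_fourteen_ge {F : V → ℤ} (hF : ∀ x, F x * F x = 1) :
    -(4 * 3108960) - 1736 * tsum F 8 - 20 * tsum F 12 ≤ tsum F 14 := by
  set χ : Finset V → ℤ := fun A => ∏ x ∈ A, F x with hχ
  have hs : ∀ A C, χ (symmDiff A C) = χ A * χ C := prod_symmDiff hF
  have hss : ∀ A, χ A * χ A = 1 := by
    intro A
    rw [← hs, symmDiff_self]
    simp [hχ]
  have h0 : 0 ≤ ∑ x : V, (∑ A ∈ words 8, if x ∈ A then χ A else 0) ^ 2 :=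
    Finset.sum_nonneg fun x _ => sq_nonneg _
  have h1 : ∑ x : V, (∑ A ∈ words 8, if x ∈ A then χ A else 0) ^ 2
      = ∑ A ∈ words 8, ∑ B ∈ words 8, ((A ∩ B).card : ℤ) * χ (symmDiff A B) := by
    simp only [sq, Finset.sum_mul_sum]
    rw [Finset.sum_comm]
    refine Finset.sum_congr rfl fun A _ => ?_
    rw [Finset.sum_comm]
    refine Finset.sum_congr rfl fun B _ => ?_
    rw [hs, ← Finset.univ_inter (A ∩ B), ← Finset.filter_mem_eq_inter, Finset.card_filter]
    push_cast
    rw [Finset.sum_mul]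
    refine Finset.sum_congr rfl fun x _ => ?_
    simp only [Finset.mem_inter]
    by_cases p : x ∈ A <;> by_cases q : x ∈ B <;> simp [p, q]
  set U := ((words 8 ∪ words 12) ∪ words 14) with hU
  have hUm : ∀ C, C ∈ U ↔ IsWord C ∧ (C.card = 8 ∨ C.card = 12 ∨ C.card = 14) := by
    intro C
    simp only [hU, Finset.mem_union, mem_words]
    constructor
    · rintro ((⟨h, h'⟩ | ⟨h, h'⟩) | ⟨h, h'⟩)
      exacts [⟨h', Or.inl h⟩, ⟨h', Or.inr (Or.inl h)⟩, ⟨h', Or.inr (Or.inr h)⟩]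
    · rintro ⟨h', h | h | h⟩
      exacts [Or.inl (Or.inl ⟨h, h'⟩), Or.inl (Or.inr ⟨h, h'⟩), Or.inr ⟨h, h'⟩]
  have h2 : ∀ A ∈ words 8, ∑ B ∈ words 8, ((A ∩ B).card : ℤ) * χ (symmDiff A B)
      = 8 + ∑ C ∈ U, if 2 * (A ∩ C).card = C.card then (8 - (A ∩ C).card : ℤ) * χ C else 0 := by
    intro A hA
    obtain ⟨hA8, hAw⟩ := mem_words.1 hA
    rw [← Finset.add_sum_erase _ _ hA, symmDiff_self, Finset.inter_self, hA8]
    refine congrArg₂ (· + ·) (by simp [hχ]) ?_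
    rw [← Finset.sum_filter]
    rw [← Finset.sum_filter_add_sum_filter_not _ (fun B => (A ∩ B).card ≠ 0)]
    rw [Finset.sum_eq_zero (s := Finset.filter (fun B => ¬ (A ∩ B).card ≠ 0) _), add_zero]
    swap
    · intro B hB
      rw [Finset.mem_filter, not_not] at hB
      rw [hB.2]
      simp
    have hinter : ∀ C, (A ∩ symmDiff A C).card = 8 - (A ∩ C).card := by
      intro C
      have e : A ∩ symmDiff A C = A \ (A ∩ C) := by
        ext x
        simp only [Finset.mem_inter, Finset.mem_symmDiff, Finset.mem_sdiff]
        by_cases p : x ∈ A <;> by_cases q : x ∈ C <;> simp [p, q]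
      rw [e, Finset.card_sdiff_of_subset Finset.inter_subset_left, hA8]
    have hle : ∀ C, (A ∩ C).card ≤ 8 := by
      intro C
      exact hA8.le.trans' (Finset.card_le_card Finset.inter_subset_left)
    refine Finset.sum_nbij' (symmDiff A) (symmDiff A) ?_ ?_ ?_ ?_ ?_
    · intro B hB
      rw [Finset.mem_filter, Finset.mem_erase] at hB
      obtain ⟨⟨hne, hB⟩, hi⟩ := hB
      obtain ⟨hB8, hBw⟩ := mem_words.1 hB
      have e1 := card_symmDiff_add A B
      rw [hA8, hB8] at e1
      have e2 := (hAw.symmDiff hBw).card_cases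
      have e3 : (symmDiff A B).card ≠ 0 := by
        rw [Ne, Finset.card_eq_zero, ← Finset.bot_eq_empty, symmDiff_eq_bot]
        exact fun h => hne h.symm
      have e4 := hle B
      rw [Finset.mem_filter, hUm, hinter]
      exact ⟨⟨hAw.symmDiff hBw, by omega⟩, by omega⟩
    · intro C hC
      rw [Finset.mem_filter, hUm] at hC
      obtain ⟨⟨hCw, hc⟩, hi⟩ := hC
      have e1 := card_symmDiff_add A C
      rw [hA8] at e1
      have e4 := hle C
      rw [Finset.mem_filter, Finset.mem_erase, hinter, mem_words]
      refine ⟨⟨?_, by omega, hAw.symmDiff hCw⟩, by omega⟩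
      intro h
      have : C = ∅ := by
        have h' := symmDiff_symmDiff_cancel_left A C
        rw [h, symmDiff_self] at h'
        exact h'.symm
      rw [this] at hc
      simp at hc
    · intro B _
      exact symmDiff_symmDiff_cancel_left A B
    · intro B _
      exact symmDiff_symmDiff_cancel_left A B
    · intro B _
      rw [hinter, Nat.cast_sub (hle B)]
      push_cast
      ring
  have h3 : ∀ w N : ℕ, (w = 8 ∧ N = 868) ∨ (w = 12 ∧ N = 20) ∨ (w = 14 ∧ N = 2) →
      ∑ C ∈ words w, ∑ A ∈ words 8,
        (if 2 * (A ∩ C).card = C.card then (8 - (A ∩ C).card : ℤ) * χ C else 0)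
      = ((8 - w / 2 : ℕ) : ℤ) * N * tsum F w := by
    intro w N h
    rw [tsum, Finset.mul_sum]
    refine Finset.sum_congr rfl fun C hC => ?_
    have e := card_flats_half h hC
    have hw := (mem_words.1 hC).1
    rw [← Finset.sum_filter, Finset.sum_congr rfl (g := fun _ => ((8 - w / 2 : ℕ) : ℤ) * χ C),
      Finset.sum_const, e, nsmul_eq_mul]
    · ring
    · intro A hA
      rw [Finset.mem_filter, hw] at hA
      have : (A ∩ C).card = w / 2 := by omega
      rw [this, Nat.cast_sub (by omega)]
      rfl
  rw [h1, Finset.sum_congr rfl h2, Finset.sum_add_distrib, Finset.sum_const, card_words_eight,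
    Finset.sum_comm, hU, Finset.sum_union, Finset.sum_union (words_disjoint (by norm_num)),
    h3 8 868 (by norm_num), h3 12 20 (by norm_num), h3 14 2 (by norm_num)] at h0
  · norm_num at h0
    linarith
  · rw [Finset.disjoint_union_left]
    exact ⟨words_disjoint (by norm_num), words_disjoint (by norm_num)⟩

/-- The space spanned by the products of two affine functions. -/
def quads : Submodule (ZMod 2) (V → ZMod 2) :=
  Submodule.span (ZMod 2) {q | ∃ (u v : V) (a b : ZMod 2), q = fun x => (u ⬝ᵥ x + a) * (v ⬝ᵥ x + b)}

/-- The finset of quadratic functions. -/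
noncomputable def Q : Finset (V → ZMod 2) := (Set.toFinite (quads : Set (V → ZMod 2))).toFinset

lemma mem_Q {q : V → ZMod 2} : q ∈ Q ↔ q ∈ quads := by
  rw [Q, Set.Finite.mem_toFinset, SetLike.mem_coe]

lemma mul_affine_mem_Q (u v : V) (a b : ZMod 2) :
    (fun x : V => (u ⬝ᵥ x + a) * (v ⬝ᵥ x + b)) ∈ Q :=
  mem_Q.2 (Submodule.subset_span ⟨u, v, a, b, rfl⟩)

lemma add_mem_Q {p q : V → ZMod 2} (hp : p ∈ Q) (hq : q ∈ Q) : p + q ∈ Q :=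
  mem_Q.2 (quads.add_mem (mem_Q.1 hp) (mem_Q.1 hq))

lemma zero_mem_Q : (0 : V → ZMod 2) ∈ Q := mem_Q.2 quads.zero_mem

lemma one_mem_Q : (1 : V → ZMod 2) ∈ Q := by
  have := mul_affine_mem_Q 0 0 1 1
  simp only [zero_dotProduct, zero_add, mul_one] at this
  exact this

lemma affine_mem_Q (u : V) (a : ZMod 2) : (fun x : V => u ⬝ᵥ x + a) ∈ Q := by
  have := mul_affine_mem_Q u 0 a 1
  simp only [zero_dotProduct, zero_add, mul_one] at this
  exact this

lemma card_Q_pos : 0 < (Q.card : ℤ) := by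
  exact_mod_cast Finset.card_pos.2 ⟨0, zero_mem_Q⟩

lemma quads_le_RM {q : V → ZMod 2} (hq : q ∈ quads) : q ∈ RM 2 8 := by
  induction hq using Submodule.span_induction with
  | mem q h =>
    obtain ⟨u, v, a, b, rfl⟩ := h
    have aff : ∀ (u : V) (a : ZMod 2), ∃ p : MvPolynomial (Fin 8) (ZMod 2),
        p.totalDegree ≤ 1 ∧ ∀ x, u ⬝ᵥ x + a = MvPolynomial.eval x p := by
      intro u a
      refine ⟨∑ i, MvPolynomial.C (u i) * MvPolynomial.X i + MvPolynomial.C a, ?_, ?_⟩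
      · refine (MvPolynomial.totalDegree_add _ _).trans (max_le ?_ ?_)
        · refine MvPolynomial.totalDegree_finsetSum_le fun i _ => ?_
          refine (MvPolynomial.totalDegree_mul _ _).trans ?_
          rw [MvPolynomial.totalDegree_C, MvPolynomial.totalDegree_X]
        · rw [MvPolynomial.totalDegree_C]
          exact Nat.zero_le _
      · intro x
        simp [dotProduct]
    obtain ⟨p, hp, hp'⟩ := aff u a
    obtain ⟨r, hr, hr'⟩ := aff v b
    refine ⟨p * r, (MvPolynomial.totalDegree_mul _ _).trans (by omega), fun x => ?_⟩
    rw [map_mul, ← hp', ← hr']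
  | zero => exact ⟨0, by simp, fun x => by simp⟩
  | add p q _ _ hp hq =>
    obtain ⟨p', hp1, hp2⟩ := hp
    obtain ⟨q', hq1, hq2⟩ := hq
    refine ⟨p' + q', (MvPolynomial.totalDegree_add _ _).trans (max_le hp1 hq1), fun x => ?_⟩
    rw [map_add, ← hp2, ← hq2, Pi.add_apply]
  | smul a q _ hq =>
    obtain ⟨q', hq1, hq2⟩ := hq
    refine ⟨a • q', (MvPolynomial.totalDegree_smul_le _ _).trans hq1, fun x => ?_⟩
    rw [MvPolynomial.smul_eval, ← hq2, Pi.smul_apply, smul_eq_mul]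

/-- Orthogonality of the characters of the space of quadratic functions. -/
lemma sum_Q_char (t : (V → ZMod 2) → ZMod 2) (ht : ∀ p q, t (p + q) = t p + t q)
    [Decidable (∀ q ∈ Q, t q = 0)] :
    ∑ q ∈ Q, sg (t q) = if ∀ q ∈ Q, t q = 0 then (Q.card : ℤ) else 0 := by
  split_ifs with h
  · rw [Finset.sum_congr rfl fun q hq => by rw [h q hq, sg_zero]]
    simp
  · push Not at h
    obtain ⟨p, hp, hp'⟩ := h
    refine sum_char_eq_zero Q _ (a := p) (fun q hq => add_mem_Q hq hp) ?_
    intro q _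
    rw [ht, sg_add, (zmod2_cases (t p)).resolve_left hp']
    simp

lemma isWord_iff {C : Finset V} : IsWord C ↔ ∀ q ∈ Q, ∑ x ∈ C, q x = 0 := by
  constructor
  · intro h q hq
    rw [mem_Q] at hq
    induction hq using Submodule.span_induction with
    | mem q hq =>
      obtain ⟨u, v, a, b, rfl⟩ := hq
      exact h u v a b
    | zero => simp
    | add p q _ _ hp hq => simp [Finset.sum_add_distrib, hp, hq]
    | smul a q _ hq => simp [← Finset.mul_sum, hq]
  · intro h u v a b
    exact h _ (mul_affine_mem_Q u v a b)

open scoped Classical in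
/-- The sets of size `w` on which summation agrees with the functional `φ` on quadratics. -/
noncomputable def twords (φ : (V → ZMod 2) → ZMod 2) (w : ℕ) : Finset (Finset V) :=
  (Finset.univ.powersetCard w).filter fun C => ∀ q ∈ Q, ∑ x ∈ C, q x = φ q

lemma mem_twords {φ : (V → ZMod 2) → ZMod 2} {w : ℕ} {C : Finset V} :
    C ∈ twords φ w ↔ C.card = w ∧ ∀ q ∈ Q, ∑ x ∈ C, q x = φ q := by
  simp [twords]

lemma twords_zero (w : ℕ) : twords (fun _ => 0) w = words w := by
  ext C
  rw [mem_twords, mem_words, isWord_iff]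

lemma sum_Q_esum (F : V → ℤ) (φ : (V → ZMod 2) → ZMod 2) (hφ : ∀ p q, φ (p + q) = φ p + φ q)
    (w : ℕ) : ∑ q ∈ Q, sg (φ q) * esum Finset.univ (fun x => F x * sg (q x)) w
      = Q.card * ∑ C ∈ twords φ w, ∏ x ∈ C, F x := by
  classical
  simp only [esum, Finset.mul_sum]
  rw [Finset.sum_comm, twords, Finset.sum_filter]
  refine Finset.sum_congr rfl fun C _ => ?_
  have h := sum_Q_char (fun q => ∑ x ∈ C, q x + φ q) (fun p q => by
    rw [hφ]
    simp only [Pi.add_apply, Finset.sum_add_distrib]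
    abel)
  simp only [add_eq_zero_iff] at h
  have h2 : ∀ q, sg (φ q) * ∏ x ∈ C, F x * sg (q x)
      = (∏ x ∈ C, F x) * sg (∑ x ∈ C, q x + φ q) := by
    intro q
    rw [Finset.prod_mul_distrib, sg_add, sg_sum]
    ring
  simp only [h2, ← Finset.mul_sum, h]
  split_ifs <;> ring

/-- The correlation of `f` with `q`. -/
def corr (f q : V → ZMod 2) : ℤ := ∑ x : V, sg (f x) * sg (q x)

lemma sum_sg_eq {ι : Type*} (s : Finset ι) (h : ι → ZMod 2) :
    ∑ x ∈ s, sg (h x) = s.card - 2 * (s.filter fun x => h x = 1).card := by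
  rw [Finset.card_filter, Finset.card_eq_sum_ones]
  push_cast
  rw [Finset.mul_sum, ← Finset.sum_sub_distrib]
  refine Finset.sum_congr rfl fun x _ => ?_
  rcases zmod2_cases (h x) with h0 | h0 <;> rw [h0] <;> simp

lemma card_filter_mod {ι : Type*} (s : Finset ι) (h : ι → ZMod 2) :
    (((s.filter fun x => h x = 1).card : ℕ) : ZMod 2) = ∑ x ∈ s, h x := by
  rw [Finset.card_filter]
  push_cast
  refine Finset.sum_congr rfl fun x _ => ?_
  rcases zmod2_cases (h x) with h0 | h0 <;> rw [h0] <;> simp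

lemma natCast_zmod2 (n : ℕ) : ((n : ZMod 2) = 0 ∧ n % 2 = 0) ∨ ((n : ZMod 2) = 1 ∧ n % 2 = 1) := by
  rcases Nat.mod_two_eq_zero_or_one n with h | h
  · left
    exact ⟨(ZMod.natCast_eq_zero_iff _ _).2 (Nat.dvd_of_mod_eq_zero h), h⟩
  · right
    refine ⟨?_, h⟩
    rw [← Nat.div_add_mod n 2, h]
    push_cast
    have : (2 : ZMod 2) = 0 := rfl
    rw [this, zero_mul, zero_add]

lemma corr_eq_kraw (f q : V → ZMod 2) (w : ℕ) :
    esum Finset.univ (fun x => sg (f x) * sg (q x)) w = kraw 256 (corr f q) w := by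
  rw [esum_eq_kraw, card_V, corr]
  intro x _
  rw [mul_mul_mul_comm, sg_mul_self, sg_mul_self, one_mul]

lemma corr_eq (f q : V → ZMod 2) : corr f q = 256 - 2 * (hd (n := 8) f q : ℤ) := by
  have h := sum_sg_eq (Finset.univ : Finset V) (fun x => f x + q x)
  have h1 : (Finset.univ.filter fun x => f x + q x = 1).card = hd (n := 8) f q := by
    rw [hd]
    refine congrArg Finset.card (Finset.filter_congr fun x _ => ?_)
    generalize f x = a
    generalize q x = b
    revert a b
    decide
  rw [h1, card_V] at h
  rw [corr, Finset.sum_congr rfl fun x _ => (sg_add (f x) (q x)).symm, h]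
  norm_num

lemma corr_bound {f : V → ZMod 2} (hf : 97 ≤ nl (n := 8) 2 f) {q : V → ZMod 2} (hq : q ∈ Q) :
    -62 ≤ corr f q ∧ corr f q ≤ 62 := by
  have key : ∀ q ∈ Q, corr f q ≤ 62 := by
    intro q hq
    have h1 : nl (n := 8) 2 f ≤ hd (n := 8) f q :=
      Nat.sInf_le ⟨q, quads_le_RM (mem_Q.1 hq), rfl⟩
    rw [corr_eq]
    omega
  refine ⟨?_, key q hq⟩
  have h1 := key (q + 1) (add_mem_Q hq one_mem_Q)
  have h2 : corr f (q + 1) = - corr f q := by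
    rw [corr, corr, ← Finset.sum_neg_distrib]
    refine Finset.sum_congr rfl fun x _ => ?_
    rw [Pi.add_apply, sg_add, Pi.one_apply, sg_one]
    ring
  omega

lemma isWord_univ : IsWord Finset.univ := by
  intro u v a b
  by_cases hu : ∃ s : V, s ≠ 0 ∧ u ⬝ᵥ s = 0 ∧ v ⬝ᵥ s = 0
  · obtain ⟨s, hs, h1, h2⟩ := hu
    refine Finset.sum_involution (fun z _ => z + s) ?_ ?_ ?_ ?_
    · intro z _
      rw [dotProduct_add, dotProduct_add, h1, h2, add_zero, add_zero, add_self_eq]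
    · intro z _ _ h
      exact hs (add_eq_left.1 h)
    · intro z _
      exact Finset.mem_univ _
    · intro z _
      exact add_add_cancel _ _
  · exfalso
    apply hu
    obtain ⟨x, _, y, _, hxy, he⟩ := Finset.exists_ne_map_eq_of_card_lt_of_maps_to
      (s := (Finset.univ : Finset V)) (t := (Finset.univ : Finset (ZMod 2 × ZMod 2)))
      (f := fun x => (u ⬝ᵥ x, v ⬝ᵥ x)) (by rw [card_V]; simp)
      (fun _ _ => Finset.mem_coe.2 (Finset.mem_univ _))
    simp only [Prod.mk.injEq] at he
    refine ⟨x + y, fun h => hxy (add_eq_zero_iff.1 h), ?_, ?_⟩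
    · rw [dotProduct_add, he.1, add_self_eq]
    · rw [dotProduct_add, he.2, add_self_eq]

lemma corr_mod_four (f : V → ZMod 2) {q : V → ZMod 2} (hq : q ∈ Q) :
    (∑ x, f x = 0 ∧ corr f q % 4 = 0) ∨ (∑ x, f x = 1 ∧ corr f q % 4 = 2) := by
  have h1 := sum_sg_eq (Finset.univ : Finset V) (fun x => f x + q x)
  have h2 := card_filter_mod (Finset.univ : Finset V) (fun x => f x + q x)
  rw [Finset.sum_add_distrib, isWord_iff.1 isWord_univ q hq, add_zero] at h2
  rw [← h2, corr, Finset.sum_congr rfl fun x _ => (sg_add (f x) (q x)).symm, h1, card_V]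
  rcases natCast_zmod2 (Finset.univ.filter fun x => f x + q x = 1).card with ⟨h, h'⟩ | ⟨h, h'⟩
  · left
    exact ⟨h, by omega⟩
  · right
    exact ⟨h, by omega⟩

/-- The hyperplane `x i = 0`. -/
def half (i : Fin 8) : Finset V := Finset.univ.filter fun x => x i = 0

/-- The orthogonal complement of `r`. -/
def perp (r : V) : Finset V := Finset.univ.filter fun u => u ⬝ᵥ r = 0

lemma mem_half {i : Fin 8} {x : V} : x ∈ half i ↔ x i = 0 := by simp [half]

lemma mem_perp {r u : V} : u ∈ perp r ↔ u ⬝ᵥ r = 0 := by simp [perp]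

lemma sum_perp {r : V} (g : V → ℤ) :
    2 * ∑ u ∈ perp r, g u = ∑ u, g u + ∑ u, g u * sg (r ⬝ᵥ u) := by
  rw [perp, Finset.sum_filter, Finset.mul_sum, ← Finset.sum_add_distrib]
  refine Finset.sum_congr rfl fun u _ => ?_
  rw [dotProduct_comm r u]
  rcases zmod2_cases (u ⬝ᵥ r) with h | h
  · rw [if_pos h, h, sg_zero]
    ring
  · rw [if_neg (by rw [h]; decide), h, sg_one]
    ring

lemma sum_perp_sg {r : V} (hr : r ≠ 0) (z : V) :
    ∑ u ∈ perp r, sg (u ⬝ᵥ z) = if z = 0 ∨ z = r then 128 else 0 := by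
  have h := sum_perp (r := r) fun u => sg (u ⬝ᵥ z)
  have h1 : ∀ u : V, sg (u ⬝ᵥ z) * sg (r ⬝ᵥ u) = sg ((z + r) ⬝ᵥ u) := by
    intro u
    rw [add_dotProduct, sg_add, dotProduct_comm u z]
  simp only [h1, sum_sg_dot, add_eq_zero_iff] at h
  simp only [dotProduct_comm _ z, sum_sg_dot] at h ⊢
  by_cases h0 : z = 0
  · have h2 : z ≠ r := fun h => hr (h.symm.trans h0)
    rw [if_pos h0, if_neg h2] at h
    rw [if_pos (Or.inl h0)]
    omega
  · by_cases h2 : z = r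
    · rw [if_neg h0, if_pos h2] at h
      rw [if_pos (Or.inr h2)]
      omega
    · rw [if_neg h0, if_neg h2] at h
      rw [if_neg (by rintro (h | h); exacts [h0 h, h2 h])]
      omega

lemma card_perp {r : V} (hr : r ≠ 0) : (perp r).card = 128 := by
  have h := sum_perp_sg hr 0
  simp only [dotProduct_zero, sg_zero, Finset.sum_const, nsmul_eq_mul, mul_one, true_or,
    if_true] at h
  exact_mod_cast h

lemma half_eq_perp (i : Fin 8) : half i = perp (Pi.single i 1) := by
  ext x
  rw [mem_half, mem_perp, dot_single]

lemma single_ne_zero (i : Fin 8) : (Pi.single i 1 : V) ≠ 0 := by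
  intro h
  have := congrFun h i
  rw [Pi.single_eq_same, Pi.zero_apply] at this
  exact one_ne_zero this

lemma card_half (i : Fin 8) : (half i).card = 128 := by
  rw [half_eq_perp, card_perp (single_ne_zero i)]

/-- The Walsh transform of the derivative of `f` in direction `r`. -/
def dwalsh (f : V → ZMod 2) (r : V) (i : Fin 8) (u : V) : ℤ :=
  ∑ x ∈ half i, sg (f x + f (x + r)) * sg (u ⬝ᵥ x)

lemma add_notMem_half {r : V} {i : Fin 8} (hr : r i = 1) {x : V} (hx : x ∈ half i) :
    x + r ∉ half i := by
  rw [mem_half] at hx ⊢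
  rw [Pi.add_apply, hx, hr]
  decide

/-- The union of a subset of a hyperplane with its translate. -/
def dbl (r : V) (D : Finset V) : Finset V := D ∪ D.image (· + r)

lemma mem_dbl {r : V} {D : Finset V} {x : V} : x ∈ dbl r D ↔ x ∈ D ∨ x + r ∈ D := by
  rw [dbl, Finset.mem_union, Finset.mem_image]
  refine or_congr Iff.rfl ⟨?_, fun h => ⟨x + r, h, add_add_cancel x r⟩⟩
  rintro ⟨y, hy, rfl⟩
  rwa [add_add_cancel]

lemma dbl_disjoint {r : V} {i : Fin 8} (hr : r i = 1) {D : Finset V} (hD : D ⊆ half i) :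
    Disjoint D (D.image (· + r)) := by
  rw [Finset.disjoint_left]
  intro x hx hx'
  rw [Finset.mem_image] at hx'
  obtain ⟨y, hy, rfl⟩ := hx'
  exact add_notMem_half hr (hD hy) (hD hx)

lemma card_dbl {r : V} {i : Fin 8} (hr : r i = 1) {D : Finset V} (hD : D ⊆ half i) :
    (dbl r D).card = 2 * D.card := by
  rw [dbl, Finset.card_union_of_disjoint (dbl_disjoint hr hD),
    Finset.card_image_of_injective _ (add_left_injective r)]
  ring

lemma sum_dbl {r : V} {i : Fin 8} (hr : r i = 1) {D : Finset V} (hD : D ⊆ half i)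
    (g : V → ZMod 2) : ∑ x ∈ dbl r D, g x = ∑ x ∈ D, (g x + g (x + r)) := by
  rw [dbl, Finset.sum_union (dbl_disjoint hr hD),
    Finset.sum_image fun _ _ _ _ h => add_left_injective r h, Finset.sum_add_distrib]

lemma isWord_dbl {r : V} {i : Fin 8} (hr : r i = 1) {D : Finset V} (hD : D ⊆ half i)
    (hw : D.card % 2 = 0) : IsWord (dbl r D) ↔ ∑ x ∈ D, x = 0 ∨ ∑ x ∈ D, x = r := by
  have hc : (D.card : ZMod 2) = 0 := by
    rw [ZMod.natCast_eq_zero_iff]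
    exact Nat.dvd_of_mod_eq_zero hw
  have key : ∀ (u v : V) (a b : ZMod 2), ∑ x ∈ dbl r D, (u ⬝ᵥ x + a) * (v ⬝ᵥ x + b)
      = (u ⬝ᵥ r) * (v ⬝ᵥ ∑ x ∈ D, x) + (v ⬝ᵥ r) * (u ⬝ᵥ ∑ x ∈ D, x) := by
    intro u v a b
    rw [sum_dbl hr hD]
    have h1 : ∀ x, (u ⬝ᵥ x + a) * (v ⬝ᵥ x + b) + (u ⬝ᵥ (x + r) + a) * (v ⬝ᵥ (x + r) + b)
        = ((u ⬝ᵥ r) * (v ⬝ᵥ x) + (v ⬝ᵥ r) * (u ⬝ᵥ x))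
          + ((u ⬝ᵥ r) * b + (v ⬝ᵥ r) * a + (u ⬝ᵥ r) * (v ⬝ᵥ r)) := by
      intro x
      rw [dotProduct_add, dotProduct_add]
      generalize u ⬝ᵥ x = p
      generalize v ⬝ᵥ x = q
      generalize u ⬝ᵥ r = s
      generalize v ⬝ᵥ r = t
      revert p q s t a b
      decide
    simp only [h1]
    rw [Finset.sum_add_distrib, Finset.sum_const, nsmul_eq_mul, hc, zero_mul, add_zero,
      Finset.sum_add_distrib, ← Finset.mul_sum, ← Finset.mul_sum, dotProduct_sum, dotProduct_sum]
  constructor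
  · intro h
    have h1 : ∀ v : V, v ⬝ᵥ (∑ x ∈ D, x) = (v ⬝ᵥ r) * (∑ x ∈ D, x) i := by
      intro v
      have h2 := h (Pi.single i 1) v 0 0
      rw [key, single_dotProduct, single_dotProduct, hr, one_mul, one_mul, one_mul] at h2
      exact add_eq_zero_iff.1 h2
    rcases zmod2_cases ((∑ x ∈ D, x) i) with h0 | h0
    · left
      refine eq_of_dot_eq fun l => ?_
      rw [h1, h0, mul_zero, dotProduct_zero]
    · right
      refine eq_of_dot_eq fun l => ?_
      rw [h1, h0, mul_one]
  · intro h u v a b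
    rw [key]
    rcases h with h | h <;> rw [h]
    · simp
    · rw [mul_comm, add_self_eq]

lemma dbl_inter_half {r : V} {i : Fin 8} (hr : r i = 1) {C : Finset V}
    (hC : ∀ x ∈ C, x + r ∈ C) : dbl r (C ∩ half i) = C := by
  ext x
  rw [mem_dbl, Finset.mem_inter, Finset.mem_inter]
  constructor
  · rintro (h | h)
    · exact h.1
    · have := hC _ h.1
      rwa [add_add_cancel] at this
  · intro h
    rcases zmod2_cases (x i) with h0 | h0
    · exact Or.inl ⟨h, mem_half.2 h0⟩
    · refine Or.inr ⟨hC x h, mem_half.2 ?_⟩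
      rw [Pi.add_apply, h0, hr]
      decide

lemma inter_half_dbl {r : V} {i : Fin 8} (hr : r i = 1) {D : Finset V} (hD : D ⊆ half i) :
    dbl r D ∩ half i = D := by
  ext x
  rw [Finset.mem_inter, mem_dbl]
  constructor
  · rintro ⟨h | h, h'⟩
    · exact h
    · exact absurd (hD h) (add_notMem_half hr h')
  · exact fun h => ⟨Or.inl h, hD h⟩

lemma sum_dwalsh_kraw (f : V → ZMod 2) {r : V} {i : Fin 8} (hr : r i = 1) {w : ℕ}
    (hw : w % 2 = 0) : ∑ u ∈ perp r, kraw 128 (dwalsh f r i u) w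
      = 128 * ∑ C ∈ (words (2 * w)).filter (fun C => ∀ x ∈ C, x + r ∈ C), ∏ x ∈ C, sg (f x) := by
  classical
  have hr0 : r ≠ 0 := by
    rintro rfl
    exact zero_ne_one hr
  have h1 : ∀ u, kraw 128 (dwalsh f r i u) w
      = ∑ D ∈ (half i).powersetCard w, (∏ x ∈ dbl r D, sg (f x)) * sg (u ⬝ᵥ ∑ x ∈ D, x) := by
    intro u
    have h2 := esum_eq_kraw (half i) (fun x => sg (f x + f (x + r)) * sg (u ⬝ᵥ x)) (by
      intro x _
      rw [mul_mul_mul_comm, sg_mul_self, sg_mul_self, one_mul]) w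
    rw [card_half] at h2
    rw [dwalsh, ← h2, esum]
    refine Finset.sum_congr rfl fun D hD => ?_
    rw [Finset.mem_powersetCard] at hD
    rw [← sg_sum, sum_dbl hr hD.1, Finset.prod_mul_distrib, ← sg_sum, ← sg_sum, dotProduct_sum]
  simp only [h1]
  rw [Finset.sum_comm]
  simp only [← Finset.mul_sum, sum_perp_sg hr0]
  have h3 : ∀ D ∈ (half i).powersetCard w,
      (∏ x ∈ dbl r D, sg (f x)) * (if ∑ x ∈ D, x = 0 ∨ ∑ x ∈ D, x = r then (128 : ℤ) else 0)
      = if IsWord (dbl r D) then 128 * ∏ x ∈ dbl r D, sg (f x) else 0 := by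
    intro D hD
    rw [Finset.mem_powersetCard] at hD
    simp only [isWord_dbl hr hD.1 (by rw [hD.2, hw])]
    split_ifs <;> ring
  rw [Finset.sum_congr rfl h3, ← Finset.sum_filter, Finset.mul_sum]
  refine Finset.sum_bij' (fun D _ => dbl r D) (fun C _ => C ∩ half i) ?_ ?_ ?_ ?_ ?_
  · intro D hD
    rw [Finset.mem_filter, Finset.mem_powersetCard] at hD
    rw [Finset.mem_filter, mem_words, card_dbl hr hD.1.1, hD.1.2]
    refine ⟨⟨rfl, hD.2⟩, fun x hx => ?_⟩
    rw [mem_dbl] at hx ⊢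
    rw [add_add_cancel]
    exact hx.symm
  · intro C hC
    rw [Finset.mem_filter, mem_words] at hC
    have h4 := dbl_inter_half hr hC.2
    have h5 := card_dbl hr (Finset.inter_subset_right : C ∩ half i ⊆ half i)
    rw [Finset.mem_filter, Finset.mem_powersetCard, h4]
    rw [h4, hC.1.1] at h5
    exact ⟨⟨Finset.inter_subset_right, by omega⟩, hC.1.2⟩
  · intro D hD
    rw [Finset.mem_filter, Finset.mem_powersetCard] at hD
    exact inter_half_dbl hr hD.1.1
  · intro C hC
    rw [Finset.mem_filter] at hC
    exact dbl_inter_half hr hC.2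
  · intro D _
    rfl

lemma card_periods_eight {C : Finset V} (hC : C ∈ words 8) :
    ((Finset.univ.erase (0 : V)).filter fun r => ∀ x ∈ C, x + r ∈ C).card = 7 := by
  rw [mem_words_eight] at hC
  obtain ⟨a, ha⟩ : C.Nonempty := by
    rw [← Finset.card_pos, hC.1]
    norm_num
  have h : ((Finset.univ.erase (0 : V)).filter fun r => ∀ x ∈ C, x + r ∈ C)
      = (C.erase a).image (· + a) := by
    ext r
    simp only [Finset.mem_filter, Finset.mem_erase, Finset.mem_image, Finset.mem_univ, and_true]
    constructor
    · rintro ⟨hr, h⟩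
      refine ⟨a + r, ⟨fun h => hr (add_eq_left.1 h), h a ha⟩, ?_⟩
      rw [add_comm a r, add_add_cancel]
    · rintro ⟨b, ⟨hb, hbC⟩, rfl⟩
      refine ⟨fun h => hb (add_eq_zero_iff.1 h), fun x hx => ?_⟩
      rw [← add_assoc]
      exact hC.2 _ hx _ hbC _ ha
  rw [h, Finset.card_image_of_injective _ (add_left_injective a), Finset.card_erase_of_mem ha, hC.1]

lemma card_periods_twelve {C : Finset V} (hC : C ∈ words 12) :
    ((Finset.univ.erase (0 : V)).filter fun r => ∀ x ∈ C, x + r ∈ C).card = 1 := by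
  rw [mem_words] at hC
  obtain ⟨r, hr, h1, h2, -⟩ := hC.2.exists_period hC.1
  refine Finset.card_eq_one.2 ⟨r, ?_⟩
  ext s
  simp only [Finset.mem_filter, Finset.mem_erase, Finset.mem_univ, and_true, Finset.mem_singleton]
  constructor
  · rintro ⟨h3, h4⟩
    exact h2 s h3 h4
  · rintro rfl
    exact ⟨hr, h1⟩

lemma sum_periods {w N : ℕ} (F : V → ℤ)
    (h : ∀ C ∈ words w, ((Finset.univ.erase (0 : V)).filter fun r => ∀ x ∈ C, x + r ∈ C).card = N) :
    ∑ r ∈ Finset.univ.erase (0 : V),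
      ∑ C ∈ (words w).filter (fun C => ∀ x ∈ C, x + r ∈ C), ∏ x ∈ C, F x = N * tsum F w := by
  simp only [Finset.sum_filter]
  rw [Finset.sum_comm, tsum, Finset.mul_sum]
  refine Finset.sum_congr rfl fun C hC => ?_
  rw [← Finset.sum_filter, Finset.sum_const, h C hC, nsmul_eq_mul]

lemma exists_eq_one {r : V} (hr : r ≠ 0) : ∃ i, r i = 1 := by
  obtain ⟨i, hi⟩ := exists_dot_eq_one hr
  exact ⟨i, by rwa [dot_single] at hi⟩

lemma words_four : words 4 = ∅ := by
  rw [Finset.eq_empty_iff_forall_notMem]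
  intro C hC
  rw [mem_words] at hC
  exact hC.2.card_ne_four hC.1

lemma sum_dwalsh_sq (f : V → ZMod 2) {r : V} {i : Fin 8} (hr : r i = 1) :
    ∑ u ∈ perp r, kraw 128 (dwalsh f r i u) 2 = 0 := by
  rw [sum_dwalsh_kraw f hr (by norm_num), words_four]
  rw [Finset.filter_empty, Finset.sum_empty, mul_zero]

/-- Lower bounds on the derivatives in all directions add up to a bound for words. -/
lemma tsum_ge_of_dwalsh (f : V → ZMod 2) (A B G : ℤ)
    (h : ∀ (r : V) (i : Fin 8), r i = 1 → 128 * G ≤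
      ∑ u ∈ perp r, (A * kraw 128 (dwalsh f r i u) 4 + B * kraw 128 (dwalsh f r i u) 6)) :
    255 * G ≤ 7 * A * tsum (fun x => sg (f x)) 8 + B * tsum (fun x => sg (f x)) 12 := by
  have h1 : ∀ r ∈ Finset.univ.erase (0 : V), G ≤
      A * ∑ C ∈ (words 8).filter (fun C => ∀ x ∈ C, x + r ∈ C), ∏ x ∈ C, sg (f x)
      + B * ∑ C ∈ (words 12).filter (fun C => ∀ x ∈ C, x + r ∈ C), ∏ x ∈ C, sg (f x) := by
    intro r hr
    obtain ⟨i, hi⟩ := exists_eq_one (Finset.ne_of_mem_erase hr)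
    have h2 := h r i hi
    rw [Finset.sum_add_distrib, ← Finset.mul_sum, ← Finset.mul_sum,
      sum_dwalsh_kraw f hi (by norm_num), sum_dwalsh_kraw f hi (by norm_num)] at h2
    linarith
  have h3 := Finset.sum_le_sum h1
  rw [Finset.sum_add_distrib, ← Finset.mul_sum, ← Finset.mul_sum,
    sum_periods _ fun C hC => card_periods_eight hC,
    sum_periods _ fun C hC => card_periods_twelve hC, Finset.sum_const,
    Finset.card_erase_of_mem (Finset.mem_univ _), card_V, nsmul_eq_mul] at h3
  push_cast at h3
  linarith

lemma abs_dwalsh_le (f : V → ZMod 2) (r : V) (i : Fin 8) (u : V) :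
    -128 ≤ dwalsh f r i u ∧ dwalsh f r i u ≤ 128 := by
  have h : dwalsh f r i u = ∑ x ∈ half i, sg (f x + f (x + r) + u ⬝ᵥ x) := by
    rw [dwalsh]
    exact Finset.sum_congr rfl fun x _ => (sg_add _ _).symm
  have h1 := sum_sg_eq (half i) fun x => f x + f (x + r) + u ⬝ᵥ x
  have h2 := Finset.card_filter_le (half i) fun x => f x + f (x + r) + u ⬝ᵥ x = 1
  rw [card_half] at h1 h2
  omega

lemma sum_half_dot (i : Fin 8) (u : V) : ∑ x ∈ half i, u ⬝ᵥ x = 0 := by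
  have h := isWord_univ (Pi.single i 1) u 1 0
  refine Eq.trans ?_ h
  rw [half, Finset.sum_filter]
  refine Finset.sum_congr rfl fun x _ => ?_
  rw [single_dotProduct, one_mul, add_zero]
  rcases zmod2_cases (x i) with h0 | h0
  · rw [if_pos h0, h0, zero_add, one_mul]
  · rw [if_neg (by rw [h0]; decide), h0, add_self_eq, zero_mul]

lemma dbl_half {r : V} {i : Fin 8} (hr : r i = 1) : dbl r (half i) = Finset.univ := by
  have := dbl_inter_half hr (C := Finset.univ) (fun _ _ => Finset.mem_univ _)
  rwa [Finset.univ_inter] at this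

lemma dwalsh_mod_four (f : V → ZMod 2) {r : V} {i : Fin 8} (hr : r i = 1) (u : V) :
    (∑ x, f x = 0 ∧ dwalsh f r i u % 4 = 0) ∨ (∑ x, f x = 1 ∧ dwalsh f r i u % 4 = 2) := by
  have h : dwalsh f r i u = ∑ x ∈ half i, sg (f x + f (x + r) + u ⬝ᵥ x) := by
    rw [dwalsh]
    exact Finset.sum_congr rfl fun x _ => (sg_add _ _).symm
  have h1 := sum_sg_eq (half i) fun x => f x + f (x + r) + u ⬝ᵥ x
  have h2 := card_filter_mod (half i) fun x => f x + f (x + r) + u ⬝ᵥ x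
  rw [Finset.sum_add_distrib, sum_half_dot, add_zero, ← sum_dbl hr subset_rfl, dbl_half hr] at h2
  rw [card_half] at h1
  rw [← h2, h, h1]
  rcases natCast_zmod2 ((half i).filter fun x => f x + f (x + r) + u ⬝ᵥ x = 1).card with
    ⟨h, h'⟩ | ⟨h, h'⟩
  · left
    exact ⟨h, by omega⟩
  · right
    exact ⟨h, by omega⟩

lemma words_eq_empty {w : ℕ} (h : w = 2 ∨ w = 4 ∨ w = 6 ∨ w = 10) : words w = ∅ := by
  rw [Finset.eq_empty_iff_forall_notMem]
  intro C hC
  rw [mem_words] at hC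
  have := hC.2.card_cases
  omega

lemma tsum_eq_zero (F : V → ℤ) {w : ℕ} (h : w = 2 ∨ w = 4 ∨ w = 6 ∨ w = 10) : tsum F w = 0 := by
  rw [tsum, words_eq_empty h, Finset.sum_empty]

lemma tsum_zero (F : V → ℤ) : tsum F 0 = 1 := by
  have : words 0 = {∅} := by
    ext C
    rw [mem_words, Finset.card_eq_zero, Finset.mem_singleton]
    refine ⟨fun h => h.1, fun h => ⟨h, ?_⟩⟩
    subst h
    intro u v a b
    exact Finset.sum_empty
  rw [tsum, this, Finset.sum_singleton, Finset.prod_empty]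

lemma sum_Q_kraw (f : V → ZMod 2) (w : ℕ) :
    ∑ q ∈ Q, kraw 256 (corr f q) w = Q.card * tsum (fun x => sg (f x)) w := by
  have h := sum_Q_esum (fun x => sg (f x)) (fun _ => 0) (fun _ _ => by rw [add_zero]) w
  rw [twords_zero] at h
  simp only [sg_zero, one_mul, corr_eq_kraw] at h
  exact h

lemma even_corr_certificate : ∀ k : Fin 31,
    71450892412880 + 7161408594445 * kraw 256 (4 * (k : ℕ) - 60) 2
      + 554656210869 * kraw 256 (4 * (k : ℕ) - 60) 4
      + 35370115435 * kraw 256 (4 * (k : ℕ) - 60) 6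
      + 1802395133 * kraw 256 (4 * (k : ℕ) - 60) 8
      + 69270315 * kraw 256 (4 * (k : ℕ) - 60) 10
      + 1792503 * kraw 256 (4 * (k : ℕ) - 60) 12
      + 23531 * kraw 256 (4 * (k : ℕ) - 60) 14 ≤ 0 := by
  decide +kernel

lemma even_dwalsh_certificate : ∀ k : Fin 65,
    -273853837248 - 5138758118 * (2 * kraw 128 (4 * (k : ℕ) - 128) 2)
      ≤ 251649331 * kraw 128 (4 * (k : ℕ) - 128) 4
      + 1321883 * kraw 128 (4 * (k : ℕ) - 128) 6 := by
  decide +kernel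

lemma nl_le_of_even {f : V → ZMod 2} (hf : ∑ x, f x = 0) : nl (n := 8) 2 f ≤ 96 := by
  by_contra! hn
  have hrow : ∀ Y : ℤ, Y % 4 = 0 → -62 ≤ Y → Y ≤ 62 →
      71450892412880 + 7161408594445 * kraw 256 Y 2 + 554656210869 * kraw 256 Y 4
      + 35370115435 * kraw 256 Y 6 + 1802395133 * kraw 256 Y 8 + 69270315 * kraw 256 Y 10
      + 1792503 * kraw 256 Y 12 + 23531 * kraw 256 Y 14 ≤ 0 := by
    intro Y h1 h2 h3
    have h4 := even_corr_certificate ⟨((Y + 60) / 4).toNat, by omega⟩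
    rwa [show 4 * ((((Y + 60) / 4).toNat : ℕ) : ℤ) - 60 = Y by omega] at h4
  have h1 := Finset.sum_le_sum fun q (hq : q ∈ Q) => hrow (corr f q)
    (by
      have := corr_mod_four f hq
      rw [hf] at this
      exact (this.resolve_right fun h => zero_ne_one h.1).2)
    (corr_bound hn hq).1 (corr_bound hn hq).2
  simp only [Finset.sum_add_distrib, ← Finset.mul_sum, sum_Q_kraw, Finset.sum_const, nsmul_eq_mul,
    mul_zero] at h1
  rw [tsum_eq_zero _ (w := 2) (by norm_num), tsum_eq_zero _ (w := 4) (by norm_num),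
    tsum_eq_zero _ (w := 6) (by norm_num), tsum_eq_zero _ (w := 10) (by norm_num)] at h1
  have h2 := tsum_fourteen_ge (F := fun x => sg (f x)) fun x => sg_mul_self _
  have h3 := tsum_ge_of_dwalsh f 251649331 1321883 (-273853837248) (by
    intro r i hr
    have h4 : ∀ u ∈ perp r, -273853837248 - 5138758118 * (2 * kraw 128 (dwalsh f r i u) 2)
        ≤ 251649331 * kraw 128 (dwalsh f r i u) 4 + 1321883 * kraw 128 (dwalsh f r i u) 6 := by
      intro u _
      have h5 := dwalsh_mod_four f hr u
      rw [hf] at h5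
      have h6 := (h5.resolve_right fun h => zero_ne_one h.1).2
      obtain ⟨h7, h8⟩ := abs_dwalsh_le f r i u
      generalize dwalsh f r i u = W at *
      have h9 := even_dwalsh_certificate ⟨((W + 128) / 4).toNat, by omega⟩
      rwa [show 4 * ((((W + 128) / 4).toNat : ℕ) : ℤ) - 128 = W by omega] at h9
    refine le_trans (le_of_eq ?_) (Finset.sum_le_sum h4)
    have hr0 : r ≠ 0 := by
      rintro rfl
      exact zero_ne_one hr
    rw [Finset.sum_sub_distrib, ← Finset.mul_sum, ← Finset.mul_sum, sum_dwalsh_sq f hr,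
      Finset.sum_const, card_perp hr0]
    norm_num)
  have h4 := card_Q_pos
  generalize tsum (fun x => sg (f x)) 8 = T8 at *
  generalize tsum (fun x => sg (f x)) 12 = T12 at *
  generalize tsum (fun x => sg (f x)) 14 = T14 at *
  have h5 : (Q.card : ℤ) * (71450892412880 + 1802395133 * T8 + 1792503 * T12 + 23531 * T14) ≤ 0 := by
    linarith
  have h6 : 71450892412880 + 1802395133 * T8 + 1792503 * T12 + 23531 * T14 ≤ 0 := by
    by_contra! h
    have := mul_pos h4 h
    omega
  omega

lemma exists_deriv {q : V → ZMod 2} (hq : q ∈ Q) (a : V) :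
    ∃ u : V, ∀ x, q x + q (x + a) = u ⬝ᵥ x + (q 0 + q a) := by
  rw [mem_Q] at hq
  induction hq using Submodule.span_induction with
  | mem q h =>
    obtain ⟨u, v, s, t, rfl⟩ := h
    refine ⟨(u ⬝ᵥ a) • v + (v ⬝ᵥ a) • u, fun x => ?_⟩
    simp only [dotProduct_add, add_dotProduct, smul_dotProduct, dotProduct_zero, smul_eq_mul]
    generalize u ⬝ᵥ x = p
    generalize v ⬝ᵥ x = q
    generalize u ⬝ᵥ a = p'
    generalize v ⬝ᵥ a = q'
    revert p q p' q' s t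
    decide
  | zero => exact ⟨0, fun x => by simp⟩
  | add p q _ _ hp hq =>
    obtain ⟨u, hu⟩ := hp
    obtain ⟨v, hv⟩ := hq
    refine ⟨u + v, fun x => ?_⟩
    simp only [Pi.add_apply, add_dotProduct]
    linear_combination hu x + hv x
  | smul c q _ hq =>
    obtain ⟨u, hu⟩ := hq
    refine ⟨c • u, fun x => ?_⟩
    simp only [Pi.smul_apply, smul_dotProduct, smul_eq_mul]
    linear_combination c * hu x

/-- The radical of a function: the directions in which its derivative is constant. -/
def radical (q : V → ZMod 2) : AddSubgroup V where
  carrier := {a | ∀ x, q x + q (x + a) = q 0 + q a}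
  zero_mem' := fun x => by simp only [add_zero, add_self_eq]
  add_mem' := by
    intro a b ha hb x
    have h1 := ha x
    have h2 := hb (x + a)
    have h3 := hb a
    rw [← add_assoc]
    linear_combination h1 + h2 + h3 - add_self_eq (q (x + a)) + add_self_eq (q 0)
      - add_self_eq (q (a + b)) + add_self_eq (q b)
  neg_mem' := by
    intro a ha
    rwa [ZModModule.neg_eq_self]


open scoped Classical in
lemma sum_sg_sq {q : V → ZMod 2} (hq : q ∈ Q) : (∑ x, sg (q x)) ^ 2
    = 256 * ∑ a ∈ Finset.univ.filter (· ∈ radical q), sg (q 0 + q a) := by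
  have h1 : (∑ x, sg (q x)) ^ 2 = ∑ a, ∑ x, sg (q x + q (x + a)) := by
    rw [sq, Finset.sum_mul_sum, Finset.sum_comm]
    simp only [sg_add]
    rw [Finset.sum_comm]
    nth_rewrite 2 [Finset.sum_comm]
    refine Finset.sum_congr rfl fun x _ => ?_
    exact (Fintype.sum_equiv (Equiv.addLeft x) _ _ fun a => rfl).symm
  rw [h1, Finset.mul_sum, Finset.sum_filter]
  refine Finset.sum_congr rfl fun a _ => ?_
  obtain ⟨u, hu⟩ := exists_deriv hq a
  have h2 : ∑ x, sg (q x + q (x + a)) = (if u = 0 then 256 else 0) * sg (q 0 + q a) := by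
    rw [← sum_sg_dot, Finset.sum_mul]
    exact Finset.sum_congr rfl fun x _ => by rw [hu, sg_add]
  have h3 : a ∈ radical q ↔ u = 0 := by
    constructor
    · intro h
      refine eq_of_dot_eq (fun l => ?_)
      have h4 := h l
      rw [hu, add_eq_right] at h4
      rw [dotProduct_comm, h4, dotProduct_zero]
    · rintro rfl x
      rw [hu, zero_dotProduct, zero_add]
  rw [h2, if_congr h3 rfl rfl]
  split_ifs <;> ring

lemma sum_sg_cases {q : V → ZMod 2} (hq : q ∈ Q) :
    ∑ x, sg (q x) = 0 ∨ (∑ x, sg (q x)) ^ 2 = 16 ^ 2 ∨ (∑ x, sg (q x)) ^ 2 = 32 ^ 2 ∨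
      (∑ x, sg (q x)) ^ 2 = 64 ^ 2 ∨ (∑ x, sg (q x)) ^ 2 = 128 ^ 2 ∨
      (∑ x, sg (q x)) ^ 2 = 256 ^ 2 := by
  classical
  have h := sum_sg_sq hq
  by_cases h0 : ∀ a ∈ radical q, q 0 + q a = 0
  · have h1 : ∑ a ∈ Finset.univ.filter (· ∈ radical q), sg (q 0 + q a)
        = (Finset.univ.filter (· ∈ radical q)).card := by
      rw [Finset.card_eq_sum_ones]
      push_cast
      refine Finset.sum_congr rfl fun a ha => ?_
      rw [h0 a (Finset.mem_filter.1 ha).2, sg_zero]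
    have h2 : (Finset.univ.filter (· ∈ radical q)).card = Nat.card (radical q) := by
      rw [Nat.card_eq_fintype_card, Fintype.card_subtype]
    have h3 : Nat.card (radical q) ∣ 2 ^ 8 := by
      have := (radical q).card_addSubgroup_dvd_card
      rwa [Nat.card_eq_fintype_card (α := V), ← Finset.card_univ, card_V] at this
    obtain ⟨k, hk, hk'⟩ := (Nat.dvd_prime_pow Nat.prime_two).1 h3
    rw [h1, h2, hk'] at h
    generalize ∑ x, sg (q x) = S at *
    have hodd : ∀ a m : ℤ, S ^ 2 = m → a ^ 2 < m → m < (a + 1) ^ 2 → 0 ≤ a → False := by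
      intro a m h1 h2 h3 ha
      rw [← h1] at h2 h3
      rw [sq_lt_sq, abs_of_nonneg ha] at h2
      rw [sq_lt_sq, abs_of_nonneg (by omega : 0 ≤ a + 1)] at h3
      omega
    interval_cases k
    · exact Or.inr (Or.inl (by rw [h]; norm_num))
    · exact (hodd 22 512 (by rw [h]; norm_num) (by norm_num) (by norm_num) (by norm_num)).elim
    · exact Or.inr (Or.inr (Or.inl (by rw [h]; norm_num)))
    · exact (hodd 45 2048 (by rw [h]; norm_num) (by norm_num) (by norm_num) (by norm_num)).elim
    · exact Or.inr (Or.inr (Or.inr (Or.inl (by rw [h]; norm_num))))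
    · exact (hodd 90 8192 (by rw [h]; norm_num) (by norm_num) (by norm_num) (by norm_num)).elim
    · exact Or.inr (Or.inr (Or.inr (Or.inr (Or.inl (by rw [h]; norm_num)))))
    · exact (hodd 181 32768 (by rw [h]; norm_num) (by norm_num) (by norm_num) (by norm_num)).elim
    · exact Or.inr (Or.inr (Or.inr (Or.inr (Or.inr (by rw [h]; norm_num)))))
  · left
    push Not at h0
    obtain ⟨a, ha, ha'⟩ := h0
    have h5 : ∑ a ∈ Finset.univ.filter (· ∈ radical q), sg (q 0 + q a) = 0 := by
      refine sum_char_eq_zero (a := a) _ _ (fun x hx => ?_) (fun x hx => ?_)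
      · rw [Finset.mem_filter] at hx ⊢
        exact ⟨Finset.mem_univ _, (radical q).add_mem hx.2 ha⟩
      · have h1 := ha x
        have h2 : q 0 + q (x + a) = (q 0 + q x) + (q 0 + q a) := by
          rw [← h1]
          linear_combination - add_self_eq (q x)
        rw [h2, sg_add, (zmod2_cases _).resolve_left ha', sg_one, mul_neg_one]
    rw [h5, mul_zero] at h
    exact (pow_eq_zero_iff two_ne_zero).1 h

lemma eq_zero_of_sum_sg {q : V → ZMod 2} (h : ∑ x, sg (q x) = 256) : q = 0 := by
  have h1 := sum_sg_eq Finset.univ q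
  rw [card_V, h] at h1
  have h2 : (Finset.univ.filter fun x => q x = 1).card = 0 := by omega
  rw [Finset.card_eq_zero, Finset.filter_eq_empty_iff] at h2
  funext x
  exact (zmod2_cases (q x)).resolve_right (h2 (Finset.mem_univ x))

lemma sum_sg_mod_sixteen {q : V → ZMod 2} (hq : q ∈ Q) : (∑ x, sg (q x)) % 16 = 0 := by
  have key : ∀ S m : ℤ, S ^ 2 = m ^ 2 → m % 16 = 0 → S % 16 = 0 := by
    intro S m h hm
    rcases sq_eq_sq_iff_eq_or_eq_neg.1 h with h | h <;> omega
  rcases sum_sg_cases hq with h | h | h | h | h | h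
  · rw [h]
    rfl
  all_goals exact key _ _ h (by norm_num)

/-- The linear functional induced by `f`. -/
def pair (f q : V → ZMod 2) : ZMod 2 := ∑ x, f x * q x

lemma pair_add (f p q : V → ZMod 2) : pair f (p + q) = pair f p + pair f q := by
  simp only [pair, Pi.add_apply, mul_add, Finset.sum_add_distrib]

lemma card_filter_add {ι : Type*} (s : Finset ι) (g h : ι → ZMod 2) :
    (s.filter fun x => g x + h x = 1).card + 2 * (s.filter fun x => g x * h x = 1).card
      = (s.filter fun x => g x = 1).card + (s.filter fun x => h x = 1).card := by
  simp only [Finset.card_filter]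
  rw [Finset.mul_sum, ← Finset.sum_add_distrib, ← Finset.sum_add_distrib]
  refine Finset.sum_congr rfl fun x _ => ?_
  generalize g x = a
  generalize h x = b
  revert a b
  decide

lemma corr_mod_eight (f : V → ZMod 2) {q : V → ZMod 2} (hq : q ∈ Q) :
    (pair f q = 0 ∧ (corr f q - corr f 0) % 8 = 0) ∨
      (pair f q = 1 ∧ (corr f q - corr f 0) % 8 = 4) := by
  have h1 := card_filter_add Finset.univ f q
  have h2 := sum_sg_eq Finset.univ fun x => f x + q x
  have h3 := sum_sg_eq Finset.univ f
  have h4 := sum_sg_eq Finset.univ q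
  have h5 := sum_sg_mod_sixteen hq
  have h6 := card_filter_mod Finset.univ fun x => f x * q x
  have h7 : corr f q = ∑ x, sg (f x + q x) := by simp only [corr, sg_add]
  have h8 : corr f 0 = ∑ x, sg (f x) := by simp [corr]
  rw [card_V] at h2 h3 h4
  rw [pair, ← h6]
  rcases natCast_zmod2 (Finset.univ.filter fun x => f x * q x = 1).card with ⟨h, h'⟩ | ⟨h, h'⟩
  · left
    exact ⟨h, by omega⟩
  · right
    exact ⟨h, by omega⟩

lemma exists_corr_sign {f : V → ZMod 2} (hf : ∑ x, f x = 1) :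
    ∃ c : ℤ, (c = 1 ∨ c = -1) ∧ ∀ q ∈ Q, (c * sg (pair f q) * corr f q) % 8 = 6 := by
  have h1 := corr_mod_four f zero_mem_Q
  rw [hf] at h1
  have h2 := (h1.resolve_left fun h => one_ne_zero h.1).2
  have h3 : corr f 0 % 8 = 6 ∨ corr f 0 % 8 = 2 := by omega
  rcases h3 with h3 | h3
  · refine ⟨1, Or.inl rfl, fun q hq => ?_⟩
    rcases corr_mod_eight f hq with ⟨h, h'⟩ | ⟨h, h'⟩ <;> rw [h]
    · rw [sg_zero]
      omega
    · rw [sg_one]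
      omega
  · refine ⟨-1, Or.inr rfl, fun q hq => ?_⟩
    rcases corr_mod_eight f hq with ⟨h, h'⟩ | ⟨h, h'⟩ <;> rw [h]
    · rw [sg_zero]
      omega
    · rw [sg_one]
      omega

lemma esum_smul {ι : Type*} (t : Finset ι) (s : ι → ℤ) (c : ℤ) (w : ℕ) :
    esum t (fun x => c * s x) w = c ^ w * esum t s w := by
  rw [esum, esum, Finset.mul_sum]
  refine Finset.sum_congr rfl fun C hC => ?_
  rw [Finset.prod_mul_distrib, Finset.prod_const, (Finset.mem_powersetCard.1 hC).2]

lemma kraw_smul_corr (f q : V → ZMod 2) {c : ℤ} (hc : c * c = 1) (w : ℕ) :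
    kraw 256 (c * corr f q) w = c ^ w * kraw 256 (corr f q) w := by
  rw [← corr_eq_kraw, ← esum_smul, esum_eq_kraw, card_V, corr, Finset.mul_sum]
  intro x _
  rw [mul_mul_mul_comm, hc, mul_mul_mul_comm, sg_mul_self, sg_mul_self]
  rfl

lemma sum_Q_kraw_odd (f : V → ZMod 2) (w : ℕ) :
    ∑ q ∈ Q, sg (pair f q) * kraw 256 (corr f q) w
      = Q.card * ∑ C ∈ twords (pair f) w, ∏ x ∈ C, sg (f x) := by
  rw [← sum_Q_esum _ _ (pair_add f)]
  simp only [corr_eq_kraw]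

lemma abs_prod_sg (f : V → ZMod 2) (C : Finset V) : |∏ x ∈ C, sg (f x)| = 1 := by
  rw [← sg_sum]
  rcases sg_eq (∑ x ∈ C, f x) with h | h <;> rw [h] <;> rfl

lemma abs_sum_twords_le (f : V → ZMod 2) (φ : (V → ZMod 2) → ZMod 2) (w : ℕ) :
    |∑ C ∈ twords φ w, ∏ x ∈ C, sg (f x)| ≤ (twords φ w).card := by
  refine (Finset.abs_sum_le_sum_abs _ _).trans ?_
  simp only [abs_prod_sg, Finset.sum_const, nsmul_eq_mul, mul_one]
  exact le_rfl

lemma odd_certificate {f : V → ZMod 2} (hf : ∑ x, f x = 1) (hn : 97 ≤ nl (n := 8) 2 f)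
    (b : ℕ → ℤ) (A B G : ℤ) (hb14 : 0 ≤ b 14) (hb8 : b 8 = 7 * A + 1736 * b 14)
    (hb12 : b 12 = B + 20 * b 14) (hb11 : b 11 = 0) (hb13 : b 13 = 0)
    (hb : ∀ k : Fin 16, ∑ w ∈ Finset.range 15, b w * kraw 256 (8 * (k : ℕ) - 58) w ≤ 0)
    (hrow : 255 * G ≤ 7 * A * tsum (fun x => sg (f x)) 8 + B * tsum (fun x => sg (f x)) 12) :
    b 0 - 4 * 3108960 * b 14 + 255 * G
      ≤ |b 1| * (twords (pair f) 1).card + |b 3| * (twords (pair f) 3).card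
        + |b 5| * (twords (pair f) 5).card + |b 7| * (twords (pair f) 7).card
        + |b 9| * (twords (pair f) 9).card := by
  obtain ⟨c, hc, hc6⟩ := exists_corr_sign hf
  have hcc : ∀ q, (c * sg (pair f q)) * (c * sg (pair f q)) = 1 := by
    intro q
    rw [mul_mul_mul_comm, sg_mul_self]
    rcases hc with rfl | rfl <;> rfl
  have h1 : ∀ q ∈ Q, ∑ w ∈ Finset.range 15, b w * ((c * sg (pair f q)) ^ w * kraw 256 (corr f q) w)
      ≤ 0 := by
    intro q hq
    have h2 := hc6 q hq
    obtain ⟨h3, h4⟩ := corr_bound hn hq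
    simp only [← kraw_smul_corr f q (hcc q)]
    have h5 : -62 ≤ c * sg (pair f q) * corr f q ∧ c * sg (pair f q) * corr f q ≤ 62 := by
      have h6 : c * sg (pair f q) = 1 ∨ c * sg (pair f q) = -1 := by
        rcases hc with rfl | rfl <;> rcases sg_eq (pair f q) with h | h <;> rw [h] <;> simp
      rcases h6 with h | h <;> rw [h] <;> omega
    generalize c * sg (pair f q) * corr f q = Y at *
    have h6 := hb ⟨((Y + 58) / 8).toNat, by omega⟩
    rwa [show 8 * ((((Y + 58) / 8).toNat : ℕ) : ℤ) - 58 = Y by omega] at h6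
  have h2 := Finset.sum_le_sum h1
  rw [Finset.sum_comm] at h2
  simp only [← Finset.mul_sum, Finset.sum_const, smul_zero] at h2
  have heven : ∀ w, w % 2 = 0 → ∑ q ∈ Q, (c * sg (pair f q)) ^ w * kraw 256 (corr f q) w
      = Q.card * tsum (fun x => sg (f x)) w := by
    intro w hw
    rw [← sum_Q_kraw]
    refine Finset.sum_congr rfl fun q _ => ?_
    obtain ⟨k, rfl⟩ := Nat.dvd_of_mod_eq_zero hw
    rw [pow_mul, sq, hcc, one_pow, one_mul]
  have hodd : ∀ w, w % 2 = 1 → ∑ q ∈ Q, (c * sg (pair f q)) ^ w * kraw 256 (corr f q) w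
      = Q.card * (c * ∑ C ∈ twords (pair f) w, ∏ x ∈ C, sg (f x)) := by
    intro w hw
    rw [mul_left_comm, ← sum_Q_kraw_odd, Finset.mul_sum]
    refine Finset.sum_congr rfl fun q _ => ?_
    obtain ⟨k, rfl⟩ : ∃ k, w = 2 * k + 1 := ⟨w / 2, by omega⟩
    rw [pow_succ, pow_mul, sq, hcc, one_pow, one_mul, mul_assoc]
  have hbd : ∀ w, - (|b w| * (twords (pair f) w).card)
      ≤ b w * (c * ∑ C ∈ twords (pair f) w, ∏ x ∈ C, sg (f x)) := by
    intro w
    refine neg_le_of_abs_le ?_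
    rw [abs_mul, abs_mul]
    have : |c| = 1 := by rcases hc with rfl | rfl <;> rfl
    rw [this, one_mul]
    exact mul_le_mul_of_nonneg_left (abs_sum_twords_le f _ w) (abs_nonneg _)
  simp only [Finset.sum_range_succ, Finset.sum_range_zero, heven 0 rfl, heven 2 rfl, heven 4 rfl,
    heven 6 rfl, heven 8 rfl, heven 10 rfl, heven 12 rfl, heven 14 rfl, hodd 1 rfl, hodd 3 rfl,
    hodd 5 rfl, hodd 7 rfl, hodd 9 rfl, hodd 11 rfl, hodd 13 rfl, hb11, hb13] at h2
  rw [tsum_eq_zero _ (w := 2) (by norm_num), tsum_eq_zero _ (w := 4) (by norm_num),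
    tsum_eq_zero _ (w := 6) (by norm_num), tsum_eq_zero _ (w := 10) (by norm_num), tsum_zero] at h2
  have h3 := tsum_fourteen_ge (F := fun x => sg (f x)) fun x => sg_mul_self _
  have h4 := card_Q_pos
  have h5 := hbd 1
  have h6 := hbd 3
  have h7 := hbd 5
  have h8 := hbd 7
  have h9 := hbd 9
  generalize tsum (fun x => sg (f x)) 8 = T8 at *
  generalize tsum (fun x => sg (f x)) 12 = T12 at *
  generalize tsum (fun x => sg (f x)) 14 = T14 at *
  generalize c * ∑ C ∈ twords (pair f) 1, ∏ x ∈ C, sg (f x) = K1 at *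
  generalize c * ∑ C ∈ twords (pair f) 3, ∏ x ∈ C, sg (f x) = K3 at *
  generalize c * ∑ C ∈ twords (pair f) 5, ∏ x ∈ C, sg (f x) = K5 at *
  generalize c * ∑ C ∈ twords (pair f) 7, ∏ x ∈ C, sg (f x) = K7 at *
  generalize c * ∑ C ∈ twords (pair f) 9, ∏ x ∈ C, sg (f x) = K9 at *
  have h10 : (Q.card : ℤ) * (b 0 + b 1 * K1 + b 3 * K3 + b 5 * K5 + b 7 * K7 + b 9 * K9
      + b 8 * T8 + b 12 * T12 + b 14 * T14) ≤ 0 := by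
    linarith
  have h11 : b 0 + b 1 * K1 + b 3 * K3 + b 5 * K5 + b 7 * K7 + b 9 * K9
      + b 8 * T8 + b 12 * T12 + b 14 * T14 ≤ 0 := by
    by_contra! h
    have := mul_pos h4 h
    omega
  have h12 := mul_le_mul_of_nonneg_left h3 hb14
  rw [hb8, hb12] at h11
  linarith

/-- The number of points of a hyperplane where both the derivative and `u` are nonzero. -/
def dcount (f : V → ZMod 2) (r : V) (i : Fin 8) (u : V) : ℕ :=
  ((half i).filter fun x => (f x + f (x + r)) * (u ⬝ᵥ x) = 1).card

/-- The number of points of a hyperplane where the derivative is nonzero. -/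
def dcard (f : V → ZMod 2) (r : V) (i : Fin 8) : ℕ :=
  ((half i).filter fun x => f x + f (x + r) = 1).card

lemma dwalsh_eq (f : V → ZMod 2) (r : V) (i : Fin 8) (u : V) :
    (dwalsh f r i u + 2 * dcard f r i - 4 * dcount f r i u) % 128 = 0 := by
  have h : dwalsh f r i u = ∑ x ∈ half i, sg (f x + f (x + r) + u ⬝ᵥ x) := by
    rw [dwalsh]
    exact Finset.sum_congr rfl fun x _ => (sg_add _ _).symm
  have h1 := sum_sg_eq (half i) fun x => f x + f (x + r) + u ⬝ᵥ x
  have h2 := card_filter_add (half i) (fun x => f x + f (x + r)) (fun x => u ⬝ᵥ x)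
  have h3 := sum_sg_eq (half i) fun x => u ⬝ᵥ x
  have h4 : ∑ x ∈ half i, sg (u ⬝ᵥ x) = if u = 0 ∨ u = Pi.single i 1 then 128 else 0 := by
    rw [← sum_perp_sg (single_ne_zero i), half_eq_perp]
    simp only [dotProduct_comm u]
  rw [card_half] at h1 h3
  rw [h, h1, dcard, dcount]
  split_ifs at h4 <;> omega

lemma cast_dcount (f : V → ZMod 2) {r : V} {i : Fin 8} (hr : r i = 1) {u : V} (hu : u ∈ perp r) :
    (dcount f r i u : ZMod 2) = pair f fun x => u ⬝ᵥ x := by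
  rw [dcount, card_filter_mod, pair, ← dbl_half hr, sum_dbl hr subset_rfl]
  refine Finset.sum_congr rfl fun x _ => ?_
  rw [dotProduct_add, mem_perp.1 hu, add_zero, add_mul]

lemma dcard_mod_two {f : V → ZMod 2} (hf : ∑ x, f x = 1) {r : V} {i : Fin 8} (hr : r i = 1) :
    dcard f r i % 2 = 1 := by
  have h := card_filter_mod (half i) fun x => f x + f (x + r)
  rw [← sum_dbl hr subset_rfl, dbl_half hr, hf] at h
  rcases natCast_zmod2 (dcard f r i) with ⟨hd, -⟩ | ⟨-, hd⟩
  · rw [dcard, h] at hd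
    exact absurd hd one_ne_zero
  · exact hd

/-- A normalisation of the derivative's Walsh transform. -/
def twalsh (f : V → ZMod 2) (r : V) (i : Fin 8) (u : V) : ℤ :=
  (if dcard f r i % 4 = 1 then -1 else 1) * sg (pair f fun x => u ⬝ᵥ x) * dwalsh f r i u

lemma twalsh_sign (f : V → ZMod 2) (r : V) (i : Fin 8) (u : V) :
    twalsh f r i u = dwalsh f r i u ∨ twalsh f r i u = - dwalsh f r i u := by
  rw [twalsh]
  rcases sg_eq (pair f fun x => u ⬝ᵥ x) with h | h <;> rw [h] <;> split_ifs <;> simp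

lemma twalsh_mod {f : V → ZMod 2} (hf : ∑ x, f x = 1) {r : V} {i : Fin 8} (hr : r i = 1) {u : V}
    (hu : u ∈ perp r) : twalsh f r i u % 8 = 2 := by
  have h1 := dwalsh_eq f r i u
  have h2 := cast_dcount f hr hu
  have h3 := dcard_mod_two hf hr
  rw [twalsh, ← h2]
  rcases natCast_zmod2 (dcount f r i u) with ⟨h, h'⟩ | ⟨h, h'⟩ <;> rw [h]
  · rw [sg_zero]
    split_ifs <;> omega
  · rw [sg_one]
    split_ifs <;> omega

lemma abs_twalsh_le (f : V → ZMod 2) (r : V) (i : Fin 8) (u : V) :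
    -128 ≤ twalsh f r i u ∧ twalsh f r i u ≤ 128 := by
  have h := abs_dwalsh_le f r i u
  rcases twalsh_sign f r i u with h' | h' <;> rw [h'] <;> omega

lemma kraw_smul_dwalsh (f : V → ZMod 2) (r : V) (i : Fin 8) (u : V) {c : ℤ} (hc : c * c = 1) (w : ℕ) :
    kraw 128 (c * dwalsh f r i u) w = c ^ w * kraw 128 (dwalsh f r i u) w := by
  have h1 : ∀ x, sg (f x + f (x + r)) * sg (u ⬝ᵥ x) * (sg (f x + f (x + r)) * sg (u ⬝ᵥ x)) = 1 := by
    intro x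
    rw [mul_mul_mul_comm, sg_mul_self, sg_mul_self, one_mul]
  have h2 := esum_eq_kraw (half i) (fun x => sg (f x + f (x + r)) * sg (u ⬝ᵥ x)) (fun x _ => h1 x) w
  have h3 := esum_eq_kraw (half i) (fun x => c * (sg (f x + f (x + r)) * sg (u ⬝ᵥ x)))
    (fun x _ => by rw [mul_mul_mul_comm, hc, h1, one_mul]) w
  rw [card_half] at h2 h3
  rw [← Finset.mul_sum, esum_smul, h2] at h3
  exact h3.symm

lemma kraw_twalsh (f : V → ZMod 2) (r : V) (i : Fin 8) (u : V) {w : ℕ} (hw : w % 2 = 0) :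
    kraw 128 (twalsh f r i u) w = kraw 128 (dwalsh f r i u) w := by
  obtain ⟨k, rfl⟩ := Nat.dvd_of_mod_eq_zero hw
  rcases twalsh_sign f r i u with h | h <;> rw [h]
  rw [← neg_one_mul, kraw_smul_dwalsh f r i u (by norm_num), pow_mul]
  norm_num

lemma sum_dwalsh_mul_sg (f : V → ZMod 2) {r : V} {i : Fin 8} (hr : r i = 1) (y : V) :
    ∑ u ∈ perp r, dwalsh f r i u * sg (u ⬝ᵥ y) = 128 * sg (f y + f (y + r)) := by
  have hr0 : r ≠ 0 := by
    rintro rfl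
    exact zero_ne_one hr
  have h1 : ∀ u, dwalsh f r i u * sg (u ⬝ᵥ y)
      = ∑ x ∈ half i, sg (f x + f (x + r)) * sg (u ⬝ᵥ (x + y)) := by
    intro u
    rw [dwalsh, Finset.sum_mul]
    refine Finset.sum_congr rfl fun x _ => ?_
    rw [dotProduct_add, sg_add (u ⬝ᵥ x), mul_assoc]
  simp only [h1]
  rw [Finset.sum_comm]
  simp only [← Finset.mul_sum, sum_perp_sg hr0]
  obtain ⟨z, hz, hz'⟩ : ∃ z ∈ half i, z = y ∨ z = y + r := by
    rcases zmod2_cases (y i) with h | h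
    · exact ⟨y, mem_half.2 h, Or.inl rfl⟩
    · refine ⟨y + r, mem_half.2 ?_, Or.inr rfl⟩
      rw [Pi.add_apply, h, hr]
      decide
  rw [Finset.sum_eq_single_of_mem z hz]
  · rw [if_pos, mul_comm]
    · rcases hz' with rfl | rfl
      · rfl
      · rw [add_add_cancel, add_comm (f (y + r))]
    · rcases hz' with rfl | rfl
      · exact Or.inl (add_self_eq _)
      · right
        rw [add_comm y r, add_add_cancel]
  · intro x hx hxz
    rw [if_neg, mul_zero]
    have h2 : ∀ a b : V, a ∈ half i → b ∈ half i → a = b ∨ a = b + r → a = b := by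
      rintro a b ha hb (h | h)
      · exact h
      · exact absurd (h ▸ ha) (add_notMem_half hr hb)
    intro h3
    apply hxz
    apply h2 x z hx hz
    rw [add_eq_zero_iff] at h3
    have h4 : x = y ∨ x = y + r := by
      refine h3.imp id fun h => ?_
      rw [← h, add_comm x, ← add_assoc, add_self_eq, zero_add]
    rcases h4 with rfl | rfl <;> rcases hz' with rfl | rfl
    · exact Or.inl rfl
    · exact Or.inr (add_add_cancel _ _).symm
    · exact Or.inr rfl
    · exact Or.inl rfl

lemma pair_dot_add (f : V → ZMod 2) (u v : V) : (pair f fun x => (u + v) ⬝ᵥ x)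
    = (pair f fun x => u ⬝ᵥ x) + pair f fun x => v ⬝ᵥ x := by
  rw [← pair_add]
  refine congrArg _ (funext fun x => ?_)
  rw [Pi.add_apply, add_dotProduct]

lemma abs_sum_twalsh_le (f : V → ZMod 2) {r : V} {i : Fin 8} (hr : r i = 1) (y : V) :
    -128 ≤ ∑ u ∈ perp r, twalsh f r i u * sg (u ⬝ᵥ y) ∧
      ∑ u ∈ perp r, twalsh f r i u * sg (u ⬝ᵥ y) ≤ 128 := by
  obtain ⟨z, hz⟩ := exists_dot_of_additive (fun u => pair f fun x => u ⬝ᵥ x) (pair_dot_add f)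
  have h1 : ∀ u, twalsh f r i u * sg (u ⬝ᵥ y)
      = (if dcard f r i % 4 = 1 then -1 else 1) * (dwalsh f r i u * sg (u ⬝ᵥ (z + y))) := by
    intro u
    have h2 : (pair f fun x => u ⬝ᵥ x) = u ⬝ᵥ z := hz u
    rw [twalsh, h2, dotProduct_add, sg_add]
    ring
  simp only [h1]
  rw [← Finset.mul_sum, sum_dwalsh_mul_sg f hr]
  rcases sg_eq (f (z + y) + f (z + y + r)) with h | h <;> rw [h] <;> split_ifs <;> norm_num

/-- The transform of `tsum_ge_of_dwalsh` to the normalised transform. -/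
lemma tsum_ge_of_twalsh (f : V → ZMod 2) (A B G : ℤ)
    (h : ∀ (r : V) (i : Fin 8), r i = 1 → ∃ g : ℤ, 0 ≤
      ∑ u ∈ perp r, (A * kraw 128 (twalsh f r i u) 4 + B * kraw 128 (twalsh f r i u) 6
        - G - g * kraw 128 (twalsh f r i u) 2)) :
    255 * G ≤ 7 * A * tsum (fun x => sg (f x)) 8 + B * tsum (fun x => sg (f x)) 12 := by
  refine tsum_ge_of_dwalsh f A B G fun r i hr => ?_
  obtain ⟨g, hg⟩ := h r i hr
  have hr0 : r ≠ 0 := by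
    rintro rfl
    exact zero_ne_one hr
  simp only [kraw_twalsh f r i _ (w := 4) rfl, kraw_twalsh f r i _ (w := 6) rfl,
    kraw_twalsh f r i _ (w := 2) rfl] at hg
  rw [Finset.sum_sub_distrib, Finset.sum_sub_distrib, ← Finset.mul_sum, sum_dwalsh_sq f hr,
    Finset.sum_const, card_perp hr0, nsmul_eq_mul] at hg
  push_cast at hg
  linarith

lemma dwalsh_certificate : ∀ k : Fin 32,
    0 ≤ 677733813 * kraw 128 (8 * (k : ℕ) - 126) 4 + 3712798 * kraw 128 (8 * (k : ℕ) - 126) 6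
      - (-699355640918) - (-27155933504) * kraw 128 (8 * (k : ℕ) - 126) 2
      + 6482045476 * (8 * (k : ℕ) - 126) - 6482045476 := by
  decide +kernel

lemma tsum_ge_of_odd {f : V → ZMod 2} (hf : ∑ x, f x = 1) : 255 * -699355640918
    ≤ 7 * 677733813 * tsum (fun x => sg (f x)) 8 + 3712798 * tsum (fun x => sg (f x)) 12 := by
  refine tsum_ge_of_twalsh f 677733813 3712798 (-699355640918) fun r i hr => ⟨-27155933504, ?_⟩
  have hr0 : r ≠ 0 := by
    rintro rfl
    exact zero_ne_one hr
  have h1 : ∀ u ∈ perp r, 0 ≤ (677733813 * kraw 128 (twalsh f r i u) 4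
      + 3712798 * kraw 128 (twalsh f r i u) 6 - (-699355640918)
      - (-27155933504) * kraw 128 (twalsh f r i u) 2)
      + 6482045476 * twalsh f r i u - 6482045476 := by
    intro u hu
    have h2 := twalsh_mod hf hr hu
    obtain ⟨h3, h4⟩ := abs_twalsh_le f r i u
    generalize twalsh f r i u = W at *
    have h5 := dwalsh_certificate ⟨((W + 126) / 8).toNat, by omega⟩
    rwa [show 8 * ((((W + 126) / 8).toNat : ℕ) : ℤ) - 126 = W by omega] at h5
  have h2 := Finset.sum_nonneg h1
  have h3 := abs_sum_twalsh_le f hr 0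
  simp only [dotProduct_zero, sg_zero, mul_one] at h3
  rw [Finset.sum_sub_distrib, Finset.sum_add_distrib, ← Finset.mul_sum, Finset.sum_const,
    card_perp hr0, nsmul_eq_mul] at h2
  push_cast at h2
  linarith [h3.2]

/-- The sign recording the residue of the normalised transform modulo 16. -/
def hsg (f : V → ZMod 2) (r : V) (i : Fin 8) (u : V) : ℤ :=
  if twalsh f r i u % 16 = 2 then 1 else -1

lemma exists_hsg {f : V → ZMod 2} (hf : ∑ x, f x = 1) {r : V} {i : Fin 8} (hr : r i = 1) :
    ∃ η : ℤ, (η = 1 ∨ η = -1) ∧ ∃ e : ℕ, e ≤ 1 ∧ ∀ u ∈ perp r,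
      hsg f r i u = η * sg (((dcount f r i u + e) / 2 : ℕ) : ZMod 2) := by
  have h3 := dcard_mod_two hf hr
  have key : ∀ (η : ℤ) (e : ℕ), (∀ n : ℕ, ∀ W : ℤ, (W + 2 * dcard f r i - 4 * n) % 128 = 0 →
      ((((if dcard f r i % 4 = 1 then -1 else 1) * (if n % 2 = 0 then 1 else -1) * W) % 16 = 2)
        → η * (if (n + e) / 2 % 2 = 0 then 1 else -1) = 1) ∧
      (¬ (((if dcard f r i % 4 = 1 then -1 else 1) * (if n % 2 = 0 then 1 else -1) * W) % 16 = 2)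
        → η * (if (n + e) / 2 % 2 = 0 then 1 else -1) = -1)) →
      ∀ u ∈ perp r, hsg f r i u = η * sg (((dcount f r i u + e) / 2 : ℕ) : ZMod 2) := by
    intro η e h u hu
    have h4 := h (dcount f r i u) (dwalsh f r i u) (dwalsh_eq f r i u)
    have h5 : ∀ n : ℕ, sg (n : ZMod 2) = if n % 2 = 0 then 1 else -1 := by
      intro n
      rcases natCast_zmod2 n with ⟨h, h'⟩ | ⟨h, h'⟩ <;> rw [h, h'] <;> simp
    rw [hsg, twalsh, ← cast_dcount f hr hu, h5, h5]
    by_cases h6 : ((if dcard f r i % 4 = 1 then -1 else 1) *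
        (if dcount f r i u % 2 = 0 then 1 else -1) * dwalsh f r i u) % 16 = 2
    · rw [if_pos h6]
      exact (h4.1 h6).symm
    · rw [if_neg h6]
      exact (h4.2 h6).symm
  have h8 : dcard f r i % 8 = 1 ∨ dcard f r i % 8 = 3 ∨ dcard f r i % 8 = 5 ∨
      dcard f r i % 8 = 7 := by omega
  rcases h8 with h8 | h8 | h8 | h8
  · refine ⟨1, Or.inl rfl, 0, by norm_num, key _ _ fun n W hW => ?_⟩
    rw [if_pos (by omega)]
    constructor <;> intro h9 <;> split_ifs at h9 ⊢ <;> omega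
  · refine ⟨-1, Or.inr rfl, 1, by norm_num, key _ _ fun n W hW => ?_⟩
    rw [if_neg (by omega)]
    constructor <;> intro h9 <;> split_ifs at h9 ⊢ <;> omega
  · refine ⟨-1, Or.inr rfl, 0, by norm_num, key _ _ fun n W hW => ?_⟩
    rw [if_pos (by omega)]
    constructor <;> intro h9 <;> split_ifs at h9 ⊢ <;> omega
  · refine ⟨1, Or.inl rfl, 1, by norm_num, key _ _ fun n W hW => ?_⟩
    rw [if_neg (by omega)]
    constructor <;> intro h9 <;> split_ifs at h9 ⊢ <;> omega

lemma cast_carry {n m k c e : ℕ} (he : e ≤ 1) (h : k + 2 * c = n + m) :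
    (((k + e) / 2 : ℕ) : ZMod 2)
      = ((n + e) / 2 : ℕ) + ((m + e) / 2 : ℕ) + (n : ZMod 2) * m + c := by
  rcases natCast_zmod2 ((k + e) / 2) with ⟨h1, h1'⟩ | ⟨h1, h1'⟩ <;>
  rcases natCast_zmod2 ((n + e) / 2) with ⟨h2, h2'⟩ | ⟨h2, h2'⟩ <;>
  rcases natCast_zmod2 ((m + e) / 2) with ⟨h3, h3'⟩ | ⟨h3, h3'⟩ <;>
  rcases natCast_zmod2 n with ⟨h4, h4'⟩ | ⟨h4, h4'⟩ <;>
  rcases natCast_zmod2 m with ⟨h5, h5'⟩ | ⟨h5, h5'⟩ <;>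
  rcases natCast_zmod2 c with ⟨h6, h6'⟩ | ⟨h6, h6'⟩ <;>
  rw [h1, h2, h3, h4, h5, h6] <;> first | decide | (exfalso; omega)

lemma dcount_add (f : V → ZMod 2) {r : V} {i : Fin 8} (hr : r i = 1) {u v : V} (hu : u ∈ perp r)
    (hv : v ∈ perp r) : ∃ c : ℕ, dcount f r i (u + v) + 2 * c = dcount f r i u + dcount f r i v ∧
      (c : ZMod 2) = pair f fun x => (u ⬝ᵥ x) * (v ⬝ᵥ x) := by
  refine ⟨((half i).filter fun x => (f x + f (x + r)) * (u ⬝ᵥ x)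
    * ((f x + f (x + r)) * (v ⬝ᵥ x)) = 1).card, ?_, ?_⟩
  · rw [dcount, dcount, dcount, ← card_filter_add]
    simp only [add_dotProduct, mul_add]
  · rw [card_filter_mod, pair, ← dbl_half hr, sum_dbl hr subset_rfl]
    refine Finset.sum_congr rfl fun x _ => ?_
    rw [dotProduct_add, dotProduct_add, mem_perp.1 hu, mem_perp.1 hv, add_zero, add_zero]
    generalize f x = a
    generalize f (x + r) = b
    generalize u ⬝ᵥ x = p
    generalize v ⬝ᵥ x = q
    revert a b p q
    decide

lemma exists_dot_of_additive_perp {r : V} {i : Fin 8} (hr : r i = 1) (t : V → ZMod 2)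
    (h : ∀ u ∈ perp r, ∀ v ∈ perp r, t (u + v) = t u + t v) :
    ∃ y : V, ∀ u ∈ perp r, t u = u ⬝ᵥ y := by
  have hp : ∀ u : V, u + (u ⬝ᵥ r) • Pi.single i 1 ∈ perp r := by
    intro u
    rw [mem_perp, add_dotProduct, smul_dotProduct, single_dotProduct, hr, one_mul, smul_eq_mul,
      mul_one, add_self_eq]
  obtain ⟨y, hy⟩ := exists_dot_of_additive (fun u => t (u + (u ⬝ᵥ r) • Pi.single i 1)) (by
    intro u v
    rw [← h _ (hp u) _ (hp v), add_dotProduct, add_smul]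
    refine congrArg t ?_
    abel)
  refine ⟨y, fun u hu => ?_⟩
  rw [← hy u, mem_perp.1 hu, zero_smul, add_zero]

lemma sg_majority (p q t : ZMod 2) :
    2 * sg (p * q + p * t + q * t) = sg p + sg q + sg t - sg (p + q + t) := by
  revert p q t
  decide

/-- If the functional of `f` is supported on three points, the residues of the normalised
transform are a combination of four characters. -/
lemma exists_hsg_chars {f : V → ZMod 2} (hf : ∑ x, f x = 1) {a b c : V}
    (hp : ∀ q ∈ Q, pair f q = q a + q b + q c) {r : V} {i : Fin 8} (hr : r i = 1) :
    ∃ η : ℤ, (η = 1 ∨ η = -1) ∧ ∃ z₁ z₂ z₃ z₄ : V, ∀ u ∈ perp r,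
      2 * hsg f r i u
        = η * (sg (u ⬝ᵥ z₁) + sg (u ⬝ᵥ z₂) + sg (u ⬝ᵥ z₃) - sg (u ⬝ᵥ z₄)) := by
  obtain ⟨η, hη, e, he, h⟩ := exists_hsg hf hr
  have hlin : ∀ u ∈ perp r, (dcount f r i u : ZMod 2) = u ⬝ᵥ a + u ⬝ᵥ b + u ⬝ᵥ c := by
    intro u hu
    rw [cast_dcount f hr hu]
    have := hp _ (affine_mem_Q u 0)
    simp only [add_zero] at this
    exact this
  obtain ⟨y, hy⟩ := exists_dot_of_additive_perp hr
    (fun u => (((dcount f r i u + e) / 2 : ℕ) : ZMod 2) + ((u ⬝ᵥ a) * (u ⬝ᵥ b)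
      + (u ⬝ᵥ a) * (u ⬝ᵥ c) + (u ⬝ᵥ b) * (u ⬝ᵥ c))) (by
    intro u hu v hv
    obtain ⟨m, hm, hm'⟩ := dcount_add f hr hu hv
    have hq := hp _ (mul_affine_mem_Q u v 0 0)
    simp only [add_zero] at hq
    rw [cast_carry he hm, hm', hq, hlin u hu, hlin v hv, add_dotProduct, add_dotProduct,
      add_dotProduct]
    generalize (((dcount f r i u + e) / 2 : ℕ) : ZMod 2) = s
    generalize (((dcount f r i v + e) / 2 : ℕ) : ZMod 2) = t
    generalize u ⬝ᵥ a = u₁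
    generalize u ⬝ᵥ b = u₂
    generalize u ⬝ᵥ c = u₃
    generalize v ⬝ᵥ a = v₁
    generalize v ⬝ᵥ b = v₂
    generalize v ⬝ᵥ c = v₃
    revert u₁ u₂ u₃ v₁ v₂ v₃ s t
    decide)
  refine ⟨η, hη, a + y, b + y, c + y, a + b + c + y, fun u hu => ?_⟩
  have h1 := hy u hu
  have h2 : (((dcount f r i u + e) / 2 : ℕ) : ZMod 2) = u ⬝ᵥ y + ((u ⬝ᵥ a) * (u ⬝ᵥ b)
      + (u ⬝ᵥ a) * (u ⬝ᵥ c) + (u ⬝ᵥ b) * (u ⬝ᵥ c)) := by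
    rw [← h1, add_add_cancel]
  rw [h u hu, h2, sg_add, mul_left_comm, mul_left_comm (2 : ℤ), sg_majority]
  simp only [dotProduct_add, sg_add]
  ring

lemma sum_hsg {f : V → ZMod 2} (hf : ∑ x, f x = 1) {a b c : V}
    (hp : ∀ q ∈ Q, pair f q = q a + q b + q c) {r : V} {i : Fin 8} (hr : r i = 1) :
    (∃ k : ℤ, -2 ≤ k ∧ k ≤ 2 ∧ ∑ u ∈ perp r, hsg f r i u = 64 * k) ∧
      |∑ u ∈ perp r, hsg f r i u * twalsh f r i u| ≤ 256 := by
  have hr0 : r ≠ 0 := by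
    rintro rfl
    exact zero_ne_one hr
  obtain ⟨η, hη, z₁, z₂, z₃, z₄, h⟩ := exists_hsg_chars hf hp hr
  constructor
  · have h1 : 2 * ∑ u ∈ perp r, hsg f r i u = η * (∑ u ∈ perp r, sg (u ⬝ᵥ z₁)
        + ∑ u ∈ perp r, sg (u ⬝ᵥ z₂) + ∑ u ∈ perp r, sg (u ⬝ᵥ z₃)
        - ∑ u ∈ perp r, sg (u ⬝ᵥ z₄)) := by
      rw [← Finset.sum_add_distrib, ← Finset.sum_add_distrib, ← Finset.sum_sub_distrib,
        Finset.mul_sum, Finset.mul_sum]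
      exact Finset.sum_congr rfl h
    have h2 : |∑ u ∈ perp r, hsg f r i u| ≤ 128 := by
      refine (Finset.abs_sum_le_sum_abs _ _).trans ?_
      have h3 : ∀ u ∈ perp r, |hsg f r i u| = 1 := by
        intro u _
        rw [hsg]
        split_ifs <;> rfl
      rw [Finset.sum_congr rfl h3, Finset.sum_const, card_perp hr0]
      norm_num
    have h3 : ∀ z, ∃ d : ℤ, ∑ u ∈ perp r, sg (u ⬝ᵥ z) = 128 * d := by
      intro z
      rw [sum_perp_sg hr0]
      split_ifs
      · exact ⟨1, rfl⟩
      · exact ⟨0, rfl⟩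
    obtain ⟨d₁, h4⟩ := h3 z₁
    obtain ⟨d₂, h5⟩ := h3 z₂
    obtain ⟨d₃, h6⟩ := h3 z₃
    obtain ⟨d₄, h7⟩ := h3 z₄
    rw [h4, h5, h6, h7] at h1
    rw [abs_le] at h2
    refine ⟨η * (d₁ + d₂ + d₃ - d₄), ?_, ?_, ?_⟩ <;> rcases hη with rfl | rfl <;> omega
  · have h1 : 2 * ∑ u ∈ perp r, hsg f r i u * twalsh f r i u
        = η * (∑ u ∈ perp r, twalsh f r i u * sg (u ⬝ᵥ z₁)
        + ∑ u ∈ perp r, twalsh f r i u * sg (u ⬝ᵥ z₂)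
        + ∑ u ∈ perp r, twalsh f r i u * sg (u ⬝ᵥ z₃)
        - ∑ u ∈ perp r, twalsh f r i u * sg (u ⬝ᵥ z₄)) := by
      rw [← Finset.sum_add_distrib, ← Finset.sum_add_distrib, ← Finset.sum_sub_distrib,
        Finset.mul_sum, Finset.mul_sum]
      refine Finset.sum_congr rfl fun u hu => ?_
      rw [← mul_assoc, h u hu]
      ring
    have h2 := abs_sum_twalsh_le f hr z₁
    have h3 := abs_sum_twalsh_le f hr z₂
    have h4 := abs_sum_twalsh_le f hr z₃
    have h5 := abs_sum_twalsh_le f hr z₄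
    rw [abs_le]
    rcases hη with rfl | rfl <;> constructor <;> linarith

/-- The summand of the derivative certificate in the presence of the residue signs. -/
def hrow (g α β τ k H W : ℤ) : ℤ :=
  395814848 * kraw 128 W 4 + 2243252 * kraw 128 W 6 - (-314309676240) - 2 * g * kraw 128 W 2
    - (α * W + |α|) - β * (2 * H - k) - (τ * (H * W) + 2 * |τ|)

lemma sum_nonneg_of_hrow {f : V → ZMod 2} (hf : ∑ x, f x = 1) {a b c : V}
    (hp : ∀ q ∈ Q, pair f q = q a + q b + q c) {r : V} {i : Fin 8} (hr : r i = 1) {g α β τ k : ℤ}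
    (hk : ∑ u ∈ perp r, hsg f r i u = 64 * k)
    (hcert : ∀ j : Fin 16, 0 ≤ hrow g α β τ k 1 (16 * (j : ℕ) - 126) ∧
      0 ≤ hrow g α β τ k (-1) (16 * (j : ℕ) - 118)) :
    0 ≤ ∑ u ∈ perp r, (395814848 * kraw 128 (twalsh f r i u) 4
      + 2243252 * kraw 128 (twalsh f r i u) 6 - (-314309676240)
      - 2 * g * kraw 128 (twalsh f r i u) 2) := by
  have hr0 : r ≠ 0 := by
    rintro rfl
    exact zero_ne_one hr
  have h1 : ∀ u ∈ perp r, 0 ≤ hrow g α β τ k (hsg f r i u) (twalsh f r i u) := by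
    intro u hu
    have h2 := twalsh_mod hf hr hu
    obtain ⟨h3, h4⟩ := abs_twalsh_le f r i u
    rw [hsg]
    generalize twalsh f r i u = W at *
    split_ifs with h5
    · have h6 := (hcert ⟨((W + 126) / 16).toNat, by omega⟩).1
      rwa [show 16 * ((((W + 126) / 16).toNat : ℕ) : ℤ) - 126 = W by omega] at h6
    · have h6 := (hcert ⟨((W + 118) / 16).toNat, by omega⟩).2
      rwa [show 16 * ((((W + 118) / 16).toNat : ℕ) : ℤ) - 118 = W by omega] at h6
  have h2 := Finset.sum_nonneg h1
  simp only [hrow] at h2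
  have h3 := abs_sum_twalsh_le f hr 0
  simp only [dotProduct_zero, sg_zero, mul_one] at h3
  have h4 := (sum_hsg hf hp hr).2
  have h7 : ∀ E : V → ℤ, ∑ u ∈ perp r, (E u - (α * twalsh f r i u + |α|)
      - β * (2 * hsg f r i u - k) - (τ * (hsg f r i u * twalsh f r i u) + 2 * |τ|))
      = ∑ u ∈ perp r, E u - (α * ∑ u ∈ perp r, twalsh f r i u + |α| * 128)
        - (τ * ∑ u ∈ perp r, hsg f r i u * twalsh f r i u + |τ| * 256) := by
    intro E
    simp only [Finset.sum_sub_distrib, Finset.sum_add_distrib, ← Finset.mul_sum, hk,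
      Finset.sum_const, card_perp hr0, nsmul_eq_mul]
    push_cast
    ring
  rw [h7] at h2
  have h5 : -(|α| * 128) ≤ α * ∑ u ∈ perp r, twalsh f r i u := by
    refine neg_le_of_abs_le ?_
    rw [abs_mul]
    exact mul_le_mul_of_nonneg_left (abs_le.2 h3) (abs_nonneg _)
  have h6 : -(|τ| * 256) ≤ τ * ∑ u ∈ perp r, hsg f r i u * twalsh f r i u := by
    refine neg_le_of_abs_le ?_
    rw [abs_mul]
    exact mul_le_mul_of_nonneg_left h4 (abs_nonneg _)
  linarith

lemma tsum_ge_of_three {f : V → ZMod 2} (hf : ∑ x, f x = 1) {a b c : V}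
    (hp : ∀ q ∈ Q, pair f q = q a + q b + q c) : 255 * -314309676240
      ≤ 7 * 395814848 * tsum (fun x => sg (f x)) 8 + 2243252 * tsum (fun x => sg (f x)) 12 := by
  refine tsum_ge_of_twalsh f 395814848 2243252 (-314309676240) fun r i hr => ?_
  obtain ⟨k, hk, hk', h⟩ := (sum_hsg hf hp hr).1
  interval_cases k
  · exact ⟨_, sum_nonneg_of_hrow (g := -5019376970) (α := -28489581892) (β := -10 ^ 20) (τ := 0)
      hf hp hr h (by decide +kernel)⟩
  · exact ⟨_, sum_nonneg_of_hrow (g := -4605088399) (α := -5761972743) (β := -108187579097)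
      (τ := 11127529179) hf hp hr h (by decide +kernel)⟩
  · exact ⟨_, sum_nonneg_of_hrow (g := -7089658464) (α := 2412785989) (β := 26943477742)
      (τ := 9364007652) hf hp hr h (by decide +kernel)⟩
  · exact ⟨_, sum_nonneg_of_hrow (g := -7089658464) (α := 0) (β := 51474169495)
      (τ := 11776793640) hf hp hr h (by decide +kernel)⟩
  · exact ⟨_, sum_nonneg_of_hrow (g := -7433413698) (α := 18651898329) (β := 10 ^ 20) (τ := 0)
      hf hp hr h (by decide +kernel)⟩

lemma eq_of_forall_Q {x y : V} (h : ∀ q ∈ Q, q x = q y) : x = y := by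
  refine eq_of_dot_eq fun l => ?_
  have := h _ (affine_mem_Q l 0)
  simpa only [add_zero] using this

lemma card_twords_one_le (φ : (V → ZMod 2) → ZMod 2) : (twords φ 1).card ≤ 1 := by
  rw [Finset.card_le_one]
  intro C hC D hD
  rw [mem_twords, Finset.card_eq_one] at hC hD
  obtain ⟨⟨x, rfl⟩, hC⟩ := hC
  obtain ⟨⟨y, rfl⟩, hD⟩ := hD
  rw [eq_of_forall_Q (x := x) (y := y) fun q hq => ?_]
  have h1 := hC q hq
  have h2 := hD q hq
  rw [Finset.sum_singleton] at h1 h2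
  rw [h1, h2]

/-- The coefficients of the certificate in the case of a functional supported on three points. -/
def threeCoeff : ℕ → ℤ
  | 0 => 82184549082806
  | 1 => 575914876154
  | 2 => 9635245720016
  | 4 => 795171512156
  | 6 => 53312116246
  | 8 => 2844289504
  | 10 => 114292805
  | 12 => 3091012
  | 14 => 42388
  | _ => 0

lemma nl_le_of_three {f : V → ZMod 2} (hf : ∑ x, f x = 1) {a b c : V}
    (hp : ∀ q ∈ Q, pair f q = q a + q b + q c) : nl (n := 8) 2 f ≤ 96 := by
  by_contra! hn
  have h := odd_certificate hf hn threeCoeff 395814848 2243252 (-314309676240) (by decide +kernel)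
    (by decide +kernel) (by decide +kernel) (by decide +kernel) (by decide +kernel)
    (by decide +kernel) (tsum_ge_of_three hf hp)
  have h1 : ((twords (pair f) 1).card : ℤ) ≤ 1 := by
    exact_mod_cast card_twords_one_le (pair f)
  simp only [threeCoeff, abs_zero, zero_mul, add_zero] at h
  rw [abs_of_pos (by norm_num)] at h
  linarith

lemma sum_symmDiff_eq (A C : Finset V) (q : V → ZMod 2) :
    ∑ x ∈ symmDiff A C, q x = ∑ x ∈ A, q x + ∑ x ∈ C, q x := by
  have h1 := Finset.sum_sdiff (f := q) (Finset.inter_subset_left (s₁ := A) (s₂ := C))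
  have h2 := Finset.sum_sdiff (f := q) (Finset.inter_subset_right (s₁ := A) (s₂ := C))
  rw [Finset.sdiff_inter_self_left] at h1
  rw [Finset.sdiff_inter_self_right] at h2
  rw [symmDiff, Finset.sup_eq_union, Finset.sum_union disjoint_sdiff_sdiff, ← h1, ← h2]
  generalize ∑ x ∈ A \ C, q x = a
  generalize ∑ x ∈ C \ A, q x = b
  generalize ∑ x ∈ A ∩ C, q x = c
  revert a b c
  decide

variable {φ : (V → ZMod 2) → ZMod 2} {v w : ℕ}

lemma isWord_symmDiff_of_mem_twords {C D : Finset V} (hC : C ∈ twords φ v) (hD : D ∈ twords φ w) :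
    IsWord (symmDiff C D) := by
  rw [isWord_iff]
  intro q hq
  rw [sum_symmDiff_eq, (mem_twords.1 hC).2 q hq, (mem_twords.1 hD).2 q hq, add_self_eq]

lemma symmDiff_mem_twords {A C : Finset V} (hA : IsWord A) (hC : C ∈ twords φ w) :
    symmDiff A C ∈ twords φ (symmDiff A C).card := by
  rw [mem_twords]
  refine ⟨rfl, fun q hq => ?_⟩
  rw [sum_symmDiff_eq, isWord_iff.1 hA q hq, zero_add, (mem_twords.1 hC).2 q hq]

lemma card_inter_le_eight {A B : Finset V} (hA : A ∈ words 12) (hB : B ∈ words 12) (h : A ≠ B) :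
    (A ∩ B).card ≤ 8 := by
  rw [mem_words] at hA hB
  have h1 := card_symmDiff_add A B
  have h2 : (symmDiff A B).card ≠ 0 := by
    rwa [Ne, Finset.card_eq_zero, ← Finset.bot_eq_empty, symmDiff_eq_bot]
  have h3 := (hA.2.symmDiff hB.2).card_cases
  omega

/-- No flat of size eight meets `T` in more than four points. -/
def Thin (T : Finset V) : Prop := 5 ≤ T.card ∧ ∀ A ∈ words 8, (A ∩ T).card ≤ 4

lemma Thin.add_add_notMem {T : Finset V} (hT : Thin T) {a b c : V} (ha : a ∈ T) (hb : b ∈ T)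
    (hc : c ∈ T) (hab : a ≠ b) (hac : a ≠ c) (hbc : b ≠ c) : a + b + c ∉ T := by
  intro hd
  obtain ⟨e, he, he'⟩ := Finset.exists_mem_notMem_of_card_lt_card
    (s := ({a, b, c, a + b + c} : Finset V)) (t := T) (by
      rw [card_plane hab hac hbc]
      exact hT.1)
  have h1 : e ≠ a ∧ e ≠ b ∧ e ≠ c ∧ e ≠ a + b + c := by simpa using he'
  obtain ⟨A, hA, ⟨hAa, hAb, hAc, hAe⟩, -⟩ := exists_flat hab hac hbc h1.1.symm h1.2.1.symm
    h1.2.2.1.symm h1.2.2.2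
  have h2 : insert e ({a, b, c, a + b + c} : Finset V) ⊆ A ∩ T := by
    rw [Finset.insert_subset_iff]
    refine ⟨Finset.mem_inter.2 ⟨hAe, he⟩, Finset.subset_inter
      (plane_subset (mem_words_eight.1 hA).2 hAa hAb hAc) ?_⟩
    simp [Finset.insert_subset_iff, ha, hb, hc, hd]
  have h3 := Finset.card_le_card h2
  rw [Finset.card_insert_of_notMem he', card_plane hab hac hbc] at h3
  have := hT.2 A hA
  omega

lemma Thin.card_flats_four_le {T : Finset V} (hT : Thin T) :
    ((words 8).filter fun A => (A ∩ T).card = 4).card ≤ T.card.choose 4 := by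
  rw [← Finset.card_powersetCard]
  refine Finset.card_le_card_of_injOn (fun A => A ∩ T) ?_ ?_
  · intro A hA
    simp only [Finset.coe_filter, Set.mem_ofPred_eq] at hA
    simp [Finset.mem_powersetCard, hA.2, Finset.inter_subset_right]
  · intro A hA B hB hAB
    simp only [Finset.coe_filter, Set.mem_ofPred_eq] at hA hB
    dsimp only at hAB
    obtain ⟨a, b, c, d, hab, hac, had, hbc, hbd, hcd, h⟩ := Finset.card_eq_four.1 hA.2
    have h1 : ∀ x ∈ ({a, b, c, d} : Finset V), x ∈ A ∧ x ∈ B ∧ x ∈ T := by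
      intro x hx
      have h2 := hx
      rw [← h, Finset.mem_inter] at hx
      rw [← h, hAB, Finset.mem_inter] at h2
      exact ⟨hx.1, h2.1, hx.2⟩
    have ha := h1 a (by simp)
    have hb := h1 b (by simp)
    have hc := h1 c (by simp)
    have hd := h1 d (by simp)
    obtain ⟨E, -, -, hE⟩ := exists_flat hab hac hbc had hbd hcd (by
      rintro rfl
      exact hT.add_add_notMem ha.2.2 hb.2.2 hc.2.2 hab hac hbc hd.2.2)
    rw [hE A hA.1 ha.1 hb.1 hc.1 hd.1, hE B hB.1 ha.2.1 hb.2.1 hc.2.1 hd.2.1]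

lemma card_flats_inter_three_le (T : Finset V) :
    ((words 8).filter fun A => (A ∩ T).card = 3).card ≤ T.card.choose 3 * 63 := by
  rw [← Finset.card_powersetCard, mul_comm]
  refine Finset.card_le_mul_card_image_of_maps_to (f := fun A => A ∩ T) ?_ 63 ?_
  · intro A hA
    rw [Finset.mem_filter] at hA
    simp [Finset.mem_powersetCard, hA.2, Finset.inter_subset_right]
  · intro S hS
    rw [Finset.mem_powersetCard] at hS
    obtain ⟨a, b, c, hab, hac, hbc, rfl⟩ := Finset.card_eq_three.1 hS.2
    rw [← card_flats_three hab hac hbc]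
    refine Finset.card_le_card fun A hA => ?_
    simp only [Finset.mem_filter] at hA ⊢
    have h1 : ∀ x ∈ ({a, b, c} : Finset V), x ∈ A := fun x hx => by
      rw [← hA.2] at hx
      exact (Finset.mem_inter.1 hx).1
    exact ⟨hA.1.1, h1 a (by simp), h1 b (by simp), h1 c (by simp)⟩

lemma le_card_union_add {T : Finset V} (hT : ∀ a ∈ T, ∀ b ∈ T, ∀ c ∈ T, a ≠ b → a ≠ c → b ≠ c →
    a + b + c ∉ T) {r : V} (hr : r ≠ 0) :
    2 * T.card ≤ (T ∪ T.image (· + r)).card + 2 ∧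
      ((∀ x ∈ T, x + r ∉ T) → 2 * T.card = (T ∪ T.image (· + r)).card) := by
  have h1 := Finset.card_union_add_card_inter T (T.image (· + r))
  rw [Finset.card_image_of_injective _ (add_left_injective r)] at h1
  have h2 : ∀ y, y ∈ T ∩ T.image (· + r) ↔ y ∈ T ∧ y + r ∈ T := by
    intro y
    rw [Finset.mem_inter, Finset.mem_image]
    refine and_congr_right fun _ => ⟨?_, fun h => ⟨_, h, add_add_cancel _ _⟩⟩
    rintro ⟨z, hz, rfl⟩
    rwa [add_add_cancel]
  constructor
  · have h3 : (T ∩ T.image (· + r)).card ≤ 2 := by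
      rcases (T ∩ T.image (· + r)).eq_empty_or_nonempty with h | ⟨x, hx⟩
      · rw [h, Finset.card_empty]
        exact Nat.zero_le _
      · refine (Finset.card_le_card (t := {x, x + r}) fun y hy => ?_).trans Finset.card_le_two
        rw [Finset.mem_insert, Finset.mem_singleton]
        by_contra! h
        rw [h2] at hx hy
        refine hT x hx.1 (x + r) hx.2 y hy.1 ?_ h.1.symm h.2.symm ?_
        · simpa using hr
        · rw [add_add_left, add_comm]
          exact hy.2
    omega
  · intro h
    have h3 : T ∩ T.image (· + r) = ∅ := by
      ext y
      rw [h2]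
      simpa using h y
    rw [h3, Finset.card_empty] at h1
    omega

lemma union_add_subset {T A : Finset V} {r : V} (hTA : T ⊆ A) (hA : ∀ x ∈ A, x + r ∈ A) :
    T ∪ T.image (· + r) ⊆ A := by
  refine Finset.union_subset hTA fun y hy => ?_
  obtain ⟨x, hx, rfl⟩ := Finset.mem_image.1 hy
  exact hA x (hTA hx)

lemma exists_period_fun : ∃ ρ : Finset V → V, ∀ A ∈ words 12, ρ A ≠ 0 ∧ ∀ x ∈ A, x + ρ A ∈ A := by
  have h : ∀ A : Finset V, ∃ r : V, A ∈ words 12 → r ≠ 0 ∧ ∀ x ∈ A, x + r ∈ A := by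
    intro A
    by_cases hA : A ∈ words 12
    · obtain ⟨r, h1, h2, -⟩ := (mem_words.1 hA).2.exists_period (mem_words.1 hA).1
      exact ⟨r, fun _ => ⟨h1, h2⟩⟩
    · exact ⟨0, fun h => absurd h hA⟩
  choose ρ hρ using h
  exact ⟨ρ, hρ⟩

lemma Thin.card_twelve_six_le {T : Finset V} (hT : Thin T) :
    ((words 12).filter fun A => (A ∩ T).card = 6).card ≤ T.card.choose 6 * 256 := by
  obtain ⟨ρ, hρ⟩ := exists_period_fun
  rw [← Finset.card_powersetCard, ← card_V, ← Finset.card_product]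
  refine Finset.card_le_card_of_injOn (fun A => (A ∩ T, ρ A)) ?_ ?_
  · intro A hA
    simp only [Finset.coe_filter, Set.mem_ofPred_eq] at hA
    simp [Finset.mem_powersetCard, hA.2, Finset.inter_subset_right]
  · intro A hA B hB hAB
    simp only [Finset.coe_filter, Set.mem_ofPred_eq] at hA hB
    simp only [Prod.mk.injEq] at hAB
    by_contra hne
    have h1 := card_inter_le_eight hA.1 hB.1 hne
    have h2 := (le_card_union_add (T := A ∩ T) (fun a ha b hb c hc hab hac hbc h =>
      hT.add_add_notMem (Finset.mem_inter.1 ha).2 (Finset.mem_inter.1 hb).2 (Finset.mem_inter.1 hc).2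
        hab hac hbc (Finset.mem_inter.1 h).2) (hρ A hA.1).1).1
    have h3 := Finset.card_le_card (Finset.subset_inter
      (union_add_subset Finset.inter_subset_left (hρ A hA.1).2)
      (union_add_subset (T := A ∩ T) (r := ρ A) (A := B) (hAB.1 ▸ Finset.inter_subset_left)
        (hAB.2 ▸ (hρ B hB.1).2)))
    omega

lemma Thin.card_twelve_five_le {T : Finset V} (hT : Thin T) (h5 : T.card = 5) :
    ((words 12).filter fun A => T ⊆ A).card ≤ 5376 := by
  obtain ⟨ρ, hρ⟩ := exists_period_fun
  have hT' : ∀ a ∈ T, ∀ b ∈ T, ∀ c ∈ T, a ≠ b → a ≠ c → b ≠ c → a + b + c ∉ T :=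
    fun a ha b hb c hc hab hac hbc => hT.add_add_notMem ha hb hc hab hac hbc
  have key : ∀ A ∈ words 12, ∀ B ∈ words 12, T ⊆ A → T ⊆ B → ρ A = ρ B → A ≠ B →
      T ∪ T.image (· + ρ A) ⊆ A ∩ B ∧ (A ∩ B).card ≤ 8 := by
    intro A hA B hB hTA hTB h hne
    exact ⟨Finset.subset_inter (union_add_subset hTA (hρ A hA).2)
      (union_add_subset hTB (h ▸ (hρ B hB).2)), card_inter_le_eight hA hB hne⟩
  rw [← Finset.card_filter_add_card_filter_not (fun A => ∃ x ∈ T, x + ρ A ∈ T)]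
  refine (add_le_add (b := 20 * 256) (d := 256) ?_ ?_).trans (by norm_num)
  · have h1 : ∀ A ∈ words 12, ∃ y ∈ A, y ∉ T ∪ T.image (· + ρ A) := by
      intro A hA
      refine Finset.exists_mem_notMem_of_card_lt_card ?_
      have h2 := Finset.card_union_le T (T.image (· + ρ A))
      rw [Finset.card_image_of_injective _ (add_left_injective _)] at h2
      rw [(mem_words.1 hA).1]
      omega
    choose! y hy hy' using h1
    have h2 : (T.offDiag.image fun p => p.1 + p.2).card ≤ 20 := by
      refine Finset.card_image_le.trans ?_
      rw [Finset.offDiag_card, h5]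
    refine le_trans ?_ (Nat.mul_le_mul_right 256 h2)
    rw [← card_V, ← Finset.card_product]
    refine Finset.card_le_card_of_injOn (fun A => (ρ A, y A)) ?_ ?_
    · intro A hA
      simp only [Finset.coe_filter, Finset.mem_filter, Set.mem_ofPred_eq] at hA
      obtain ⟨⟨hA, -⟩, x, hx, hx'⟩ := hA
      simp only [Finset.coe_product, Set.mem_prod, Finset.mem_coe, Finset.mem_univ, and_true,
        Finset.mem_image, Prod.exists, Finset.mem_offDiag]
      refine ⟨x, x + ρ A, ⟨hx, hx', ?_⟩, add_add_left _ _⟩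
      simpa using (hρ A hA).1
    · intro A hA B hB hAB
      simp only [Finset.coe_filter, Finset.mem_filter, Set.mem_ofPred_eq] at hA hB
      simp only [Prod.mk.injEq] at hAB
      by_contra hne
      obtain ⟨h3, h4⟩ := key A hA.1.1 B hB.1.1 hA.1.2 hB.1.2 hAB.1 hne
      have h5' := (le_card_union_add hT' (hρ A hA.1.1).1).1
      have h6 : insert (y A) (T ∪ T.image (· + ρ A)) ⊆ A ∩ B := by
        rw [Finset.insert_subset_iff, Finset.mem_inter]
        exact ⟨⟨hy A hA.1.1, hAB.2 ▸ hy B hB.1.1⟩, h3⟩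
      have h7 := Finset.card_le_card h6
      rw [Finset.card_insert_of_notMem (hy' A hA.1.1)] at h7
      omega
  · rw [← card_V]
    refine Finset.card_le_card_of_injOn ρ (by simp) ?_
    intro A hA B hB hAB
    simp only [Finset.coe_filter, Finset.mem_filter, Set.mem_ofPred_eq] at hA hB
    by_contra hne
    obtain ⟨h3, h4⟩ := key A hA.1.1 B hB.1.1 hA.1.2 hB.1.2 hAB hne
    have h5' := (le_card_union_add hT' (hρ A hA.1.1).1).2 (by simpa using hA.2)
    have h7 := Finset.card_le_card h3
    omega

lemma symmDiff_inter_eq_sdiff {D A T : Finset V} (h : T ⊆ A) : symmDiff D A ∩ T = T \ (D ∩ T) := by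
  ext x
  have := @h x
  simp only [Finset.mem_inter, Finset.mem_symmDiff, Finset.mem_sdiff]
  tauto

lemma Thin.card_fourteen_le {T : Finset V} (hT : Thin T) (h7 : T.card = 7) :
    ((words 14).filter fun A => T ⊆ A).card ≤ 2205 := by
  have key : ∀ A ∈ words 14, T ⊆ A → ∃ E ∈ words 8, (E ∩ T).card = 4 ∧ (A ∩ E).card = 7 := by
    intro A hA hTA
    rw [mem_words] at hA
    have h1 : ((words 8).filter fun E => (E ∩ A).card = 7).Nonempty := by
      rw [← Finset.card_pos, hA.2.card_flats_fourteen hA.1]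
      norm_num
    obtain ⟨E, hE⟩ := h1
    rw [Finset.mem_filter] at hE
    have h2 := card_symmDiff_add E A
    have h3 : symmDiff E A ∈ words 8 := by
      rw [mem_words]
      refine ⟨?_, (mem_words.1 hE.1).2.symmDiff hA.2⟩
      have := (mem_words.1 hE.1).1
      omega
    have h5 := Finset.card_sdiff_add_card_eq_card (Finset.inter_subset_right (s₁ := E) (s₂ := T))
    rw [← symmDiff_inter_eq_sdiff hTA] at h5
    have h6 := hT.2 E hE.1
    have h8 := hT.2 _ h3
    by_cases h9 : (E ∩ T).card = 4
    · exact ⟨E, hE.1, h9, Finset.inter_comm E A ▸ hE.2⟩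
    · refine ⟨_, h3, by omega, ?_⟩
      have h10 := card_symmDiff_add (symmDiff E A) A
      rw [symmDiff_symmDiff_cancel_right, (mem_words.1 h3).1, (mem_words.1 hE.1).1, hA.1] at h10
      rw [Finset.inter_comm]
      omega
  have h35 : ((words 8).filter fun A => (A ∩ T).card = 4).card ≤ 35 := by
    have := hT.card_flats_four_le
    rwa [h7] at this
  choose! E hE hE4 hE7 using key
  refine le_trans (Finset.card_le_mul_card_image_of_maps_to (f := E)
    (t := (words 8).filter fun A => (A ∩ T).card = 4) ?_ 63 ?_) (Nat.mul_le_mul_left 63 h35)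
  · intro A hA
    rw [Finset.mem_filter] at hA ⊢
    exact ⟨hE A hA.1 hA.2, hE4 A hA.1 hA.2⟩
  · intro D hD
    rw [Finset.mem_filter] at hD
    have h5 := Finset.card_sdiff_add_card_eq_card (Finset.inter_subset_right (s₁ := D) (s₂ := T))
    obtain ⟨a, b, c, hab, hac, hbc, h⟩ := Finset.card_eq_three.1
      (show (T \ (D ∩ T)).card = 3 by omega)
    rw [← card_flats_three hab hac hbc]
    refine Finset.card_le_card_of_injOn (fun A => symmDiff D A) ?_ ?_
    · intro A hA
      simp only [Finset.coe_filter, Finset.mem_filter, Set.mem_ofPred_eq] at hA ⊢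
      obtain ⟨⟨hA, hTA⟩, rfl⟩ := hA
      have h1 := hE7 A hA hTA
      rw [mem_words] at hA
      have h2 := card_symmDiff_add (E A) A
      have h3 := mem_words.1 hD.1
      have h4 : ∀ x ∈ T \ (E A ∩ T), x ∈ symmDiff (E A) A := by
        intro x hx
        rw [← symmDiff_inter_eq_sdiff hTA] at hx
        exact (Finset.mem_inter.1 hx).1
      rw [h] at h4
      refine ⟨mem_words.2 ⟨?_, h3.2.symmDiff hA.2⟩, h4 a (by simp), h4 b (by simp), h4 c (by simp)⟩
      rw [Finset.inter_comm] at h1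
      omega
    · intro A _ B _ hAB
      exact symmDiff_right_injective D hAB

lemma card_le_card_words {𝒟 : Finset (Finset V)} {C : Finset V} {v : ℕ} {P : Finset V → Prop}
    [DecidablePred P] (h : ∀ D ∈ 𝒟, symmDiff D C ∈ words v ∧ P (symmDiff D C)) :
    𝒟.card ≤ ((words v).filter P).card :=
  Finset.card_le_card_of_injOn (fun D => symmDiff D C) (fun D hD => by
    simpa using h D hD) ((symmDiff_left_injective C).injOn)

lemma card_symmDiff_inter_add (D C : Finset V) :
    (symmDiff D C ∩ C).card + (D ∩ C).card = C.card := by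
  have h5 := Finset.card_sdiff_add_card_eq_card (Finset.inter_subset_right (s₁ := D) (s₂ := C))
  rw [← h5, symmDiff_inter_eq_sdiff subset_rfl]

lemma thin_of_mem_twords {C : Finset V} (hC : C ∈ twords φ w) (hw : 5 ≤ w) (hw' : w ≤ 7)
    (hodd : w % 2 = 1) (h : ∀ v, v % 2 = 1 → v < w → twords φ v = ∅) : Thin C := by
  have hcard := (mem_twords.1 hC).1
  refine ⟨by omega, fun A hA => ?_⟩
  rw [mem_words] at hA
  by_contra! h5
  have h1 := card_symmDiff_add A C
  have h2 := symmDiff_mem_twords hA.2 hC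
  rw [h _ (by omega) (by omega)] at h2
  simp at h2

lemma card_twords_five_le (h1 : twords φ 1 = ∅) (h3 : twords φ 3 = ∅) : (twords φ 5).card ≤ 6 := by
  rcases (twords φ 5).eq_empty_or_nonempty with h | ⟨C, hC⟩
  · rw [h]
    exact Nat.zero_le _
  have hT := thin_of_mem_twords hC le_rfl (by norm_num) rfl fun v hv hv' => by
    obtain rfl | rfl : v = 1 ∨ v = 3 := by omega
    · exact h1
    · exact h3
  have h5 := (mem_twords.1 hC).1
  have h4 : ((twords φ 5).erase C).card ≤ 5 := by
    have h35 := hT.card_flats_four_le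
    rw [h5] at h35
    refine (card_le_card_words (C := C) fun D hD => ?_).trans h35
    rw [Finset.mem_erase] at hD
    have h6 := isWord_symmDiff_of_mem_twords hD.2 hC
    have h7 := card_symmDiff_add D C
    have h8 := card_symmDiff_inter_add D C
    have h9 : (symmDiff D C).card ≠ 0 := by
      rw [Ne, Finset.card_eq_zero, ← Finset.bot_eq_empty, symmDiff_eq_bot]
      exact hD.1
    have h10 := (mem_twords.1 hD.2).1
    have h11 := h6.card_cases
    exact ⟨mem_words.2 ⟨by omega, h6⟩, by omega⟩
  rw [Finset.card_erase_of_mem hC] at h4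
  omega

lemma card_twords_seven_le (h1 : twords φ 1 = ∅) (h3 : twords φ 3 = ∅) :
    (twords φ 7).card ≤ 6006 := by
  rcases (twords φ 5).eq_empty_or_nonempty with h5 | ⟨C, hC⟩
  · rcases (twords φ 7).eq_empty_or_nonempty with h | ⟨C, hC⟩
    · rw [h]
      exact Nat.zero_le _
    have hT := thin_of_mem_twords hC (by norm_num) (by norm_num) rfl fun v hv hv' => by
      obtain rfl | rfl | rfl : v = 1 ∨ v = 3 ∨ v = 5 := by omega
      · exact h1
      · exact h3
      · exact h5
    have h7 := (mem_twords.1 hC).1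
    have h4 := hT.card_flats_four_le
    have h6 := hT.card_twelve_six_le
    have h8 := hT.card_fourteen_le h7
    rw [h7, show Nat.choose 7 4 = 35 from rfl] at h4
    rw [h7, show Nat.choose 7 6 = 7 from rfl] at h6
    have key : ∀ D ∈ (twords φ 7).erase C, IsWord (symmDiff D C) ∧
        (symmDiff D C ∩ C).card + (D ∩ C).card = 7 ∧ (symmDiff D C).card + 2 * (D ∩ C).card = 14 ∧
        ((D ∩ C).card = 0 ∨ (D ∩ C).card = 1 ∨ (D ∩ C).card = 3) := by
      intro D hD
      rw [Finset.mem_erase] at hD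
      have g6 := isWord_symmDiff_of_mem_twords hD.2 hC
      have g7 := card_symmDiff_add D C
      have g8 := card_symmDiff_inter_add D C
      have g9 : (symmDiff D C).card ≠ 0 := by
        rw [Ne, Finset.card_eq_zero, ← Finset.bot_eq_empty, symmDiff_eq_bot]
        exact hD.1
      have g10 := (mem_twords.1 hD.2).1
      have g11 := g6.card_cases
      exact ⟨g6, by omega, by omega, by omega⟩
    have k3 := (card_le_card_words (C := C) (v := 8) (P := fun A => (A ∩ C).card = 4)
      (𝒟 := ((twords φ 7).erase C).filter fun D => (D ∩ C).card = 3) fun D hD => by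
        rw [Finset.mem_filter] at hD
        obtain ⟨k1, k2, k3, -⟩ := key D hD.1
        exact ⟨mem_words.2 ⟨by omega, k1⟩, by omega⟩).trans h4
    have k1 := (card_le_card_words (C := C) (v := 12) (P := fun A => (A ∩ C).card = 6)
      (𝒟 := ((twords φ 7).erase C).filter fun D => (D ∩ C).card = 1) fun D hD => by
        rw [Finset.mem_filter] at hD
        obtain ⟨k1, k2, k3, -⟩ := key D hD.1
        exact ⟨mem_words.2 ⟨by omega, k1⟩, by omega⟩).trans h6
    have k0 := (card_le_card_words (C := C) (v := 14) (P := fun A => C ⊆ A)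
      (𝒟 := ((twords φ 7).erase C).filter fun D => (D ∩ C).card = 0) fun D hD => by
        rw [Finset.mem_filter] at hD
        obtain ⟨k1, k2, k3, -⟩ := key D hD.1
        refine ⟨mem_words.2 ⟨by omega, k1⟩, ?_⟩
        rw [← Finset.inter_eq_right]
        exact Finset.eq_of_subset_of_card_le Finset.inter_subset_right (by omega)).trans h8
    have hsum : ((twords φ 7).erase C).card
        ≤ (((twords φ 7).erase C).filter fun D => (D ∩ C).card = 0).card
        + (((twords φ 7).erase C).filter fun D => (D ∩ C).card = 1).card
        + (((twords φ 7).erase C).filter fun D => (D ∩ C).card = 3).card := by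
      refine le_trans (Finset.card_le_card fun D hD => ?_)
        ((Finset.card_union_le _ _).trans (Nat.add_le_add_right (Finset.card_union_le _ _) _))
      simp only [Finset.mem_union, Finset.mem_filter, hD, true_and, or_assoc]
      exact (key D hD).2.2.2
    rw [Finset.card_erase_of_mem hC] at hsum
    omega
  · have hT := thin_of_mem_twords hC le_rfl (by norm_num) rfl fun v hv hv' => by
      obtain rfl | rfl : v = 1 ∨ v = 3 := by omega
      · exact h1
      · exact h3
    have h5 := (mem_twords.1 hC).1
    have h6 := hT.card_twelve_five_le h5
    have h8 := card_flats_inter_three_le C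
    rw [h5, show Nat.choose 5 3 = 10 from rfl] at h8
    have key : ∀ D ∈ twords φ 7, IsWord (symmDiff D C) ∧
        (symmDiff D C ∩ C).card + (D ∩ C).card = 5 ∧ (symmDiff D C).card + 2 * (D ∩ C).card = 12 ∧
        ((D ∩ C).card = 0 ∨ (D ∩ C).card = 2) := by
      intro D hD
      have g6 := isWord_symmDiff_of_mem_twords hD hC
      have g7 := card_symmDiff_add D C
      have g8 := card_symmDiff_inter_add D C
      have g10 := (mem_twords.1 hD).1
      have g11 := g6.card_cases
      exact ⟨g6, by omega, by omega, by omega⟩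
    have k2 := (card_le_card_words (C := C) (v := 8) (P := fun A => (A ∩ C).card = 3)
      (𝒟 := (twords φ 7).filter fun D => (D ∩ C).card = 2) fun D hD => by
        rw [Finset.mem_filter] at hD
        obtain ⟨k1, k2, k3, -⟩ := key D hD.1
        exact ⟨mem_words.2 ⟨by omega, k1⟩, by omega⟩).trans h8
    have k0 := (card_le_card_words (C := C) (v := 12) (P := fun A => C ⊆ A)
      (𝒟 := (twords φ 7).filter fun D => (D ∩ C).card = 0) fun D hD => by
        rw [Finset.mem_filter] at hD
        obtain ⟨k1, k2, k3, -⟩ := key D hD.1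
        refine ⟨mem_words.2 ⟨by omega, k1⟩, ?_⟩
        rw [← Finset.inter_eq_right]
        exact Finset.eq_of_subset_of_card_le Finset.inter_subset_right (by omega)).trans h6
    have hsum : (twords φ 7).card ≤ ((twords φ 7).filter fun D => (D ∩ C).card = 0).card
        + ((twords φ 7).filter fun D => (D ∩ C).card = 2).card := by
      refine le_trans (Finset.card_le_card fun D hD => ?_) (Finset.card_union_le _ _)
      simp only [Finset.mem_union, Finset.mem_filter, hD, true_and]
      exact (key D hD).2.2.2
    omega

lemma sum_Q_vanishing {φ : (V → ZMod 2) → ZMod 2} (hφ : ∀ p q, φ (p + q) = φ p + φ q)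
    (a : ℕ → ℤ) (n : ℕ) (ha : ∀ S ∈ ({0, 16, -16, 32, -32, 64, -64, 128, -128} : Finset ℤ),
      ∑ w ∈ Finset.range n, a w * kraw 256 S w = 0) :
    (Q.card : ℤ) * ∑ w ∈ Finset.range n, a w * (twords φ w).card
      = ∑ w ∈ Finset.range n, a w * kraw 256 256 w
        + sg (φ 1) * ∑ w ∈ Finset.range n, a w * kraw 256 (-256) w := by
  have h0 : φ 0 = 0 := by
    have := hφ 0 0
    rwa [add_zero, add_self_eq] at this
  have h1 : ∀ w, ∑ q ∈ Q, sg (φ q) * kraw 256 (∑ x, sg (q x)) w = Q.card * (twords φ w).card := by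
    intro w
    have h2 := sum_Q_esum (fun _ => 1) φ hφ w
    simp only [one_mul, Finset.prod_const_one, Finset.sum_const, nsmul_eq_mul, mul_one] at h2
    rw [← h2]
    refine Finset.sum_congr rfl fun q _ => ?_
    rw [esum_eq_kraw _ _ fun x _ => sg_mul_self _, card_V]
  have h2 : (Q.card : ℤ) * ∑ w ∈ Finset.range n, a w * (twords φ w).card
      = ∑ q ∈ Q, sg (φ q) * ∑ w ∈ Finset.range n, a w * kraw 256 (∑ x, sg (q x)) w := by
    simp only [Finset.mul_sum]
    rw [Finset.sum_comm]
    refine Finset.sum_congr rfl fun w _ => ?_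
    rw [mul_left_comm, ← h1, Finset.mul_sum]
    refine Finset.sum_congr rfl fun q _ => ?_
    ring
  have h01 : (0 : V → ZMod 2) ≠ 1 := fun h => zero_ne_one (congrFun h 0)
  rw [h2, ← Finset.sum_subset (s₁ := {0, 1}), Finset.sum_pair h01, h0]
  · simp only [Pi.zero_apply, Pi.one_apply, sg_zero, sg_one, Finset.sum_const, card_V, one_mul]
    rfl
  · simp [Finset.insert_subset_iff, zero_mem_Q, one_mem_Q]
  · intro q hq hq01
    rw [ha, mul_zero]
    have h3 : ∑ x, sg (q x) ≠ 256 := fun h => hq01 (by simp [eq_zero_of_sum_sg h])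
    have h4 : ∑ x, sg (q x) ≠ -256 := by
      intro h
      have h5 : ∑ x, sg ((q + 1) x) = 256 := by
        simp only [Pi.add_apply, sg_add, Pi.one_apply, sg_one, mul_neg, mul_one,
          Finset.sum_neg_distrib, h, neg_neg]
      exact hq01 (by simp [add_eq_zero_iff.1 (eq_zero_of_sum_sg h5)])
    have h5 := sum_sg_cases hq
    simp only [sq_eq_sq_iff_eq_or_eq_neg, h3, h4] at h5
    simp only [Finset.mem_insert, Finset.mem_singleton]
    tauto

/-- The expansion of the degree nine polynomial vanishing at the intermediate character sums. -/
def nineCoeff : ℕ → ℤ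
  | 1 => 5179026988800
  | 3 => 119426227200
  | 5 => 263424000
  | 7 => -64068480
  | 9 => 362880
  | _ => 0

/-- The expansion of the degree ten polynomial vanishing at the intermediate character sums. -/
def tenCoeff : ℕ → ℤ
  | 0 => 1325830909132800
  | 2 => 40692315686400
  | 4 => 544087756800
  | 6 => -14436576000
  | 8 => -422553600
  | 10 => 3628800
  | _ => 0

lemma card_twords_nine {φ : (V → ZMod 2) → ZMod 2} (hφ : ∀ p q, φ (p + q) = φ p + φ q)
    (h : φ 1 = 1) (h1 : twords φ 1 = ∅) (h3 : twords φ 3 = ∅) :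
    (256 : ℤ) * (263424000 * (twords φ 5).card - 64068480 * (twords φ 7).card
      + 362880 * (twords φ 9).card) = 1325830909132800 - 422553600 * 3108960 := by
  have g1 := sum_Q_vanishing hφ nineCoeff 10 (by decide +kernel)
  have g2 := sum_Q_vanishing (φ := fun _ => 0) (by simp) tenCoeff 11 (by decide +kernel)
  have g3 : 2 * ∑ w ∈ Finset.range 11, tenCoeff w * kraw 256 256 w = 256 *
      (∑ w ∈ Finset.range 10, nineCoeff w * kraw 256 256 w
        + -1 * ∑ w ∈ Finset.range 10, nineCoeff w * kraw 256 (-256) w) := by decide +kernel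
  have g4 : ∑ w ∈ Finset.range 11, tenCoeff w * kraw 256 (-256) w
      = ∑ w ∈ Finset.range 11, tenCoeff w * kraw 256 256 w := by decide +kernel
  rw [h, sg_one] at g1
  rw [sg_zero, one_mul, g4, ← two_mul, g3, ← g1, mul_left_comm] at g2
  have g5 := mul_left_cancel₀ card_Q_pos.ne' g2
  simp only [twords_zero, Finset.sum_range_succ, Finset.sum_range_zero, nineCoeff, tenCoeff, h1, h3,
    card_words_eight, Finset.card_empty] at g5
  rw [words_eq_empty (w := 2) (by norm_num), words_eq_empty (w := 4) (by norm_num),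
    words_eq_empty (w := 6) (by norm_num), words_eq_empty (w := 10) (by norm_num),
    show (words 0).card = 1 by
      rw [Finset.card_eq_one]
      refine ⟨∅, ?_⟩
      ext C
      simp only [mem_words, Finset.card_eq_zero, Finset.mem_singleton, and_iff_left_iff_imp]
      rintro rfl u v a b
      simp] at g5
  simp only [Finset.card_empty] at g5
  push_cast at g5
  linarith

/-- The coefficients of the certificate when the functional is not supported on three points. -/
def oddCoeff : ℕ → ℤ
  | 0 => 190535257069134
  | 1 => -9141815285429
  | 2 => 18770693806902
  | 3 => -517813976267
  | 4 => 1455586789879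
  | 5 => -19447587130
  | 6 => 93726705390
  | 7 => -484741853
  | 8 => 4863181155
  | 9 => -6121113
  | 10 => 191328151
  | 12 => 5084278
  | 14 => 68574
  | _ => 0

lemma nl_le_of_odd {f : V → ZMod 2} (hf : ∑ x, f x = 1) : nl (n := 8) 2 f ≤ 96 := by
  rcases (twords (pair f) 1).eq_empty_or_nonempty with h1 | ⟨C, hC⟩
  · rcases (twords (pair f) 3).eq_empty_or_nonempty with h3 | ⟨C, hC⟩
    · by_contra! hn
      have h := odd_certificate hf hn oddCoeff 677733813 3712798 (-699355640918) (by decide +kernel)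
        (by decide +kernel) (by decide +kernel) (by decide +kernel) (by decide +kernel)
        (by decide +kernel) (tsum_ge_of_odd hf)
      have h9 := card_twords_nine (pair_add f) (by simpa [pair] using hf) h1 h3
      have h5 : ((twords (pair f) 5).card : ℤ) ≤ 6 := by
        exact_mod_cast card_twords_five_le h1 h3
      have h7 : ((twords (pair f) 7).card : ℤ) ≤ 6006 := by
        exact_mod_cast card_twords_seven_le h1 h3
      rw [h1, h3] at h
      simp only [oddCoeff, abs_neg, Finset.card_empty, Nat.cast_zero, mul_zero, zero_add,
        Nat.abs_ofNat] at h
      linarith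
    · rw [mem_twords] at hC
      obtain ⟨hC, hC'⟩ := hC
      obtain ⟨a, b, c, hab, hac, hbc, rfl⟩ := Finset.card_eq_three.1 hC
      refine nl_le_of_three hf (a := a) (b := b) (c := c) fun q hq => ?_
      rw [← hC' q hq, Finset.sum_insert (by simp [hab, hac]), Finset.sum_pair hbc, add_assoc]
  · rw [mem_twords] at hC
    obtain ⟨hC, hC'⟩ := hC
    obtain ⟨a, rfl⟩ := Finset.card_eq_one.1 hC
    refine nl_le_of_three hf (a := a) (b := a) (c := a) fun q hq => ?_
    rw [← hC' q hq, Finset.sum_singleton, add_add_cancel]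

end SecondOrder

/-- For every `f ∈ B_8`, `nl_2(f) ≤ 96`. -/
theorem stmt1 : ∀ f : BF 8, nl 2 f ≤ 96 := by
  intro f
  rcases SecondOrder.zmod2_cases (∑ x, f x) with h | h
  · exact SecondOrder.nl_le_of_even h
  · exact SecondOrder.nl_le_of_odd h
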